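/- Let η ∈ {1,2} and let q, r, s be primes with q ≡ 3 (mod 4), r ≡ s ≡ 5 (mod 8), Legendre symbols (q/r) = (q/s) = (−1)^{δ_{η,2}} and (r/s) = 1, and assume the non-square condition. Let m be the integer with h₂(ηqrs) = 2^{m+1} and set K′ = ℚ(√r, √(ηqs)). Then for every integer n ≥ 0, the 2-Sylow subgroup of the ideal class group of the n-th layer K′_n of the cyclotomic ℤ₂-extension of K′ is isomorphic to ℤ/2ℤ × ℤ/2^mℤ; in particular A(K′) ≅ ℤ/2ℤ × ℤ/2^mℤ. -/

import Mathlib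

open IntermediateField NumberField

/-- The `n`-th layer `k(2·cos(2π/2^(n+2)))` of the cyclotomic `ℤ₂`-extension of a
(totally real) subfield of `ℝ`. -/
noncomputable def layer (F : IntermediateField ℚ ℝ) (n : ℕ) : IntermediateField ℚ ℝ :=
  F ⊔ IntermediateField.adjoin ℚ {2 * Real.cos (2 * Real.pi / 2 ^ (n + 2))}

/-- The 2-part of the class number of a subfield of `ℝ` (the largest power of 2 dividing
the cardinality of the class group of its ring of integers). -/
noncomputable def h2 (F : IntermediateField ℚ ℝ) : ℕ :=
  2 ^ ((Nat.card (ClassGroup (NumberField.RingOfIntegers F))).factorization 2)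


open IntermediateField NumberField

set_option linter.all false
namespace Wk

section abs
variable {X : Type*} [CommGroup X]

/-- fixed subgroup -/
def fixS (σ : X →* X) : Subgroup X where
  carrier := {x | σ x = x}
  mul_mem' := by intro a b ha hb; simp_all
  one_mem' := by simp
  inv_mem' := by intro a ha; simp_all

@[simp] lemma mem_fixS (σ : X →* X) (x : X) : x ∈ fixS σ ↔ σ x = x := Iff.rfl

/-- `x / σ x` -/
def psi (σ : X →* X) : X →* X := (MonoidHom.id X) / σ
/-- `x * σ x` -/
def nu (σ : X →* X) : X →* X := (MonoidHom.id X) * σ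

@[simp] lemma psi_apply (σ : X →* X) (x : X) : psi σ x = x / σ x := rfl
@[simp] lemma nu_apply (σ : X →* X) (x : X) : nu σ x = x * σ x := rfl

lemma ker_psi (σ : X →* X) : (psi σ).ker = fixS σ := by
  ext x; rw [MonoidHom.mem_ker, psi_apply, div_eq_one, mem_fixS, eq_comm]

lemma comap_map_sup {Y : Type*} [CommGroup Y] (f : X →* Y) (H : Subgroup X) :
    (H.map f).comap f = H ⊔ f.ker := Subgroup.comap_map_eq f H

variable {I : Type*} [CommGroup I]

/-- Abstract ambiguous class number formula, first form. -/
theorem abs_chev (σ : X →* X) (s : I →* I) (d : X →* I)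
    (hσ : ∀ x, σ (σ x) = x) (hs : ∀ x, s (s x) = x) (hd : ∀ x, d (σ x) = s (d x))
    (h90 : ∀ x, x * σ x = 1 → ∃ y, x = y / σ y)
    (h90I : ∀ x, x * s x = 1 → ∃ y, x = y / s y)
    (J : Subgroup I) (hJ : J ≤ fixS s) (hPJ : (fixS σ).map d ≤ J) :
    d.range.relIndex (d.range.comap (psi s)) *
      ((d.ker.map (psi σ)).relIndex (d.ker ⊓ (nu σ).ker)) =
    ((d.ker.map (nu σ)).relIndex (d.ker ⊓ (nu σ).range)) * J.relIndex (fixS s) *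
      ((fixS σ).map d).relIndex J := by
  set P := d.range with hP
  set E := d.ker with hE
  have c1 : (P.comap (psi s)) ⊓ (fixS s) = fixS s := by
    rw [inf_eq_right]; intro a ha; simp only [mem_fixS] at ha
    simp [Subgroup.mem_comap, ha, P.one_mem]
  have hle : P ⊔ fixS s ≤ P.comap (psi s) := by
    apply sup_le
    · rintro _ ⟨x, rfl⟩
      exact ⟨x / σ x, by simp [hd]⟩
    · rw [← c1]; exact inf_le_left
  -- chain
  have e1 : P.relIndex (P.comap (psi s)) =
      P.relIndex (P ⊔ fixS s) * (P ⊔ fixS s).relIndex (P.comap (psi s)) :=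
    (Subgroup.relIndex_mul_relIndex _ _ _ le_sup_left hle).symm
  have e2 : P.relIndex (P ⊔ fixS s) = P.relIndex (fixS s) := by
    rw [sup_comm, Subgroup.relIndex_sup_right]
  -- (P ⊔ I^σ).relIndex I' = (psi P).relIndex P^-
  have e3 : (P ⊔ fixS s).relIndex (P.comap (psi s)) =
      (P.map (psi s)).relIndex (P ⊓ (nu s).ker) := by
    have h1 : (P.comap (psi s)).map (psi s) = P ⊓ (nu s).ker := by
      ext b; constructor
      · rintro ⟨a, ha, rfl⟩
        refine ⟨ha, ?_⟩
        simp [MonoidHom.mem_ker, hs, div_mul_div_comm, mul_comm]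
      · rintro ⟨hb, hb2⟩
        obtain ⟨a, ha⟩ := h90I b (by simpa [MonoidHom.mem_ker] using hb2)
        exact ⟨a, by simpa [Subgroup.mem_comap, ← ha] using hb, by simp [← ha]⟩
    rw [← h1, ← Subgroup.relIndex_comap, comap_map_sup, ker_psi]
  have e4 : (P.map (psi s)).relIndex (P ⊓ (nu s).ker) =
      (E.map (nu σ)).relIndex (E ⊓ (nu σ).range) := by
    have h1 : (E.comap (nu σ)).map d = P ⊓ (nu s).ker := by
      ext b; constructor
      · rintro ⟨a, ha, rfl⟩
        refine ⟨⟨a, rfl⟩, ?_⟩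
        have : d (a * σ a) = 1 := ha
        simpa [MonoidHom.mem_ker, hd] using this
      · rintro ⟨⟨a, rfl⟩, hb2⟩
        refine ⟨a, ?_, rfl⟩
        change d (a * σ a) = 1
        simpa [MonoidHom.mem_ker, hd] using hb2
    have h2 : (P.map (psi s)).comap d = E ⊔ (nu σ).ker := by
      have : P.map (psi s) = ((nu σ).ker).map d := by
        ext b; constructor
        · rintro ⟨_, ⟨a, rfl⟩, rfl⟩
          exact ⟨a / σ a, by simp [MonoidHom.mem_ker, hσ, div_mul_div_comm, mul_comm], by simp [hd]⟩
        · rintro ⟨x, hx, rfl⟩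
          obtain ⟨y, rfl⟩ := h90 x (by simpa [MonoidHom.mem_ker] using hx)
          exact ⟨d y, ⟨y, rfl⟩, by simp [hd]⟩
      rw [this, comap_map_sup, sup_comm]
    have h3 : (E.comap (nu σ)).map (nu σ) = E ⊓ (nu σ).range := by
      rw [Subgroup.map_comap_eq, inf_comm]
    rw [← h1, ← Subgroup.relIndex_comap, h2, ← h3, ← Subgroup.relIndex_comap, comap_map_sup]
  have e5 : ((fixS σ).map d).relIndex (P ⊓ fixS s) = (E.map (psi σ)).relIndex (E ⊓ (nu σ).ker) := by
    have h1 : (E.comap (psi σ)).map d = P ⊓ fixS s := by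
      ext b; constructor
      · rintro ⟨a, ha, rfl⟩
        refine ⟨⟨a, rfl⟩, ?_⟩
        have : d (a / σ a) = 1 := ha
        rw [map_div, hd, div_eq_one] at this
        exact this.symm
      · rintro ⟨⟨a, rfl⟩, hb2⟩
        refine ⟨a, ?_, rfl⟩
        change d (a / σ a) = 1
        rw [map_div, hd, div_eq_one]
        exact hb2.symm
    have h3 : (E.comap (psi σ)).map (psi σ) = E ⊓ (nu σ).ker := by
      ext b; constructor
      · rintro ⟨a, ha, rfl⟩
        refine ⟨ha, ?_⟩
        simp [MonoidHom.mem_ker, hσ, div_mul_div_comm, mul_comm]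
      · rintro ⟨hb, hb2⟩
        obtain ⟨a, ha⟩ := h90 b (by simpa [MonoidHom.mem_ker] using hb2)
        exact ⟨a, by simpa [Subgroup.mem_comap, ← ha] using hb, by simp [← ha]⟩
    rw [← h1, ← h3, ← Subgroup.relIndex_comap, ← Subgroup.relIndex_comap, comap_map_sup,
      comap_map_sup, ker_psi, sup_comm]
  have e6 : ((fixS σ).map d).relIndex (P ⊓ fixS s) * P.relIndex (fixS s) =
      ((fixS σ).map d).relIndex J * J.relIndex (fixS s) := by
    have h1 : (fixS σ).map d ≤ P ⊓ fixS s := by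
      apply le_inf
      · rintro _ ⟨x, _, rfl⟩; exact ⟨x, rfl⟩
      · exact hPJ.trans hJ
    rw [Subgroup.relIndex_mul_relIndex _ _ _ hPJ hJ, ← Subgroup.inf_relIndex_right P,
      Subgroup.relIndex_mul_relIndex _ _ _ h1 inf_le_right]
  rw [e1, e2, e3, e4]
  rw [e5] at e6
  calc _ = (E.map (nu σ)).relIndex (E ⊓ (nu σ).range) * ((E.map (psi σ)).relIndex (E ⊓ (nu σ).ker) * P.relIndex (fixS s)) := by ring
    _ = _ := by rw [e6]; ring

end abs

end Wk

open IntermediateField NumberField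
set_option linter.all false
namespace Wk
section abs
variable {X : Type*} [CommGroup X]

/-- squaring -/
def sq : X →* X := powMonoidHom 2
@[simp] lemma sq_apply (x : X) : sq x = x ^ 2 := rfl

lemma relIndex_sup_inf (A B E : Subgroup X) (hA : A ≤ E) :
    (A ⊔ B).relIndex E = (A ⊔ (E ⊓ B)).relIndex E := by
  rw [← Subgroup.inf_relIndex_right, ← Subgroup.inf_relIndex_right (A ⊔ (E ⊓ B))]
  congr 1
  ext x
  simp only [Subgroup.mem_inf]
  constructor
  · rintro ⟨h, hx⟩
    obtain ⟨a, ha, b, hb, rfl⟩ := Subgroup.mem_sup.1 h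
    refine ⟨Subgroup.mem_sup.2 ⟨a, ha, b, ⟨?_, hb⟩, rfl⟩, hx⟩
    exact (Subgroup.mul_mem_cancel_left E (hA ha)).1 hx
  · rintro ⟨h, hx⟩
    exact ⟨sup_le_sup_left inf_le_right A h, hx⟩

theorem herb1 (σ : X →* X) (E : Subgroup X) (hσ : ∀ x, σ (σ x) = x) (hE : ∀ x ∈ E, σ x ∈ E) :
    (E.map (nu σ)).relIndex (E ⊓ fixS σ) * ((E ⊓ (nu σ).ker).map sq).relIndex (E ⊓ (nu σ).ker) =
    (E.map (psi σ)).relIndex (E ⊓ (nu σ).ker) * ((E ⊓ fixS σ).map sq).relIndex (E ⊓ fixS σ) := by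
  have a1 : (E ⊓ fixS σ).map sq = (E ⊓ fixS σ).map (nu σ) := by
    ext y; constructor
    · rintro ⟨x, hx, rfl⟩; refine ⟨x, hx, ?_⟩
      have : σ x = x := hx.2
      simp [this, sq_apply, _root_.sq, pow_two]
    · rintro ⟨x, hx, rfl⟩; refine ⟨x, hx, ?_⟩
      have : σ x = x := hx.2
      simp [this, pow_two]
  have a2 : (E ⊓ (nu σ).ker).map sq = (E ⊓ (nu σ).ker).map (psi σ) := by
    have key : ∀ x ∈ (nu σ).ker, σ x = x⁻¹ := by
      intro x hx
      rw [MonoidHom.mem_ker, nu_apply] at hx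
      exact (inv_eq_of_mul_eq_one_right hx).symm
    ext y; constructor
    · rintro ⟨x, hx, rfl⟩; refine ⟨x, hx, ?_⟩
      simp [key x hx.2, pow_two]
    · rintro ⟨x, hx, rfl⟩; refine ⟨x, hx, ?_⟩
      simp [key x hx.2, pow_two]
  have b1 : E.map (nu σ) ≤ E ⊓ fixS σ := by
    rintro _ ⟨x, hx, rfl⟩
    exact ⟨E.mul_mem hx (hE x hx), by simp [hσ, mul_comm]⟩
  have b2 : E.map (psi σ) ≤ E ⊓ (nu σ).ker := by
    rintro _ ⟨x, hx, rfl⟩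
    exact ⟨E.div_mem hx (hE x hx), by simp [MonoidHom.mem_ker, hσ]⟩
  have c1 : ((E ⊓ fixS σ).map (nu σ)).relIndex (E.map (nu σ)) =
      ((E ⊓ fixS σ) ⊔ (E ⊓ (nu σ).ker)).relIndex E := by
    rw [← Subgroup.relIndex_comap, comap_map_sup, relIndex_sup_inf _ _ _ inf_le_left]
  have c2 : ((E ⊓ (nu σ).ker).map (psi σ)).relIndex (E.map (psi σ)) =
      ((E ⊓ fixS σ) ⊔ (E ⊓ (nu σ).ker)).relIndex E := by
    rw [← Subgroup.relIndex_comap, comap_map_sup, relIndex_sup_inf _ _ _ inf_le_left, ker_psi,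
      sup_comm]
  rw [a1, a2]
  rw [← Subgroup.relIndex_mul_relIndex _ _ _ (Subgroup.map_mono inf_le_left) b1,
    ← Subgroup.relIndex_mul_relIndex _ _ _ (Subgroup.map_mono inf_le_left) b2, c1, c2]
  ring

theorem herb2 (σ : X →* X) (E : Subgroup X) (hσ : ∀ x, σ (σ x) = x) (hE : ∀ x ∈ E, σ x ∈ E)
    (z : X) (hz : z ∈ E) (hz1 : z ≠ 1) (hz2 : z * z = 1) (hzσ : σ z = z)
    (htor : ∀ x ∈ E, x * x = 1 → x = 1 ∨ x = z) (hnsq : ∀ x ∈ E, x * x ≠ z)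
    (hfin : (E.map sq).relIndex E ≠ 0) :
    (E.map sq).relIndex E * 2 =
    ((E ⊓ fixS σ).map sq).relIndex (E ⊓ fixS σ) *
      ((E ⊓ (nu σ).ker).map sq).relIndex (E ⊓ (nu σ).ker) := by
  set P := E ⊓ fixS σ with hP
  set M := E ⊓ (nu σ).ker with hM
  set D := P ⊔ M with hD
  have hDE : D ≤ E := sup_le inf_le_left inf_le_left
  have hMi : ∀ x ∈ M, σ x = x⁻¹ := by
    intro x hx
    have : x * σ x = 1 := hx.2
    exact (inv_eq_of_mul_eq_one_right this).symm
  have hzP : z ∈ P := ⟨hz, hzσ⟩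
  have hzM : z ∈ M := ⟨hz, by
    change z * σ z = 1
    rw [hzσ, hz2]⟩
  have hPM : ∀ x ∈ P, x ∈ M → x = 1 ∨ x = z := by
    intro x hx hx'
    apply htor x hx.1
    have h1 : σ x = x := hx.2
    have h2 := hMi x hx'
    rw [h1] at h2
    nth_rw 1 [h2]; simp
  -- E^2 ≤ D
  have hsqD : E.map sq ≤ D := by
    rintro _ ⟨x, hx, rfl⟩
    have : sq x = (x * σ x) * (x / σ x) := by
      simp [pow_two]
    rw [this]
    apply Subgroup.mul_mem_sup
    · exact ⟨E.mul_mem hx (hE x hx), by simp [hσ, mul_comm]⟩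
    · exact ⟨E.div_mem hx (hE x hx), by simp [MonoidHom.mem_ker, hσ]⟩
  have s1 : (D.map sq).relIndex (E.map sq) = D.relIndex E := by
    rw [← Subgroup.relIndex_comap, comap_map_sup, relIndex_sup_inf _ _ _ hDE]
    congr 1
    rw [sup_eq_left]
    rintro x ⟨hx, hx2⟩
    rcases htor x hx (by rw [← pow_two]; exact hx2) with h | h
    · rw [h]; exact D.one_mem
    · rw [h]; exact (le_sup_left : P ≤ D) hzP
  have s2 : (E.map sq).relIndex E = (D.map sq).relIndex D := by
    have h1 := Subgroup.relIndex_mul_relIndex (D.map sq) (E.map sq) E (Subgroup.map_mono hDE)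
      (by rintro _ ⟨x, hx, rfl⟩; exact E.pow_mem hx 2)
    have h2 := Subgroup.relIndex_mul_relIndex (D.map sq) D E
      (by rintro _ ⟨x, hx, rfl⟩; exact D.pow_mem hx 2) hDE
    rw [s1] at h1
    have h3 : D.relIndex E ≠ 0 := by
      intro h0
      have := Subgroup.relIndex_mul_relIndex (E.map sq) D E hsqD hDE
      rw [h0, mul_zero] at this
      exact hfin this.symm
    have h4 : D.relIndex E * (E.map sq).relIndex E = D.relIndex E * (D.map sq).relIndex D := by
      rw [h1, ← h2, mul_comm]
    exact Nat.eq_of_mul_eq_mul_left (Nat.pos_of_ne_zero h3) h4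
  have hsqle : ∀ H : Subgroup X, H.map sq ≤ H := by
    rintro H _ ⟨x, hx, rfl⟩; exact H.pow_mem hx 2
  have hDsq : D.map sq = P.map sq ⊔ M.map sq := Subgroup.map_sup _ _ _
  have s3 : (D.map sq).relIndex D = (D.map sq).relIndex (P ⊔ M.map sq) *
      (P ⊔ M.map sq).relIndex D := by
    rw [Subgroup.relIndex_mul_relIndex]
    · rw [hDsq]; exact sup_le_sup_right (hsqle P) _
    · exact sup_le_sup_left (hsqle M) _
  have s4 : (D.map sq).relIndex (P ⊔ M.map sq) = (P.map sq).relIndex P := by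
    have : P ⊔ M.map sq = P ⊔ D.map sq := by
      rw [hDsq, ← sup_assoc, sup_eq_left.2 (hsqle P)]
    rw [this, Subgroup.relIndex_sup_right]
    rw [← Subgroup.inf_relIndex_right]
    congr 1
    ext x
    constructor
    · rintro ⟨hx, hxP⟩
      rw [hDsq] at hx
      obtain ⟨_, ⟨u, hu, rfl⟩, _, ⟨v, hv, rfl⟩, rfl⟩ := Subgroup.mem_sup.1 hx
      have h1 : sq v ∈ P := (P.mul_mem_cancel_left (P.pow_mem hu 2)).1 hxP
      have h2 : sq v = 1 := by
        rcases hPM _ h1 (M.pow_mem hv 2) with h | h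
        · exact h
        · exact absurd (by rw [← h, sq_apply, pow_two]) (hnsq v hv.1)
      rw [h2, mul_one]; exact ⟨u, hu, rfl⟩
    · rintro ⟨u, hu, rfl⟩
      exact ⟨⟨u, (le_sup_left : P ≤ D) hu, rfl⟩, P.pow_mem hu 2⟩
  have s5 : (P ⊔ M.map sq).relIndex D * 2 = (M.map sq).relIndex M := by
    have : D = M ⊔ (P ⊔ M.map sq) := by
      rw [hD, sup_comm M, sup_assoc, sup_eq_right.2 (hsqle M)]
    rw [this, Subgroup.relIndex_sup_right]
    have h1 : (P ⊔ M.map sq) ⊓ M = M.map sq ⊔ Subgroup.zpowers z := by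
      ext x; constructor
      · rintro ⟨hx, hxM⟩
        obtain ⟨u, hu, v, hv, rfl⟩ := Subgroup.mem_sup.1 hx
        have : u ∈ M := (M.mul_mem_cancel_right (hsqle M hv)).1 hxM
        rw [mul_comm]
        apply Subgroup.mul_mem_sup hv
        rcases hPM u hu this with h | h <;> rw [h]
        · exact Subgroup.one_mem _
        · exact Subgroup.mem_zpowers z
      · intro hx
        have : M.map sq ⊔ Subgroup.zpowers z ≤ (P ⊔ M.map sq) ⊓ M := by
          apply sup_le
          · exact le_inf le_sup_right (hsqle M)
          · rw [Subgroup.zpowers_le]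
            exact ⟨(le_sup_left : P ≤ _) hzP, hzM⟩
        exact this hx
    rw [← Subgroup.inf_relIndex_right, h1]
    have h2 : (M.map sq).relIndex (M.map sq ⊔ Subgroup.zpowers z) = 2 := by
      rw [sup_comm, Subgroup.relIndex_sup_right]
      have h3 : M.map sq ⊓ Subgroup.zpowers z = ⊥ := by
        rw [eq_bot_iff]
        rintro x ⟨⟨v, hv, rfl⟩, hx⟩
        rcases hPM _ ((Subgroup.zpowers_le.2 hzP) hx) (M.pow_mem hv 2) with h | h
        · exact h
        · exact absurd (by rw [← h, sq_apply, pow_two]) (hnsq v hv.1)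
      rw [← Subgroup.inf_relIndex_right, h3, Subgroup.relIndex_bot_left, Nat.card_zpowers]
      exact orderOf_eq_prime (by rw [pow_two, hz2]) hz1
    rw [mul_comm, ← h2, Subgroup.relIndex_mul_relIndex]
    · exact le_sup_left
    · exact sup_le (hsqle M) (Subgroup.zpowers_le.2 hzM)
  rw [s2, s3, s4, mul_assoc, s5]

variable {I : Type*} [CommGroup I]

/-- Abstract ambiguous class number formula. -/
theorem abs_chev2 (σ : X →* X) (s : I →* I) (d : X →* I)
    (hσ : ∀ x, σ (σ x) = x) (hs : ∀ x, s (s x) = x) (hd : ∀ x, d (σ x) = s (d x))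
    (h90 : ∀ x, x * σ x = 1 → ∃ y, x = y / σ y)
    (h90I : ∀ x, x * s x = 1 → ∃ y, x = y / s y)
    (J : Subgroup I) (hJ : J ≤ fixS s) (hPJ : (fixS σ).map d ≤ J)
    (z : X) (hz : z ∈ d.ker) (hz1 : z ≠ 1) (hz2 : z * z = 1) (hzσ : σ z = z)
    (htor : ∀ x ∈ d.ker, x * x = 1 → x = 1 ∨ x = z) (hnsq : ∀ x ∈ d.ker, x * x ≠ z)
    (N : ℕ) (hN : (d.ker.map sq).relIndex d.ker = 2 ^ (2 * N))
    (hN' : ((d.ker ⊓ fixS σ).map sq).relIndex (d.ker ⊓ fixS σ) = 2 ^ N) :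
    d.range.relIndex (d.range.comap (psi s)) * 2 *
      (nu σ).range.relIndex (d.ker ⊓ fixS σ) =
      J.relIndex (fixS s) * ((fixS σ).map d).relIndex J := by
  have hE : ∀ x ∈ d.ker, σ x ∈ d.ker := by
    intro x hx; rw [MonoidHom.mem_ker] at *; rw [hd, hx, map_one]
  have h0 := abs_chev σ s d hσ hs hd h90 h90I J hJ hPJ
  have h1 := herb1 σ d.ker hσ hE
  have h2 := herb2 σ d.ker hσ hE z hz hz1 hz2 hzσ htor hnsq (by rw [hN]; positivity)
  rw [hN, hN'] at h2
  rw [hN'] at h1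
  have h3 : ((d.ker ⊓ (nu σ).ker).map sq).relIndex (d.ker ⊓ (nu σ).ker) = 2 ^ N * 2 := by
    have : 2 ^ (2 * N) * 2 = 2 ^ N * (2 ^ N * 2) := by ring
    rw [this] at h2
    exact (Nat.eq_of_mul_eq_mul_left (by positivity) h2).symm
  rw [h3] at h1
  have h4 : (d.ker.map (psi σ)).relIndex (d.ker ⊓ (nu σ).ker) =
      2 * (d.ker.map (nu σ)).relIndex (d.ker ⊓ fixS σ) := by
    apply Nat.eq_of_mul_eq_mul_right (show 0 < 2 ^ N by positivity)
    rw [← h1]; ring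
  have hle : d.ker.map (nu σ) ≤ d.ker ⊓ (nu σ).range := by
    rintro _ ⟨x, hx, rfl⟩
    exact ⟨d.ker.mul_mem hx (hE x hx), ⟨x, rfl⟩⟩
  have hle2 : d.ker ⊓ (nu σ).range ≤ d.ker ⊓ fixS σ := by
    apply inf_le_inf_left
    rintro _ ⟨x, rfl⟩
    simp [hσ, mul_comm]
  have h5 := Subgroup.relIndex_mul_relIndex _ _ _ hle hle2
  have h6 : (d.ker ⊓ (nu σ).range).relIndex (d.ker ⊓ fixS σ) =
      (nu σ).range.relIndex (d.ker ⊓ fixS σ) := by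
    rw [← Subgroup.inf_relIndex_right, ← Subgroup.inf_relIndex_right (nu σ).range]
    congr 1
    ext x
    simp only [Subgroup.mem_inf]
    tauto
  rw [h6] at h5
  have h7 : (d.ker.map (nu σ)).relIndex (d.ker ⊓ (nu σ).range) ≠ 0 := by
    intro h
    rw [h, zero_mul] at h5
    have hle3 : (d.ker ⊓ fixS σ).map sq ≤ d.ker.map (nu σ) := by
      rintro _ ⟨x, hx, rfl⟩
      refine ⟨x, hx.1, ?_⟩
      have : σ x = x := hx.2
      simp [this, pow_two]
    have := Subgroup.relIndex_mul_relIndex _ _ _ hle3 (hle.trans hle2)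
    rw [← h5, mul_zero, hN'] at this
    exact absurd this.symm (by positivity)
  rw [h4, ← h5] at h0
  apply Nat.eq_of_mul_eq_mul_left (Nat.pos_of_ne_zero h7)
  linarith

end abs
end Wk

open IntermediateField NumberField
set_option linter.all false
namespace Wk
open scoped nonZeroDivisors
section ideals
variable (K : Type*) [Field K] [NumberField K]
variable {L : Type*} [Field L] [NumberField L]
variable {M : Type*} [Field M] [NumberField M]

/-- group of fractional ideals -/
abbrev Id := (FractionalIdeal (𝓞 K)⁰ K)ˣ
/-- principal ideals -/
noncomputable def pr : Kˣ →* Id K := toPrincipalIdeal (𝓞 K) K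
/-- class group -/
abbrev Cl := Id K ⧸ (pr K).range

variable {K}
/-- map on integers -/
noncomputable abbrev om (φ : K →+* L) : 𝓞 K →+* 𝓞 L := RingOfIntegers.mapRingHom φ

lemma om_inj (φ : K →+* L) : Function.Injective (om φ) := by
  intro x y h
  apply RingOfIntegers.ext
  apply φ.injective
  have := congrArg (algebraMap (𝓞 L) L) h
  exact this

lemma om_le (φ : K →+* L) : (𝓞 K)⁰ ≤ Submonoid.comap (om φ) (𝓞 L)⁰ :=
  nonZeroDivisors_le_comap_nonZeroDivisors_of_injective _ (om_inj φ)

/-- extension of ideals -/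
noncomputable def iMap (φ : K →+* L) : Id K →* Id L :=
  Units.map (FractionalIdeal.extendedHom' L (om_le φ)).toMonoidHom

lemma coe_iMap (φ : K →+* L) (a : Id K) :
    (iMap φ a : FractionalIdeal (𝓞 L)⁰ L) = FractionalIdeal.extended L (om_le φ) (a : FractionalIdeal (𝓞 K)⁰ K) := rfl

lemma locmap (φ : K →+* L) : IsLocalization.map L (om φ) (om_le φ) = φ := by
  apply IsLocalization.ringHom_ext (𝓞 K)⁰
  ext x
  simp

lemma coe_pr (x : Kˣ) : (pr K x : FractionalIdeal (𝓞 K)⁰ K) = FractionalIdeal.spanSingleton _ (x:K) := by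
  simp [pr]

lemma iMap_pr (φ : K →+* L) (x : Kˣ) : iMap φ (pr K x) = pr L (Units.map φ.toMonoidHom x) := by
  ext1
  rw [coe_iMap, coe_pr, coe_pr, FractionalIdeal.extended_spanSingleton, locmap]
  rfl

lemma iMap_comp (φ : K →+* L) (ψ : L →+* M) (a : Id K) : iMap ψ (iMap φ a) = iMap (ψ.comp φ) a := by
  ext1
  rw [coe_iMap, coe_iMap, coe_iMap, FractionalIdeal.extended_extended]
  rfl

/-- ideal as unit -/
noncomputable def idu (a : Ideal (𝓞 K)) (ha : a ≠ ⊥) : Id K :=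
  Units.mk0 (a : FractionalIdeal (𝓞 K)⁰ K) (by simpa using ha)

@[simp] lemma coe_idu (a : Ideal (𝓞 K)) (ha : a ≠ ⊥) :
    (idu a ha : FractionalIdeal (𝓞 K)⁰ K) = a := rfl

lemma map_ne_bot (φ : K →+* L) {a : Ideal (𝓞 K)} (ha : a ≠ ⊥) : a.map (om φ) ≠ ⊥ := by
  intro h
  exact ha ((Ideal.map_eq_bot_iff_of_injective (om_inj φ)).1 h)

lemma iMap_idu (φ : K →+* L) (a : Ideal (𝓞 K)) (ha : a ≠ ⊥) :
    iMap φ (idu a ha) = idu (a.map (om φ)) (map_ne_bot φ ha) := by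
  ext1
  rw [coe_iMap, coe_idu, coe_idu, FractionalIdeal.extended_coeIdeal_eq_map]

lemma iMap_id (φ : K →+* K) (h : ∀ x, φ x = x) (a : Id K) : iMap φ a = a := by
  have h1 : φ = RingHom.id K := RingHom.ext h
  subst h1
  ext1
  rw [← FractionalIdeal.coeToSubmodule_inj, coe_iMap, FractionalIdeal.coe_extended_eq_span, locmap]
  simp
  exact Submodule.span_eq (FractionalIdeal.coeToSubmodule (a : FractionalIdeal (𝓞 K)⁰ K))

lemma idu_mul (a b : Ideal (𝓞 K)) (ha : a ≠ ⊥) (hb : b ≠ ⊥) :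
    idu (a * b) (mul_ne_zero ha hb) = idu a ha * idu b hb := by
  ext1; simp

lemma idu_inj {a b : Ideal (𝓞 K)} {ha : a ≠ ⊥} {hb : b ≠ ⊥} : idu a ha = idu b hb ↔ a = b := by
  rw [Units.ext_iff, coe_idu, coe_idu]; exact FractionalIdeal.coeIdeal_inj

lemma idu_span (x : 𝓞 K) (hx : x ≠ 0) :
    idu (Ideal.span {x}) (by simpa using hx) =
      pr K (Units.mk0 (x : K) (by simpa using hx)) := by
  ext1
  rw [coe_idu, coe_pr, FractionalIdeal.coeIdeal_span_singleton]
  rfl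

lemma exists_idu_div (a : Id K) : ∃ (n d : Ideal (𝓞 K)) (hn : n ≠ ⊥) (hd : d ≠ ⊥),
    a = idu n hn / idu d hd := by
  have h := FractionalIdeal.exists_eq_spanSingleton_mul (a : FractionalIdeal (𝓞 K)⁰ K)
  obtain ⟨x, I, hx, h⟩ := h
  have hI : I ≠ ⊥ := by
    rintro rfl
    apply a.ne_zero
    rw [h]; simp
  refine ⟨I, Ideal.span {x}, hI, by simpa using hx, ?_⟩
  rw [eq_div_iff_mul_eq']
  ext1
  simp only [Units.val_mul, coe_idu]
  rw [h, FractionalIdeal.coeIdeal_span_singleton, mul_right_comm, FractionalIdeal.spanSingleton_mul_spanSingleton]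
  rw [inv_mul_cancel₀ (by simpa using hx)]
  simp

lemma exists_idu_div_coprime (a : Id K) : ∃ (n d : Ideal (𝓞 K)) (hn : n ≠ ⊥) (hd : d ≠ ⊥),
    IsCoprime n d ∧ a = idu n hn / idu d hd := by
  obtain ⟨n, d, hn, hd, rfl⟩ := exists_idu_div a
  obtain ⟨n', d', h⟩ : ∃ n' d', n = (n ⊔ d) * n' ∧ d = (n ⊔ d) * d' := by
    obtain ⟨n', h1⟩ := Ideal.dvd_iff_le.2 (le_sup_left : n ≤ n ⊔ d)
    obtain ⟨d', h2⟩ := Ideal.dvd_iff_le.2 (le_sup_right : d ≤ n ⊔ d)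
    exact ⟨n', d', h1, h2⟩
  set g := n ⊔ d
  have hg : g ≠ ⊥ := fun h0 => hn (eq_bot_iff.2 (h0 ▸ (le_sup_left : n ≤ n ⊔ d)))
  have hn' : n' ≠ ⊥ := by rintro rfl; exact hn (by rw [h.1]; simp)
  have hd' : d' ≠ ⊥ := by rintro rfl; exact hd (by rw [h.2]; simp)
  refine ⟨n', d', hn', hd', ?_, ?_⟩
  · rw [Ideal.isCoprime_iff_sup_eq]
    have : g * (n' ⊔ d') = g * ⊤ := by
      rw [Ideal.mul_sup, ← h.1, ← h.2, Ideal.mul_top]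
    exact mul_left_cancel₀ (a := g) (by simpa using hg) this
  · have e1 : idu n hn = idu g hg * idu n' hn' := by rw [← idu_mul, idu_inj]; exact h.1
    have e2 : idu d hd = idu g hg * idu d' hd' := by rw [← idu_mul, idu_inj]; exact h.2
    rw [e1, e2]; simp

lemma iMap_inj (φ : K →+* L) : Function.Injective (iMap φ) := by
  letI := φ.toAlgebra
  intro a b h
  ext1
  have := congrArg Units.val h
  exact FractionalIdeal.extendedHom_injective (A := 𝓞 K) (K := K) L (𝓞 L) this

lemma Id_pow_inj {n : ℕ} (hn : n ≠ 0) {a b : Id K} (h : a ^ n = b ^ n) : a = b := by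
  suffices ∀ c : Id K, c ^ n = 1 → c = 1 by
    have := this (a / b) (by rw [div_pow, h, div_self'])
    exact div_eq_one.1 this
  intro c hc
  obtain ⟨x, y, hx, hy, hco, rfl⟩ := exists_idu_div_coprime c
  rw [div_pow, div_eq_one] at hc
  have h1 : x ^ n = y ^ n := by
    have := congrArg Units.val hc
    simp only [Units.val_pow_eq_pow_val, coe_idu] at this
    rw [← FractionalIdeal.coeIdeal_pow, ← FractionalIdeal.coeIdeal_pow] at this
    exact FractionalIdeal.coeIdeal_inj.1 this
  have h2 : IsCoprime (x ^ n) (y ^ n) := hco.pow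
  rw [h1] at h2
  have h3 : y = ⊤ := by
    have := Ideal.isCoprime_iff_sup_eq.1 h2
    rw [sup_idem] at this
    by_contra hy'
    have hle := Ideal.pow_le_self (I := y) hn
    rw [this, top_le_iff] at hle
    exact hy' hle
  have h4 : x = ⊤ := by
    by_contra hx'
    have hle := Ideal.pow_le_self (I := x) hn
    rw [h1, h3, Ideal.top_pow, top_le_iff] at hle
    exact hx' hle
  subst h3; subst h4
  simp

instance : Finite (Cl K) := by
  have : Finite (ClassGroup (𝓞 K)) := inferInstance
  exact Finite.of_equiv _ (ClassGroup.equiv (R := 𝓞 K) K).toEquiv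

end ideals
end Wk

open IntermediateField NumberField
set_option linter.all false
namespace Wk
open scoped nonZeroDivisors
section quad
variable {k : Type*} [Field k] [NumberField k]
variable {L : Type*} [Field L] [NumberField L]

/-- `L/k` is quadratic via `φ`, with nontrivial automorphism `σ`. -/
structure IsQuad (φ : k →+* L) (σ : L →+* L) : Prop where
  inv : ∀ x, σ (σ x) = x
  fixed : ∀ x, σ x = x → ∃ y, φ y = x
  map : ∀ y, σ (φ y) = φ y
  ne : ∃ x, σ x ≠ x

variable {φ : k →+* L} {σ : L →+* L}

lemma IsQuad.delta (h : IsQuad φ σ) : ∃ δ : L, δ ≠ 0 ∧ σ δ = -δ := by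
  obtain ⟨x, hx⟩ := h.ne
  refine ⟨x - σ x, sub_ne_zero.2 (Ne.symm hx), ?_⟩
  rw [map_sub, h.inv]; ring

lemma IsQuad.decomp (h : IsQuad φ σ) {δ : L} (hδ : δ ≠ 0) (hδ' : σ δ = -δ) (x : L) :
    ∃ a b : k, x = φ a + φ b * δ := by
  have h2 : (2 : L) ≠ 0 := two_ne_zero
  obtain ⟨a, ha⟩ := h.fixed ((x + σ x) / 2) (by simp only [map_div₀, map_add, h.inv, map_ofNat, add_comm])
  obtain ⟨b, hb⟩ := h.fixed ((x - σ x) / (2 * δ)) (by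
    simp only [map_div₀, map_sub, h.inv, map_mul, hδ', map_ofNat]; field_simp; ring)
  refine ⟨a, b, ?_⟩
  rw [ha, hb]; field_simp; ring

lemma IsQuad.finrank (h : IsQuad φ σ) : Module.finrank ℚ L = 2 * Module.finrank ℚ k ∧
    (letI := φ.toAlgebra; Module.finrank k L = 2) := by
  letI := φ.toAlgebra
  have key : Module.finrank k L = 2 := by
    obtain ⟨δ, hδ, hδ'⟩ := h.delta
    have hli : LinearIndependent k ![(1:L), δ] := by
      rw [LinearIndependent.pair_iff]
      intro s t hst
      have e1 : φ s + φ t * δ = 0 := by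
        have : s • (1:L) + t • δ = 0 := hst
        rw [Algebra.smul_def, Algebra.smul_def, mul_one] at this; exact this
      have e2 := congrArg σ e1
      rw [map_add, map_mul, h.map, h.map, hδ', map_zero] at e2
      have e3 : φ t * δ = 0 := by
        have h2 : (2:L) * (φ t * δ) = 0 := by linear_combination e1 - e2
        simpa using h2
      have e4 : φ t = 0 := by simpa [hδ] using e3
      have e5 : φ s = 0 := by rw [e4] at e1; simpa using e1
      exact ⟨by simpa using e5, by simpa using e4⟩
    have hsp : ⊤ ≤ Submodule.span k (Set.range ![(1:L), δ]) := by
      intro x _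
      obtain ⟨a, b, rfl⟩ := h.decomp hδ hδ' x
      have e1 : φ a + φ b * δ = a • (1:L) + b • δ := by
        rw [Algebra.smul_def, Algebra.smul_def, mul_one]; rfl
      rw [e1]
      refine Submodule.add_mem _ (Submodule.smul_mem _ _ (Submodule.subset_span ⟨0, rfl⟩))
        (Submodule.smul_mem _ _ (Submodule.subset_span ⟨1, rfl⟩))
    have := Module.finrank_eq_card_basis (Module.Basis.mk hli hsp)
    simpa using this
  refine ⟨?_, key⟩
  haveI : IsScalarTower ℚ k L := inferInstance
  rw [← Module.finrank_mul_finrank ℚ k L, key, mul_comm]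

lemma IsQuad.h90 (h : IsQuad φ σ) (x : Lˣ) (hx : x * Units.map σ.toMonoidHom x = 1) :
    ∃ y : Lˣ, x = y / Units.map σ.toMonoidHom y := by
  have hx' : (x : L) * σ x = 1 := congrArg Units.val hx
  by_cases h1 : (x : L) = -1
  · obtain ⟨δ, hδ, hδ'⟩ := h.delta
    refine ⟨Units.mk0 δ hδ, ?_⟩
    rw [eq_div_iff_mul_eq']
    ext
    simp only [Units.val_mul, Units.val_mk0]
    change (x : L) * σ δ = δ
    rw [h1, hδ']; ring
  · have h2 : (1 + x : L) ≠ 0 := fun h0 => h1 (by linear_combination h0)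
    refine ⟨Units.mk0 _ h2, ?_⟩
    rw [eq_div_iff_mul_eq']
    ext
    simp only [Units.val_mul, Units.val_mk0]
    change (x : L) * σ (1 + x) = 1 + x
    rw [map_add, map_one]; linear_combination hx'

lemma om_inv (h : IsQuad φ σ) (x : 𝓞 L) : om σ (om σ x) = x := by
  apply RingOfIntegers.ext
  exact h.inv _

/-- σ as ring equiv on integers -/
noncomputable def IsQuad.oe (h : IsQuad φ σ) : 𝓞 L ≃+* 𝓞 L :=
  RingEquiv.ofRingHom (om σ) (om σ) (RingHom.ext (om_inv h)) (RingHom.ext (om_inv h))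

lemma IsQuad.map_eq_comap (h : IsQuad φ σ) (a : Ideal (𝓞 L)) : a.map (om σ) = a.comap (om σ) := by
  have := Ideal.map_comap_of_equiv (I := a) h.oe
  exact this

lemma IsQuad.mem_map (h : IsQuad φ σ) (a : Ideal (𝓞 L)) (x : 𝓞 L) :
    x ∈ a.map (om σ) ↔ om σ x ∈ a := by
  rw [h.map_eq_comap]; rfl

lemma IsQuad.map_map (h : IsQuad φ σ) (a : Ideal (𝓞 L)) : (a.map (om σ)).map (om σ) = a := by
  ext x; rw [h.mem_map, h.mem_map, om_inv h]

lemma IsQuad.map_prime (h : IsQuad φ σ) (P : Ideal (𝓞 L)) [P.IsPrime] : (P.map (om σ)).IsPrime := by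
  rw [h.map_eq_comap]; exact Ideal.comap_isPrime _ _

lemma IsQuad.iMap_iMap (h : IsQuad φ σ) (a : Id L) : iMap σ (iMap σ a) = a := by
  rw [iMap_comp]; exact iMap_id _ h.inv a

lemma IsQuad.iMap_phi (h : IsQuad φ σ) (a : Id k) : iMap σ (iMap φ a) = iMap φ a := by
  rw [iMap_comp]
  have : σ.comp φ = φ := RingHom.ext h.map
  rw [this]

lemma IsQuad.fixed_int (h : IsQuad φ σ) (x : 𝓞 L) (hx : om σ x = x) : ∃ y : 𝓞 k, om φ y = x := by
  obtain ⟨y, hy⟩ := h.fixed x (congrArg (algebraMap (𝓞 L) L) hx)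
  have hyi : IsIntegral ℤ y := by
    have : IsIntegral ℤ (φ y) := by rw [hy]; exact x.2
    exact (isIntegral_algHom_iff φ.toIntAlgHom φ.injective).1 this
  refine ⟨⟨y, hyi⟩, ?_⟩
  apply RingOfIntegers.ext
  exact hy

lemma IsQuad.norm_int (h : IsQuad φ σ) (x : 𝓞 L) : ∃ y : 𝓞 k, om φ y = x * om σ x :=
  h.fixed_int _ (by rw [map_mul, om_inv h, mul_comm])

lemma h90I_aux (h : IsQuad φ σ) (a : Id L) (ha : a * iMap σ a = 1) : ∃ b, a = b / iMap σ b := by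
  obtain ⟨n, d, hn, hd, hco, rfl⟩ := exists_idu_div_coprime a
  refine ⟨idu n hn, ?_⟩
  rw [map_div, div_mul_div_comm, div_eq_one, iMap_idu, iMap_idu, ← idu_mul, ← idu_mul, idu_inj] at ha
  rw [iMap_idu]
  congr 1
  rw [idu_inj]
  have hco' : IsCoprime (n.map (om σ)) (d.map (om σ)) := by
    rw [Ideal.isCoprime_iff_sup_eq] at *
    rw [← Ideal.map_sup, hco, Ideal.map_top]
  apply dvd_antisymm
  · have : d ∣ n * n.map (om σ) := ⟨_, ha⟩
    exact hco.symm.dvd_of_dvd_mul_left this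
  · have : n.map (om σ) ∣ d * d.map (om σ) := ⟨n, by rw [← ha, mul_comm]⟩
    exact hco'.dvd_of_dvd_mul_right this

end quad
end Wk

open IntermediateField NumberField
set_option linter.all false
namespace Wk
open scoped nonZeroDivisors
section quad
variable {k : Type*} [Field k] [NumberField k]
variable {L : Type*} [Field L] [NumberField L]
variable {φ : k →+* L} {σ : L →+* L}

lemma absNorm_om_map (h : IsQuad φ σ) (a : Ideal (𝓞 k)) :
    Ideal.absNorm (a.map (om φ)) = Ideal.absNorm a ^ 2 := by
  letI := φ.toAlgebra
  have h1 : Module.finrank (𝓞 k) (𝓞 L) = 2 := by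
    rw [← h.finrank.2]
    exact (Algebra.IsAlgebraic.finrank_of_isFractionRing (𝓞 k) k (𝓞 L) L).symm
  rw [← h1]
  exact Ideal.absNorm_algebraMap (R := 𝓞 k) (S := 𝓞 L) (I := a)

lemma comap_ne_bot (φ : k →+* L) (P : Ideal (𝓞 L)) (hP : P ≠ ⊥) : P.comap (om φ) ≠ ⊥ := by
  letI := φ.toAlgebra
  intro h0
  apply hP
  exact Ideal.eq_bot_of_comap_eq_bot (R := 𝓞 k) h0

lemma absNorm_comap (φ : k →+* L) (P : Ideal (𝓞 L)) [P.IsPrime] (hP : P ≠ ⊥) :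
    ∃ f, 1 ≤ f ∧ Ideal.absNorm P = Ideal.absNorm (P.comap (om φ)) ^ f := by
  letI := φ.toAlgebra
  haveI : (P.comap (om φ)).IsPrime := Ideal.comap_isPrime _ _
  haveI : P.LiesOver (P.comap (om φ)) := ⟨rfl⟩
  have hb := comap_ne_bot φ P hP
  haveI : (P.comap (om φ)).IsMaximal := Ideal.IsPrime.isMaximal inferInstance hb
  exact ⟨_, Ideal.inertiaDeg'_pos (P.comap (om φ)) P,
    Ideal.absNorm_eq_pow_inertiaDeg'_of_liesOver P (P.comap (om φ)) inferInstance hb⟩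

lemma comap_map_sig (h : IsQuad φ σ) (P : Ideal (𝓞 L)) :
    (P.map (om σ)).comap (om φ) = P.comap (om φ) := by
  ext x
  rw [Ideal.mem_comap, h.mem_map, Ideal.mem_comap]
  have : om σ (om φ x) = om φ x := by
    apply RingOfIntegers.ext
    exact h.map _
  rw [this]

lemma absNorm_map_sig (h : IsQuad φ σ) (P : Ideal (𝓞 L)) :
    Ideal.absNorm (P.map (om σ)) = Ideal.absNorm P := by
  have e : (𝓞 L ⧸ P) ≃+* (𝓞 L ⧸ P.map (om σ)) := Ideal.quotientEquiv P (P.map (om σ)) h.oe rfl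
  rw [Ideal.absNorm_apply, Ideal.absNorm_apply, Submodule.cardQuot_apply, Submodule.cardQuot_apply]
  exact Nat.card_congr e.symm.toEquiv

lemma over_same (h : IsQuad φ σ) (P Q : Ideal (𝓞 L)) [P.IsPrime] [Q.IsPrime] (hP : P ≠ ⊥) (hQ : Q ≠ ⊥)
    (hc : P.comap (om φ) = Q.comap (om φ)) : Q = P ∨ Q = P.map (om σ) := by
  haveI hQm : Q.IsMaximal := Ideal.IsPrime.isMaximal inferInstance hQ
  haveI hPm : P.IsMaximal := Ideal.IsPrime.isMaximal inferInstance hP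
  haveI := h.map_prime P
  have h1 : (Q : Set (𝓞 L)) ⊆ P ∪ P.map (om σ) := by
    intro x hx
    obtain ⟨y, hy⟩ := h.norm_int x
    have h2 : y ∈ P.comap (om φ) := by
      rw [hc, Ideal.mem_comap, hy]; exact Ideal.mul_mem_right _ _ hx
    rw [Ideal.mem_comap, hy] at h2
    rcases Ideal.IsPrime.mem_or_mem inferInstance h2 with h3 | h3
    · exact Or.inl h3
    · exact Or.inr ((h.mem_map _ _).2 h3)
  rcases Ideal.subset_union.1 h1 with h2 | h2
  · exact Or.inl (hQm.eq_of_le hPm.ne_top h2)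
  · exact Or.inr (hQm.eq_of_le (Ideal.IsPrime.ne_top inferInstance) h2)

theorem prime_cases (h : IsQuad φ σ) (P : Ideal (𝓞 L)) [P.IsPrime] (hP : P ≠ ⊥) :
    (P.map (om σ) ≠ P ∧ (P.comap (om φ)).map (om φ) = P * P.map (om σ) ∧
      Ideal.absNorm P = Ideal.absNorm (P.comap (om φ))) ∨
    (P.map (om σ) = P ∧ (P.comap (om φ)).map (om φ) = P ∧
      Ideal.absNorm P = Ideal.absNorm (P.comap (om φ)) ^ 2) ∨
    (P.map (om σ) = P ∧ (P.comap (om φ)).map (om φ) = P ^ 2 ∧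
      Ideal.absNorm P = Ideal.absNorm (P.comap (om φ))) := by
  set p := P.comap (om φ) with hp
  obtain ⟨f, hf1, hf⟩ := absNorm_comap φ P hP
  rw [← hp] at hf
  haveI : p.IsPrime := Ideal.comap_isPrime _ _
  have hpb : p ≠ ⊥ := comap_ne_bot φ P hP
  have hN : 1 < Ideal.absNorm p := by
    have h0 : Ideal.absNorm p ≠ 0 := by rwa [Ne, Ideal.absNorm_eq_zero_iff]
    have h1 : Ideal.absNorm p ≠ 1 := by
      rw [Ne, Ideal.absNorm_eq_one_iff]; exact Ideal.IsPrime.ne_top inferInstance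
    omega
  have hPp : Prime P := Ideal.prime_of_isPrime hP inferInstance
  have hmb : p.map (om φ) ≠ ⊥ := map_ne_bot φ hpb
  have hNm := absNorm_om_map h p
  have hPd : P ∣ p.map (om φ) := Ideal.dvd_iff_le.2 Ideal.map_comap_le
  haveI := h.map_prime P
  have hsb : P.map (om σ) ≠ ⊥ := map_ne_bot σ hP
  by_cases hs : P.map (om σ) = P
  · right
    have hall : ∀ {q : Ideal (𝓞 L)}, Prime q → q ∣ p.map (om φ) → q = P := by
      intro Q hQ hQd
      haveI := Ideal.isPrime_of_prime hQ
      have hle : p.map (om φ) ≤ Q := Ideal.dvd_iff_le.1 hQd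
      have hQp : p = Q.comap (om φ) := by
        have hm : p.IsMaximal := Ideal.IsPrime.isMaximal inferInstance hpb
        have : (Q.comap (om φ)).IsPrime := Ideal.comap_isPrime _ _
        exact hm.eq_of_le this.ne_top (Ideal.map_le_iff_le_comap.1 hle)
      rcases over_same h P Q hP hQ.ne_zero hQp with h1 | h1
      · exact h1
      · rw [h1, hs]
    obtain ⟨e, hpow⟩ : ∃ e, p.map (om φ) = P ^ e := by
      refine ⟨(UniqueFactorizationMonoid.normalizedFactors (p.map (om φ))).card, ?_⟩
      rw [← Multiset.prod_replicate]
      conv_lhs => rw [← Ideal.prod_normalizedFactors_eq_self hmb]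
      congr 1
      rw [Multiset.eq_replicate]
      refine ⟨rfl, fun b hb => ?_⟩
      exact hall (UniqueFactorizationMonoid.prime_of_normalized_factor b hb)
        (UniqueFactorizationMonoid.dvd_of_mem_normalizedFactors hb)
    rw [hpow, map_pow, hf, ← pow_mul] at hNm
    have hfe := Nat.pow_right_injective hN hNm
    have hf2 : f = 1 ∨ f = 2 := (Nat.dvd_prime Nat.prime_two).1 ⟨e, hfe.symm⟩
    rcases hf2 with h1 | h1
    · right
      subst h1
      have : e = 2 := by omega
      rw [this] at hpow
      exact ⟨hs, hpow, by rw [hf, pow_one]⟩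
    · left
      subst h1
      have : e = 1 := by omega
      rw [this, pow_one] at hpow
      exact ⟨hs, hpow, hf⟩
  · left
    have hsd : P.map (om σ) ∣ p.map (om φ) := by
      rw [Ideal.dvd_iff_le, hp, ← comap_map_sig h P]; exact Ideal.map_comap_le
    have hcop : IsCoprime P (P.map (om σ)) := by
      haveI : P.IsMaximal := Ideal.IsPrime.isMaximal inferInstance hP
      haveI : (P.map (om σ)).IsMaximal := Ideal.IsPrime.isMaximal inferInstance hsb
      exact Ideal.isCoprime_of_isMaximal (Ne.symm hs)
    obtain ⟨c, hc⟩ := hcop.mul_dvd hPd hsd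
    rw [hc, map_mul, map_mul, absNorm_map_sig h, hf, ← pow_add] at hNm
    have h1 : (Ideal.absNorm p) ^ (f + f) ∣ Ideal.absNorm p ^ 2 := ⟨_, hNm.symm⟩
    have h2 := (Nat.pow_dvd_pow_iff_le_right hN).1 h1
    have h3 : f = 1 := by omega
    subst h3
    have hc1 : Ideal.absNorm c = 1 := by
      have : 0 < Ideal.absNorm p ^ 2 := by positivity
      have h4 : Ideal.absNorm p ^ 2 * Ideal.absNorm c = Ideal.absNorm p ^ 2 * 1 := by simpa using hNm
      exact Nat.eq_of_mul_eq_mul_left this h4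
    rw [Ideal.absNorm_eq_one_iff] at hc1
    refine ⟨hs, ?_, by rw [hf, pow_one]⟩
    rw [hc, hc1, ← Ideal.one_eq_top, mul_one]
end quad
end Wk

open IntermediateField NumberField
set_option linter.all false
namespace Wk
open scoped nonZeroDivisors
section quad
variable {k : Type*} [Field k] [NumberField k]
variable {L : Type*} [Field L] [NumberField L]
variable {φ : k →+* L} {σ : L →+* L}

lemma idu_one : idu (1 : Ideal (𝓞 L)) one_ne_zero = 1 := by
  ext1; simp

lemma idu_mem_of_prime (H : Subgroup (Id L)) (h : ∀ (P : Ideal (𝓞 L)) (hP : P ≠ ⊥), P.IsPrime → idu P hP ∈ H)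
    (a : Ideal (𝓞 L)) (ha : a ≠ ⊥) : idu a ha ∈ H := by
  induction a using UniqueFactorizationMonoid.induction_on_prime with
  | h₁ => exact absurd rfl ha
  | h₂ x hx =>
    have : x = 1 := by rw [Ideal.isUnit_iff] at hx; rw [hx, Ideal.one_eq_top]
    subst this
    rw [idu_one]; exact H.one_mem
  | h₃ a p ha' hp ih =>
    rw [idu_mul p a hp.ne_zero ha']
    exact H.mul_mem (h p hp.ne_zero (Ideal.isPrime_of_prime hp)) (ih ha')

lemma Id_ind (H : Subgroup (Id L)) (h : ∀ (P : Ideal (𝓞 L)) (hP : P ≠ ⊥), P.IsPrime → idu P hP ∈ H)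
    (a : Id L) : a ∈ H := by
  obtain ⟨n, d, hn, hd, rfl⟩ := exists_idu_div a
  exact H.div_mem (idu_mem_of_prime H h n hn) (idu_mem_of_prime H h d hd)

lemma nu_mem_range (h : IsQuad φ σ) (a : Id L) : nu (iMap σ) a ∈ (iMap φ).range := by
  refine Id_ind ((iMap φ).range.comap (nu (iMap σ))) ?_ a
  intro P hP hPp
  rw [Subgroup.mem_comap, nu_apply, iMap_idu, ← idu_mul]
  rcases prime_cases h P hP with ⟨h1, h2, h3⟩ | ⟨h1, h2, h3⟩ | ⟨h1, h2, h3⟩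
  · refine ⟨idu _ (comap_ne_bot φ P hP), ?_⟩
    rw [iMap_idu, idu_inj, h2]
  · refine ⟨idu _ (comap_ne_bot φ P hP) * idu _ (comap_ne_bot φ P hP), ?_⟩
    rw [map_mul, iMap_idu, ← idu_mul, idu_inj, h2, h1]
  · refine ⟨idu _ (comap_ne_bot φ P hP), ?_⟩
    rw [iMap_idu, idu_inj, h2, h1, pow_two]

/-- relative norm of ideals -/
noncomputable def nI (h : IsQuad φ σ) : Id L →* Id k where
  toFun a := Classical.choose (nu_mem_range h a)
  map_one' := by
    apply iMap_inj φ
    rw [Classical.choose_spec (nu_mem_range h 1), map_one, map_one]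
  map_mul' a b := by
    apply iMap_inj φ
    rw [Classical.choose_spec (nu_mem_range h (a * b)), map_mul, map_mul,
      Classical.choose_spec (nu_mem_range h a), Classical.choose_spec (nu_mem_range h b)]

lemma iMap_nI (h : IsQuad φ σ) (a : Id L) : iMap φ (nI h a) = a * iMap σ a :=
  Classical.choose_spec (nu_mem_range h a)

lemma nI_eq (h : IsQuad φ σ) (a : Id L) (b : Id k) (hb : iMap φ b = a * iMap σ a) : nI h a = b := by
  apply iMap_inj φ; rw [hb, iMap_nI]

lemma nI_iMap (h : IsQuad φ σ) (a : Id k) : nI h (iMap φ a) = a ^ 2 := by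
  apply nI_eq; rw [h.iMap_phi, map_pow, pow_two]

lemma nI_sig (h : IsQuad φ σ) (a : Id L) : nI h (iMap σ a) = nI h a := by
  apply nI_eq; rw [iMap_nI, h.iMap_iMap, mul_comm]

/-- relative norm of elements -/
lemma IsQuad.exists_norm (h : IsQuad φ σ) (x : Lˣ) : ∃ y : kˣ, φ y = x * σ x := by
  obtain ⟨y, hy⟩ := h.fixed ((x:L) * σ x) (by rw [map_mul, h.inv, mul_comm])
  have hy0 : y ≠ 0 := by
    rintro rfl
    rw [map_zero] at hy
    have := mul_ne_zero x.ne_zero ((map_ne_zero σ).2 x.ne_zero)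
    exact this hy.symm
  exact ⟨Units.mk0 y hy0, hy⟩

lemma nI_pr (h : IsQuad φ σ) (x : Lˣ) (y : kˣ) (hy : φ y = x * σ x) : nI h (pr L x) = pr k y := by
  apply nI_eq
  rw [iMap_pr, iMap_pr, ← map_mul]
  congr 1
  ext1
  exact hy

/-- absolute norm -/
noncomputable def aN : Id L →* ℚ := (FractionalIdeal.absNorm (R := 𝓞 L) (K := L)).toMonoidHom.comp (Units.coeHom _)

lemma aN_idu (a : Ideal (𝓞 L)) (ha : a ≠ ⊥) : aN (idu a ha) = (Ideal.absNorm a : ℚ) :=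
  FractionalIdeal.coeIdeal_absNorm a

lemma aN_pos (a : Id L) : 0 < aN a := by
  have h1 : 0 ≤ aN a := FractionalIdeal.absNorm_nonneg _
  have h2 : aN a ≠ 0 := by
    intro h0
    have : aN (a * a⁻¹) = 0 := by rw [map_mul, h0, zero_mul]
    rw [mul_inv_cancel, map_one] at this
    exact one_ne_zero this
  exact lt_of_le_of_ne h1 (Ne.symm h2)

lemma aN_pr (x : Lˣ) : aN (pr L x) = |Algebra.norm ℚ (x : L)| := by
  change FractionalIdeal.absNorm (pr L x : FractionalIdeal (𝓞 L)⁰ L) = _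
  rw [coe_pr, FractionalIdeal.absNorm_span_singleton]

lemma aN_iMap (h : IsQuad φ σ) (a : Id k) : aN (iMap φ a) = aN a ^ 2 := by
  obtain ⟨n, d, hn, hd, rfl⟩ := exists_idu_div a
  have key : ∀ (n : Ideal (𝓞 k)) (hn : n ≠ ⊥), aN (iMap φ (idu n hn)) = aN (idu n hn) ^ 2 := by
    intro n hn
    rw [iMap_idu, aN_idu, aN_idu, absNorm_om_map h]; push_cast; rfl
  have e1 : iMap φ (idu n hn / idu d hd) * iMap φ (idu d hd) = iMap φ (idu n hn) := by
    rw [← map_mul]; simp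
  have e2 : (idu n hn / idu d hd) * (idu d hd) = (idu n hn) := by simp
  have e1' := congrArg aN e1
  have e2' := congrArg aN e2
  rw [map_mul, key, key] at e1'
  rw [map_mul] at e2'
  rw [← e2'] at e1'
  have h0 := (aN_pos (idu d hd)).ne'
  apply mul_right_cancel₀ (pow_ne_zero 2 h0)
  rw [e1']; ring

lemma aN_sig (h : IsQuad φ σ) (a : Id L) : aN (iMap σ a) = aN a := by
  obtain ⟨n, d, hn, hd, rfl⟩ := exists_idu_div a
  have key : ∀ (n : Ideal (𝓞 L)) (hn : n ≠ ⊥), aN (iMap σ (idu n hn)) = aN (idu n hn) := by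
    intro n hn
    rw [iMap_idu, aN_idu, aN_idu, absNorm_map_sig h]
  have e1 : iMap σ (idu n hn / idu d hd) * iMap σ (idu d hd) = iMap σ (idu n hn) := by
    rw [← map_mul]; simp
  have e2 : (idu n hn / idu d hd) * (idu d hd) = (idu n hn) := by simp
  have e1' := congrArg aN e1
  have e2' := congrArg aN e2
  rw [map_mul, key, key] at e1'
  rw [map_mul] at e2'
  rw [← e2'] at e1'
  have h0 := (aN_pos (idu d hd)).ne'
  exact mul_right_cancel₀ h0 e1'

lemma aN_nI (h : IsQuad φ σ) (a : Id L) : aN (nI h a) = aN a := by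
  have h1 := aN_iMap h (nI h a)
  rw [iMap_nI, map_mul, aN_sig h] at h1
  have h2 := aN_pos (nI h a)
  have h3 := aN_pos a
  nlinarith

/-- ramified primes -/
def Ram (φ : k →+* L) (σ : L →+* L) (P : Ideal (𝓞 L)) : Prop :=
  P ≠ ⊥ ∧ P.IsPrime ∧ P.map (om σ) = P ∧ (P.comap (om φ)).map (om φ) = P ^ 2 ∧
      Ideal.absNorm P = Ideal.absNorm (P.comap (om φ))

lemma same_norm_res (φ : k →+* L) (P : Ideal (𝓞 L)) (hP : P ≠ ⊥)
    (hN : Ideal.absNorm P = Ideal.absNorm (P.comap (om φ))) (β : 𝓞 L) : ∃ y : 𝓞 k, β - om φ y ∈ P := by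
  let f : (𝓞 k ⧸ P.comap (om φ)) →+* (𝓞 L ⧸ P) := Ideal.quotientMap P (om φ) le_rfl
  have hf : Function.Injective f := Ideal.quotientMap_injective
  have hfin : Finite (𝓞 L ⧸ P) := by
    have := Ideal.finiteQuotientOfFreeOfNeBot P hP
    exact this
  rw [Ideal.absNorm_apply, Ideal.absNorm_apply, Submodule.cardQuot_apply, Submodule.cardQuot_apply] at hN
  have hb : Function.Bijective f := (Nat.bijective_iff_injective_and_card f).2 ⟨hf, hN.symm⟩
  obtain ⟨y, hy⟩ := hb.2 (Ideal.Quotient.mk P β)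
  obtain ⟨y, rfl⟩ := Ideal.Quotient.mk_surjective y
  refine ⟨y, ?_⟩
  rw [← Ideal.Quotient.eq]
  rw [← hy]; rfl

lemma Ram.diff (h : IsQuad φ σ) {P : Ideal (𝓞 L)} (hR : Ram φ σ P) (β : 𝓞 L) : β - om σ β ∈ P := by
  obtain ⟨hP, hPp, hs, -, hN⟩ := hR
  obtain ⟨y, hy⟩ := same_norm_res φ P hP hN β
  have h2 : om σ (β - om φ y) ∈ P := by rwa [← h.mem_map, hs]
  have h3 : om σ (om φ y) = om φ y := by
    apply RingOfIntegers.ext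
    exact h.map _
  rw [map_sub, h3] at h2
  have := P.sub_mem hy h2
  simpa using this

lemma fix_gen (h : IsQuad φ σ) (M : Subgroup (Id L)) (hM : (iMap φ).range ≤ M)
    (hR : ∀ P, ∀ hR : Ram φ σ P, idu P hR.1 ∈ M) : fixS (iMap σ) ≤ M := by
  have key : ∀ N : ℕ, ∀ (n : Ideal (𝓞 L)) (hn : n ≠ ⊥), Ideal.absNorm n = N → n.map (om σ) = n →
      idu n hn ∈ M := by
    intro N
    induction N using Nat.strong_induction_on with
    | _ N ih =>
      intro n hn hN hs
      by_cases hu : n = ⊤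
      · subst hu
        have h1 : idu ⊤ hn = 1 := by
          rw [← idu_one (L := L), idu_inj, Ideal.one_eq_top]
        rw [h1]; exact M.one_mem
      obtain ⟨P, hPm, hle⟩ := Ideal.exists_le_maximal n hu
      have hP : P ≠ ⊥ := fun h0 => hn (le_bot_iff.1 (h0 ▸ hle))
      haveI := hPm.isPrime
      have step : ∀ (c : Ideal (𝓞 L)) (hc : c ≠ ⊥), c ∣ n → c ≠ ⊤ → c.map (om σ) = c → idu c hc ∈ M →
          idu n hn ∈ M := by
        rintro c hc ⟨b, rfl⟩ hct hcs hcM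
        have hb : b ≠ ⊥ := right_ne_zero_of_mul hn
        rw [idu_mul c b hc hb]
        refine M.mul_mem hcM (ih _ ?_ b hb rfl ?_)
        · rw [← hN, map_mul]
          have h1 : Ideal.absNorm c ≠ 1 := by rwa [Ne, Ideal.absNorm_eq_one_iff]
          have h2 : Ideal.absNorm c ≠ 0 := by rwa [Ne, Ideal.absNorm_eq_zero_iff]
          have h3 : Ideal.absNorm b ≠ 0 := by rwa [Ne, Ideal.absNorm_eq_zero_iff]
          have h4 : 2 ≤ Ideal.absNorm c := by omega
          nlinarith [Nat.pos_of_ne_zero h3]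
        · rw [Ideal.map_mul, hcs] at hs
          exact mul_left_cancel₀ hc hs
      have hd : P ∣ n := Ideal.dvd_iff_le.2 hle
      rcases prime_cases h P hP with ⟨h1, h2, h3⟩ | ⟨h1, h2, h3⟩ | ⟨h1, h2, h3⟩
      · have hsb : P.map (om σ) ≠ ⊥ := map_ne_bot σ hP
        haveI := h.map_prime P
        haveI : (P.map (om σ)).IsMaximal := Ideal.IsPrime.isMaximal inferInstance hsb
        have hd' : P.map (om σ) ∣ n := by
          rw [Ideal.dvd_iff_le, ← hs]; exact Ideal.map_mono hle
        have hcop : IsCoprime P (P.map (om σ)) := Ideal.isCoprime_of_isMaximal (Ne.symm h1)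
        refine step (P * P.map (om σ)) (mul_ne_zero hP hsb) (hcop.mul_dvd hd hd') ?_ ?_ ?_
        · intro h0
          exact hPm.ne_top (top_le_iff.1 (h0 ▸ Ideal.dvd_iff_le.1 (dvd_mul_right P (P.map (om σ)))))
        · rw [Ideal.map_mul, h.map_map, mul_comm]
        · apply hM
          refine ⟨idu _ (comap_ne_bot φ P hP), ?_⟩
          rw [iMap_idu, idu_inj, h2]
      · refine step P hP hd hPm.ne_top h1 (hM ⟨idu _ (comap_ne_bot φ P hP), ?_⟩)
        rw [iMap_idu, idu_inj, h2]
      · exact step P hP hd hPm.ne_top h1 (hR P ⟨hP, inferInstance, h1, h2, h3⟩)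
  intro a ha
  rw [mem_fixS] at ha
  obtain ⟨n, d, hn, hd, hco, rfl⟩ := exists_idu_div_coprime a
  rw [map_div, div_eq_div_iff_mul_eq_mul, iMap_idu, iMap_idu, ← idu_mul, ← idu_mul, idu_inj] at ha
  have hco' : IsCoprime (n.map (om σ)) (d.map (om σ)) := by
    rw [Ideal.isCoprime_iff_sup_eq] at *
    rw [← Ideal.map_sup, hco, Ideal.map_top]
  have e1 : n.map (om σ) = n := by
    apply dvd_antisymm
    · exact hco'.dvd_of_dvd_mul_right ⟨d, ha.symm⟩
    · exact hco.dvd_of_dvd_mul_right ⟨_, ha⟩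
  have e2 : d.map (om σ) = d := by
    rw [e1] at ha
    exact (mul_left_cancel₀ hn ha).symm
  exact M.div_mem (key _ n hn rfl e1) (key _ d hd rfl e2)

lemma relIndex_zpowers_dvd {X : Type*} [CommGroup X] (M : Subgroup X) (x : X) (hx : x ^ 2 ∈ M) :
    M.relIndex (M ⊔ Subgroup.zpowers x) ∣ 2 := by
  rw [sup_comm, Subgroup.relIndex_sup_right, Subgroup.relIndex, Subgroup.index]
  set g : Subgroup.zpowers x ⧸ M.subgroupOf (Subgroup.zpowers x) :=
    QuotientGroup.mk ⟨x, Subgroup.mem_zpowers x⟩ with hg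
  have h1 : ∀ y, y ∈ Subgroup.zpowers g := by
    intro y
    obtain ⟨⟨y, n, rfl⟩, rfl⟩ := QuotientGroup.mk_surjective y
    exact ⟨n, rfl⟩
  rw [← orderOf_eq_card_of_forall_mem_zpowers h1]
  apply orderOf_dvd_of_pow_eq_one
  rw [hg, ← QuotientGroup.mk_pow, QuotientGroup.eq_one_iff]
  exact hx

lemma relIndex_fin_dvd {X ι : Type*} [CommGroup X] (J : Subgroup X) (T : Finset ι) (f : ι → X)
    (hf : ∀ i, f i ^ 2 ∈ J) : ∃ M : Subgroup X, J ≤ M ∧ (∀ i ∈ T, f i ∈ M) ∧ J.relIndex M ∣ 2 ^ T.card := by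
  classical
  induction T using Finset.induction_on with
  | empty => exact ⟨J, le_rfl, by simp, by simp⟩
  | insert i T hi ih =>
    obtain ⟨M, h1, h2, h3⟩ := ih
    refine ⟨M ⊔ Subgroup.zpowers (f i), h1.trans le_sup_left, ?_, ?_⟩
    · intro j hj
      rcases Finset.mem_insert.1 hj with rfl | hj
      · exact Subgroup.mem_sup_right (Subgroup.mem_zpowers _)
      · exact Subgroup.mem_sup_left (h2 j hj)
    · rw [← Subgroup.relIndex_mul_relIndex J M _ h1 le_sup_left, Finset.card_insert_of_notMem hi, pow_succ]
      exact mul_dvd_mul h3 (relIndex_zpowers_dvd M _ (h1 (hf i)))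

/-- number of ramified primes bound -/
theorem ram_bound (h : IsQuad φ σ) (S : Finset (Ideal (𝓞 k)))
    (hS : ∀ P, Ram φ σ P → P.comap (om φ) ∈ S) :
    (iMap φ).range.relIndex (fixS (iMap σ)) ∣ 2 ^ S.card := by
  classical
  let f : Ideal (𝓞 k) → Id L := fun p =>
    if hp : ∃ P, Ram φ σ P ∧ P.comap (om φ) = p then idu hp.choose hp.choose_spec.1.1 else 1
  obtain ⟨M, h1, h2, h3⟩ := relIndex_fin_dvd (iMap φ).range S f (by
    intro p
    by_cases hp : ∃ P, Ram φ σ P ∧ P.comap (om φ) = p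
    · simp only [f, dif_pos hp]
      obtain ⟨hP, hPp, hs, h2, -⟩ := hp.choose_spec.1
      refine ⟨idu _ (comap_ne_bot φ _ hP), ?_⟩
      rw [iMap_idu, pow_two, ← idu_mul, idu_inj, h2, pow_two]
    · simp only [f, dif_neg hp]; rw [one_pow]; exact Subgroup.one_mem _)
  refine dvd_trans ?_ h3
  have h4 : fixS (iMap σ) ≤ M := by
    refine fix_gen h M h1 ?_
    intro P hR
    have h5 := h2 _ (hS P hR)
    have hp : ∃ Q, Ram φ σ Q ∧ Q.comap (om φ) = P.comap (om φ) := ⟨P, hR, rfl⟩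
    simp only [f, dif_pos hp] at h5
    have h6 : hp.choose = P := by
      obtain ⟨hQ, hQp, -⟩ := hp.choose_spec.1
      haveI := hR.2.1
      rcases over_same h P hp.choose hR.1 hQ hp.choose_spec.2.symm with h7 | h7
      · exact h7
      · rw [h7, hR.2.2.1]
    have h8 : idu hp.choose hp.choose_spec.1.1 = idu P hR.1 := by rw [idu_inj]; exact h6
    rwa [h8] at h5
  have h5 : (iMap φ).range ≤ fixS (iMap σ) := by
    rintro _ ⟨a, rfl⟩
    rw [mem_fixS]; exact h.iMap_phi a
  rw [← Subgroup.relIndex_mul_relIndex _ _ _ h5 h4]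
  exact dvd_mul_right _ _

end quad
end Wk

open IntermediateField NumberField
set_option linter.all false
namespace Wk
open scoped nonZeroDivisors
section units
variable {K : Type*} [Field K] [NumberField K]

lemma real_tor {K : Type*} [Field K] (ι : K →+* ℝ) (x : K) (n : ℕ) (hn : n ≠ 0) (hx : x ^ n = 1) : x = 1 ∨ x = -1 := by
  have h1 : (ι x) ^ n = 1 := by rw [← map_pow, hx, map_one]
  have h2 : |ι x| = 1 := by
    have : |ι x| ^ n = 1 := by rw [← abs_pow, h1, abs_one]
    exact (pow_eq_one_iff_of_nonneg (abs_nonneg _) hn).1 this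
  rcases eq_or_eq_neg_of_abs_eq h2 with h | h
  · left; apply ι.injective; rw [h, map_one]
  · right; apply ι.injective; rw [h, map_neg, map_one]

lemma tor_real (ι : K →+* ℝ) (x : (𝓞 K)ˣ) : x ∈ Units.torsion K ↔ x = 1 ∨ x = -1 := by
  constructor
  · intro hx
    rw [Units.torsion, CommGroup.mem_torsion, isOfFinOrder_iff_pow_eq_one] at hx
    obtain ⟨n, hn, hx⟩ := hx
    have h1 : ((x : 𝓞 K) : K) ^ n = 1 := by
      have := congrArg (fun u : (𝓞 K)ˣ => ((u : 𝓞 K) : K)) hx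
      simpa using this
    rcases real_tor ι _ n hn.ne' h1 with h | h
    · left; ext; simpa using h
    · right; ext; simpa using h
  · rintro (rfl | rfl)
    · exact Subgroup.one_mem _
    · rw [Units.torsion, CommGroup.mem_torsion, isOfFinOrder_iff_pow_eq_one]
      exact ⟨2, by norm_num, by simp⟩

lemma sq_index [IsTotallyReal K] (ι : K →+* ℝ) :
    (sq (X := (𝓞 K)ˣ)).range.index = 2 ^ Module.finrank ℚ K := by
  set T := Units.torsion K with hT
  set q := QuotientGroup.mk' T with hq
  have e1 : ((sq (X := (𝓞 K)ˣ ⧸ T)).range).comap q = sq.range ⊔ T := by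
    have : ((sq (X := (𝓞 K)ˣ ⧸ T)).range) = (sq (X := (𝓞 K)ˣ)).range.map q := by
      ext y; constructor
      · rintro ⟨y, rfl⟩
        obtain ⟨y, rfl⟩ := QuotientGroup.mk'_surjective T y
        exact ⟨_, ⟨y, rfl⟩, by simp [hq]⟩
      · rintro ⟨_, ⟨y, rfl⟩, rfl⟩
        exact ⟨q y, by simp⟩
    rw [this, Subgroup.comap_map_eq, QuotientGroup.ker_mk']
  have e2 : (sq.range ⊔ T).index = 2 ^ Units.rank K := by
    rw [← e1, Subgroup.index_comap_of_surjective _ (QuotientGroup.mk'_surjective T),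
      ← Units.finrank_modTorsion]
    exact AddSubgroup.index_range_nsmul (Additive ((𝓞 K)ˣ ⧸ T)) 2
  have e3 : (sq (X := (𝓞 K)ˣ)).range.relIndex (sq.range ⊔ T) = 2 := by
    rw [sup_comm, Subgroup.relIndex_sup_right, ← Subgroup.inf_relIndex_right]
    have : (sq (X := (𝓞 K)ˣ)).range ⊓ T = ⊥ := by
      rw [eq_bot_iff]
      rintro _ ⟨⟨x, rfl⟩, hx⟩
      have hxT : x ∈ T := by
        have hx' : x ^ 2 ∈ T := hx
        rw [hT, Units.torsion, CommGroup.mem_torsion] at hx' ⊢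
        exact hx'.of_pow (by norm_num)
      rcases (tor_real ι x).1 hxT with rfl | rfl <;> simp
    rw [this, Subgroup.relIndex_bot_left]
    have h2 : (T : Set (𝓞 K)ˣ) = {1, -1} := by
      ext x; exact tor_real ι x
    change Nat.card (T : Set (𝓞 K)ˣ) = 2
    rw [h2, Nat.card_coe_set_eq, Set.ncard_pair]
    intro h0
    have h3 := congrArg (fun u : (𝓞 K)ˣ => ((u : 𝓞 K) : K)) h0
    simp only [Units.val_one, Units.val_neg, map_one, map_neg] at h3
    have h4 : (2 : K) = 0 := by linear_combination h3
    exact two_ne_zero h4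
  rw [← Subgroup.relIndex_mul_index (H := (sq (X := (𝓞 K)ˣ)).range) (K := sq.range ⊔ T) le_sup_left, e2, e3]
  have hp : 0 < Fintype.card (InfinitePlace K) := Fintype.card_pos
  have h5 : Units.rank K + 1 = Module.finrank ℚ K := by
    have h6 := InfinitePlace.card_eq_nrRealPlaces_add_nrComplexPlaces K
    have h7 := IsTotallyReal.nrComplexPlaces_eq_zero K
    rw [IsTotallyReal.finrank, Units.rank]; omega
  rw [← h5, pow_succ, mul_comm]

lemma ker_pr_int (x : Kˣ) (hx : x ∈ (pr K).ker) : ∃ y : 𝓞 K, (y : K) = x := by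
  rw [MonoidHom.mem_ker] at hx
  have h1 := congrArg Units.val hx
  rw [coe_pr, Units.val_one] at h1
  have h2 : (x : K) ∈ (1 : FractionalIdeal (𝓞 K)⁰ K) := by
    rw [← h1]; exact FractionalIdeal.mem_spanSingleton_self _ _
  rw [FractionalIdeal.mem_one_iff] at h2
  exact h2

lemma mem_ker_pr (x : Kˣ) : x ∈ (pr K).ker ↔ ∃ u : (𝓞 K)ˣ, Units.map (algebraMap (𝓞 K) K).toMonoidHom u = x := by
  constructor
  · intro h
    obtain ⟨y, hy⟩ := ker_pr_int x h
    obtain ⟨z, hz⟩ := ker_pr_int x⁻¹ ((pr K).ker.inv_mem h)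
    have hyz : y * z = 1 := by
      apply RingOfIntegers.ext
      change (y : K) * (z : K) = 1
      rw [hy, hz]; simp
    refine ⟨⟨y, z, hyz, by rw [mul_comm, hyz]⟩, ?_⟩
    ext1
    exact hy
  · rintro ⟨u, rfl⟩
    rw [MonoidHom.mem_ker]
    have h1 : idu (Ideal.span {(u : 𝓞 K)}) (by simp) = idu (1 : Ideal (𝓞 K)) one_ne_zero := by
      rw [idu_inj, Ideal.one_eq_top, Ideal.span_singleton_eq_top]; exact u.isUnit
    rw [idu_span _ u.ne_zero, idu_one] at h1
    rw [← h1]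
    congr 1
    ext1
    rfl

lemma ker_pr : (pr K).ker = (Units.map (algebraMap (𝓞 K) K).toMonoidHom).range := by
  ext x; exact mem_ker_pr x

lemma sq_relIndex [IsTotallyReal K] (ι : K →+* ℝ) :
    ((pr K).ker.map sq).relIndex (pr K).ker = 2 ^ Module.finrank ℚ K := by
  set f : (𝓞 K)ˣ →* Kˣ := Units.map (algebraMap (𝓞 K) K).toMonoidHom with hf
  have hinj : Function.Injective f := Units.map_injective (FaithfulSMul.algebraMap_injective (𝓞 K) K)
  have e1 : (pr K).ker = (⊤ : Subgroup (𝓞 K)ˣ).map f := by rw [ker_pr, MonoidHom.range_eq_map]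
  have e2 : (pr K).ker.map sq = (sq (X := (𝓞 K)ˣ)).range.map f := by
    rw [ker_pr]
    ext y; constructor
    · rintro ⟨_, ⟨u, rfl⟩, rfl⟩
      exact ⟨u ^ 2, ⟨u, rfl⟩, by simp [hf]⟩
    · rintro ⟨_, ⟨u, rfl⟩, rfl⟩
      exact ⟨f u, ⟨u, rfl⟩, by simp⟩
  rw [e2, e1, Subgroup.relIndex_map_map_of_injective _ _ hinj, Subgroup.relIndex_top_right, sq_index ι]

end units
end Wk

open IntermediateField NumberField
set_option linter.all false
namespace Wk
open scoped nonZeroDivisors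
section Agroup
variable (K : Type*) [Field K] [NumberField K]
variable {L : Type*} [Field L] [NumberField L]
variable {M : Type*} [Field M] [NumberField M]

/-- ideals with an odd power principal -/
def P2 : Subgroup (Id K) where
  carrier := {a | ∃ n : ℕ, Odd n ∧ a ^ n ∈ (pr K).range}
  mul_mem' := by
    rintro a b ⟨n, hn, ha⟩ ⟨m, hm, hb⟩
    refine ⟨n * m, hn.mul hm, ?_⟩
    rw [mul_pow, pow_mul, mul_comm n m, pow_mul]
    exact Subgroup.mul_mem _ (Subgroup.pow_mem _ ha _) (Subgroup.pow_mem _ hb _)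
  one_mem' := ⟨1, odd_one, by simp⟩
  inv_mem' := by
    rintro a ⟨n, hn, ha⟩
    exact ⟨n, hn, by rw [inv_pow]; exact Subgroup.inv_mem _ ha⟩

lemma mem_P2 {a : Id K} : a ∈ P2 K ↔ ∃ n : ℕ, Odd n ∧ a ^ n ∈ (pr K).range := Iff.rfl

/-- the 2-class group -/
def A := Id K ⧸ P2 K
noncomputable instance : CommGroup (A K) := inferInstanceAs (CommGroup (Id K ⧸ P2 K))
/-- class of an ideal -/
noncomputable def cl : Id K →* A K := QuotientGroup.mk' (P2 K)

variable {K}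
lemma cl_eq_one {a : Id K} : cl K a = 1 ↔ ∃ n : ℕ, Odd n ∧ a ^ n ∈ (pr K).range := by
  exact QuotientGroup.eq_one_iff a

lemma ker_cl : (cl K).ker = P2 K := QuotientGroup.ker_mk' _

lemma cl_surj (x : A K) : ∃ a, cl K a = x := QuotientGroup.mk'_surjective _ x

lemma range_le_P2 : (pr K).range ≤ P2 K := fun a ha => ⟨1, odd_one, by simpa using ha⟩

lemma cl_pr (x : Kˣ) : cl K (pr K x) = 1 := cl_eq_one.2 ⟨1, odd_one, by rw [pow_one]; exact ⟨x, rfl⟩⟩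

lemma prange_index_ne : (pr K).range.index ≠ 0 := by
  have : Finite (Id K ⧸ (pr K).range) := inferInstanceAs (Finite (Cl K))
  exact Subgroup.index_ne_zero_of_finite

instance : Finite (A K) := by
  have : (P2 K).index ≠ 0 := fun h0 => prange_index_ne (K := K) (by
    have := Subgroup.index_dvd_of_le (range_le_P2 (K := K))
    rw [h0] at this
    exact Nat.eq_zero_of_zero_dvd this)
  exact (Subgroup.index_ne_zero_iff_finite).1 this

lemma odd_relIndex {X : Type*} [CommGroup X] (H G : Subgroup X) (hle : H ≤ G) (h0 : H.relIndex G ≠ 0)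
    (h : ∀ x ∈ G, ∃ n : ℕ, Odd n ∧ x ^ n ∈ H) : Odd (H.relIndex G) := by
  by_contra hc
  rw [Nat.not_odd_iff_even, even_iff_two_dvd] at hc
  haveI : Finite (G ⧸ H.subgroupOf G) := Subgroup.index_ne_zero_iff_finite.1 h0
  have hc' : 2 ∣ Nat.card (G ⧸ H.subgroupOf G) := hc
  haveI : Fact (Nat.Prime 2) := ⟨Nat.prime_two⟩
  obtain ⟨y, hy⟩ := exists_prime_orderOf_dvd_card' 2 hc'
  obtain ⟨⟨x, hx⟩, rfl⟩ := QuotientGroup.mk_surjective y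
  obtain ⟨n, hn, hxn⟩ := h x hx
  have h1 : (QuotientGroup.mk ⟨x, hx⟩ : G ⧸ H.subgroupOf G) ^ n = 1 := by
    rw [← QuotientGroup.mk_pow, QuotientGroup.eq_one_iff]; exact hxn
  have h2 := orderOf_dvd_of_pow_eq_one h1
  rw [hy] at h2
  exact (Nat.not_even_iff_odd.2 hn) (even_iff_two_dvd.2 h2)

lemma A_pgroup : IsPGroup 2 (A K) := by
  intro x
  obtain ⟨a, rfl⟩ := cl_surj x
  obtain ⟨e, b, hb, hcard⟩ := Nat.exists_eq_two_pow_mul_odd (prange_index_ne (K := K))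
  refine ⟨e, ?_⟩
  rw [← map_pow, cl_eq_one]
  refine ⟨b, hb, ?_⟩
  rw [← pow_mul, ← hcard]
  exact Subgroup.pow_index_mem _ a

lemma A_card : ∃ n, Nat.card (A K) = 2 ^ n := by
  haveI : Fact (Nat.Prime 2) := ⟨Nat.prime_two⟩
  exact IsPGroup.iff_card.1 A_pgroup

lemma subA_card (H : Subgroup (A K)) : ∃ n, Nat.card H = 2 ^ n := by
  haveI : Fact (Nat.Prime 2) := ⟨Nat.prime_two⟩
  exact IsPGroup.iff_card.1 (A_pgroup.to_subgroup H)

lemma Cl_card : ∃ u, Odd u ∧ (pr K).range.index = u * Nat.card (A K) := by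
  refine ⟨(pr K).range.relIndex (P2 K), ?_, ?_⟩
  · apply odd_relIndex _ _ range_le_P2 _ (fun x hx => hx)
    intro h0
    have := Subgroup.relIndex_mul_index (range_le_P2 (K := K))
    rw [h0, zero_mul] at this
    exact prange_index_ne this.symm
  · rw [← Subgroup.relIndex_mul_index (range_le_P2 (K := K))]; rfl

lemma fac_odd {a u : ℕ} (hu : Odd u) : (u * 2 ^ a).factorization 2 = a := by
  have hu0 : u ≠ 0 := by rintro rfl; simp at hu
  rw [Nat.factorization_mul hu0 (by positivity), Nat.factorization_pow]
  simp [Nat.Prime.factorization_self Nat.prime_two, Nat.factorization_eq_zero_of_not_dvd (fun h => (Nat.not_even_iff_odd.2 hu) (even_iff_two_dvd.2 h))]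

lemma two_pow_odd {a b u v : ℕ} (hu : Odd u) (hv : Odd v) (h : u * 2 ^ a = v * 2 ^ b) : a = b := by
  rw [← fac_odd (a := a) hu, h, fac_odd hv]

lemma A_card_eq : Nat.card (A K) = 2 ^ ((Nat.card (ClassGroup (𝓞 K))).factorization 2) := by
  obtain ⟨u, hu, h1⟩ := Cl_card (K := K)
  obtain ⟨n, hn⟩ := A_card (K := K)
  have h2 : Nat.card (ClassGroup (𝓞 K)) = (pr K).range.index :=
    Nat.card_congr (ClassGroup.equiv (R := 𝓞 K) K).toEquiv
  rw [h2, h1, hn]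
  rw [fac_odd hu]

/-- functoriality -/
noncomputable def aMap (φ : K →+* L) : A K →* A L :=
  QuotientGroup.map _ _ (iMap φ) (by
    rintro a ⟨n, hn, x, hx⟩
    refine ⟨n, hn, Units.map φ.toMonoidHom x, ?_⟩
    rw [← iMap_pr, hx, map_pow])

@[simp] lemma aMap_cl (φ : K →+* L) (a : Id K) : aMap φ (cl K a) = cl L (iMap φ a) := rfl

lemma aMap_comp (φ : K →+* L) (ψ : L →+* M) (x : A K) : aMap ψ (aMap φ x) = aMap (ψ.comp φ) x := by
  obtain ⟨a, rfl⟩ := cl_surj x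
  rw [aMap_cl, aMap_cl, aMap_cl, iMap_comp]

lemma aMap_id (φ : K →+* K) (h : ∀ x, φ x = x) (a : A K) : aMap φ a = a := by
  obtain ⟨a, rfl⟩ := cl_surj a
  rw [aMap_cl, iMap_id φ h]

variable {φ : K →+* L} {σ : L →+* L}

/-- norm on 2-class groups -/
noncomputable def aNm (h : IsQuad φ σ) : A L →* A K :=
  QuotientGroup.map _ _ (nI h) (by
    rintro a ⟨n, hn, x, hx⟩
    obtain ⟨y, hy⟩ := h.exists_norm x
    refine ⟨n, hn, y, ?_⟩
    rw [← nI_pr h x y hy, hx, map_pow])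

@[simp] lemma aNm_cl (h : IsQuad φ σ) (a : Id L) : aNm h (cl L a) = cl K (nI h a) := rfl

lemma aMap_aNm (h : IsQuad φ σ) (x : A L) : aMap φ (aNm h x) = x * aMap σ x := by
  obtain ⟨a, rfl⟩ := cl_surj x
  rw [aNm_cl, aMap_cl, iMap_nI, map_mul, aMap_cl]

lemma aNm_aMap (h : IsQuad φ σ) (x : A K) : aNm h (aMap φ x) = x ^ 2 := by
  obtain ⟨a, rfl⟩ := cl_surj x
  rw [aMap_cl, aNm_cl, nI_iMap, map_pow]

lemma aNm_sig (h : IsQuad φ σ) (x : A L) : aNm h (aMap σ x) = aNm h x := by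
  obtain ⟨a, rfl⟩ := cl_surj x
  rw [aMap_cl, aNm_cl, nI_sig, aNm_cl]

lemma aMap_sig_sig (h : IsQuad φ σ) (x : A L) : aMap σ (aMap σ x) = x := by
  rw [aMap_comp]; exact aMap_id _ h.inv x

/-- action on elements -/
abbrev um (σ : L →+* L) : Lˣ →* Lˣ := Units.map σ.toMonoidHom

/-- ramification index number -/
noncomputable def ri (φ : K →+* L) (σ : L →+* L) : ℕ := (iMap φ).range.relIndex (fixS (iMap σ))
/-- unit norm index -/
noncomputable def ei (σ : L →+* L) : ℕ := (nu (um σ)).range.relIndex ((pr L).ker ⊓ fixS (um σ))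

lemma fixS_um (h : IsQuad φ σ) : fixS (um σ) = (Units.map φ.toMonoidHom).range := by
  ext x
  rw [mem_fixS]
  constructor
  · intro hx
    obtain ⟨y, hy⟩ := h.fixed x (congrArg Units.val hx)
    have hy0 : y ≠ 0 := by
      rintro rfl
      rw [map_zero] at hy
      exact x.ne_zero hy.symm
    exact ⟨Units.mk0 y hy0, Units.ext hy⟩
  · rintro ⟨y, rfl⟩
    ext1
    exact h.map _

lemma kerfix (h : IsQuad φ σ) : (pr L).ker ⊓ fixS (um σ) = (pr K).ker.map (Units.map φ.toMonoidHom) := by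
  rw [fixS_um h]
  ext x; constructor
  · rintro ⟨h1, ⟨y, rfl⟩⟩
    refine ⟨y, ?_, rfl⟩
    have h2 : pr L (Units.map φ.toMonoidHom y) = 1 := h1
    rw [← iMap_pr] at h2
    exact iMap_inj φ (by rw [h2, map_one])
  · rintro ⟨y, h1, rfl⟩
    refine ⟨?_, ⟨y, rfl⟩⟩
    have h2 : pr K y = 1 := h1
    have h3 : pr L (Units.map φ.toMonoidHom y) = 1 := by
      rw [← iMap_pr, h2, map_one]
    exact h3

lemma um_inj (φ : K →+* L) : Function.Injective (Units.map φ.toMonoidHom) := Units.map_injective φ.injective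

theorem chev0 (h : IsQuad φ σ) [IsTotallyReal K] [IsTotallyReal L] (ι : L →+* ℝ) :
    (pr L).range.relIndex ((pr L).range.comap (psi (iMap σ))) * 2 * ei σ =
      ri φ σ * (pr K).range.index := by
  have hN' : (((pr L).ker ⊓ fixS (um σ)).map sq).relIndex ((pr L).ker ⊓ fixS (um σ)) = 2 ^ Module.finrank ℚ K := by
    rw [kerfix h, ← sq_relIndex (ι.comp φ)]
    have : ((pr K).ker.map (Units.map φ.toMonoidHom)).map sq = ((pr K).ker.map sq).map (Units.map φ.toMonoidHom) := by
      rw [Subgroup.map_map, Subgroup.map_map]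
      congr 1
      ext x; simp
    rw [this, Subgroup.relIndex_map_map_of_injective _ _ (um_inj φ)]
  have hN : ((pr L).ker.map sq).relIndex (pr L).ker = 2 ^ (2 * Module.finrank ℚ K) := by
    rw [sq_relIndex ι, h.finrank.1]
  have hm1 : (-1 : Lˣ) ∈ (pr L).ker := by
    rw [mem_ker_pr]
    exact ⟨-1, by ext; simp⟩
  have e4 : (fixS (um σ)).map (pr L) = ((pr K).range).map (iMap φ) := by
    rw [fixS_um h]
    ext x; constructor
    · rintro ⟨_, ⟨y, rfl⟩, rfl⟩
      exact ⟨pr K y, ⟨y, rfl⟩, iMap_pr φ y⟩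
    · rintro ⟨_, ⟨y, rfl⟩, rfl⟩
      exact ⟨_, ⟨y, rfl⟩, (iMap_pr φ y).symm⟩
  have h5 : (iMap φ).range ≤ fixS (iMap σ) := by
    rintro _ ⟨a, rfl⟩
    rw [mem_fixS]; exact h.iMap_phi a
  have main := abs_chev2 (um σ) (iMap σ) (pr L) (fun x => Units.ext (h.inv _)) (h.iMap_iMap)
    (fun x => (iMap_pr σ x).symm) h.h90 (h90I_aux h) (iMap φ).range h5
    (by rw [e4]; exact Subgroup.map_le_range _ _) (-1) hm1 (by
      intro h0
      have h3 := congrArg Units.val h0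
      simp only [Units.val_neg, Units.val_one] at h3
      have h4 : (2 : L) = 0 := by linear_combination -h3
      exact two_ne_zero h4) (by simp) (by ext; simp) (by
      intro x hx hxx
      have h3 : (x : L) ^ 2 = 1 := by rw [pow_two]; exact congrArg Units.val hxx
      rcases real_tor ι (x : L) 2 (by norm_num) h3 with h4 | h4
      · left; ext; simpa using h4
      · right; ext; simpa using h4) (by
      intro x hx hxx
      have h3 : (x : L) * x = -1 := congrArg Units.val hxx
      have h4 := congrArg ι h3
      rw [map_mul, map_neg, map_one] at h4
      nlinarith [mul_self_nonneg (ι x)]) _ hN hN'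
  rw [e4, MonoidHom.range_eq_map (iMap φ), Subgroup.relIndex_map_map_of_injective _ _ (iMap_inj φ),
    Subgroup.relIndex_top_right, ← MonoidHom.range_eq_map (iMap φ)] at main
  exact main

lemma ei_dvd (h : IsQuad φ σ) [IsTotallyReal K] (ι : K →+* ℝ) : ei σ ∣ 2 ^ Module.finrank ℚ K := by
  have hN' : (((pr L).ker ⊓ fixS (um σ)).map sq).relIndex ((pr L).ker ⊓ fixS (um σ)) = 2 ^ Module.finrank ℚ K := by
    rw [kerfix h, ← sq_relIndex ι]
    have : ((pr K).ker.map (Units.map φ.toMonoidHom)).map sq = ((pr K).ker.map sq).map (Units.map φ.toMonoidHom) := by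
      rw [Subgroup.map_map, Subgroup.map_map]
      congr 1
      ext x; simp
    rw [this, Subgroup.relIndex_map_map_of_injective _ _ (um_inj φ)]
  rw [← hN', ei]
  apply Subgroup.relIndex_dvd_of_le_left
  rintro _ ⟨x, ⟨-, hx⟩, rfl⟩
  refine ⟨x, ?_⟩
  have hx' : um σ x = x := hx
  rw [nu_apply, hx', sq_apply, pow_two]

theorem chev (h : IsQuad φ σ) [IsTotallyReal K] [IsTotallyReal L] (ι : L →+* ℝ) {t : ℕ}
    (hr : ri φ σ ∣ 2 ^ t) :
    Nat.card (fixS (aMap σ)) * 2 * ei σ = ri φ σ * Nat.card (A K) := by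
  have main := chev0 h ι
  set B := (pr L).range with hB
  set C := B.comap (psi (iMap σ)) with hC
  set C' := (P2 L).comap (psi (iMap σ)) with hC'
  have hBC : B ≤ C := by
    rintro _ ⟨x, rfl⟩
    rw [hC, Subgroup.mem_comap, psi_apply, iMap_pr]
    exact B.div_mem ⟨_, rfl⟩ ⟨_, rfl⟩
  have hCC' : C ≤ C' := Subgroup.comap_mono range_le_P2
  have hP2C' : P2 L ≤ C' := by
    rintro a ⟨n, hn, ha⟩
    rw [hC', Subgroup.mem_comap]
    refine ⟨n, hn, ?_⟩
    rw [← map_pow]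
    exact hBC ha
  have hB0 : B.relIndex C' ≠ 0 := by
    intro h0
    have := Subgroup.relIndex_mul_index (hBC.trans hCC')
    rw [h0, zero_mul] at this
    exact prange_index_ne this.symm
  have e1 := Subgroup.relIndex_mul_relIndex B C C' hBC hCC'
  have e2 := Subgroup.relIndex_mul_relIndex B (P2 L) C' range_le_P2 hP2C'
  have o1 : Odd (C.relIndex C') := by
    refine odd_relIndex _ _ hCC' (fun h0 => hB0 (by rw [← e1, h0, mul_zero])) ?_
    rintro a ⟨n, hn, ha⟩
    refine ⟨n, hn, ?_⟩
    rw [hC, Subgroup.mem_comap, map_pow]; exact ha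
  have o2 : Odd (B.relIndex (P2 L)) := 
    odd_relIndex _ _ range_le_P2 (fun h0 => hB0 (by rw [← e2, h0, zero_mul])) (fun x hx => hx)
  have e3 : (P2 L).relIndex C' = Nat.card (fixS (aMap σ)) := by
    have : fixS (aMap σ) = C'.map (cl L) := by
      ext x
      obtain ⟨a, rfl⟩ := cl_surj x
      rw [mem_fixS, aMap_cl]
      have e : cl L a ∈ C'.map (cl L) ↔ a ∈ (C'.map (cl L)).comap (cl L) := Iff.rfl
      rw [e, Subgroup.comap_map_eq, ker_cl, sup_eq_left.2 hP2C', hC', Subgroup.mem_comap,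
        psi_apply, ← ker_cl, MonoidHom.mem_ker, map_div, div_eq_one, eq_comm]
    rw [this]
    have := Subgroup.relIndex_ker (K := C') (cl L)
    rwa [ker_cl] at this
  obtain ⟨u, hu, e4⟩ := Cl_card (K := K)
  obtain ⟨n1, hn1⟩ := subA_card (fixS (aMap σ))
  obtain ⟨n2, hn2⟩ := A_card (K := K)
  obtain ⟨n3, -, hn3⟩ := (Nat.dvd_prime_pow Nat.prime_two).1 hr
  obtain ⟨n4, -, hn4⟩ := (Nat.dvd_prime_pow Nat.prime_two).1 (ei_dvd h (ι.comp φ))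
  rw [e4] at main
  rw [e3] at e2
  rw [hn3, hn4, hn2] at main
  rw [hn1] at e2
  rw [hn1, hn2, hn3, hn4]
  have fin : B.relIndex (P2 L) * 2 ^ (n1 + 1 + n4) = (C.relIndex C' * u) * 2 ^ (n3 + n2) := by
    rw [pow_add, pow_add, pow_add]
    calc _ = (B.relIndex (P2 L) * 2 ^ n1) * 2 * 2 ^ n4 := by ring
      _ = C.relIndex C' * (B.relIndex C * 2 * 2 ^ n4) := by rw [e2, ← e1]; ring
      _ = _ := by rw [main]; ring
  have := two_pow_odd o2 (o1.mul hu) fin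
  calc _ = 2 ^ (n1 + 1 + n4) := by ring
    _ = _ := by rw [this]; ring

end Agroup
end Wk

open IntermediateField NumberField
set_option linter.all false
namespace Wk
open scoped nonZeroDivisors
section transfer
variable {K : Type*} [Field K] [NumberField K]

/-- ClassGroup to A -/
noncomputable def cgA : ClassGroup (𝓞 K) →* A K :=
  (QuotientGroup.lift (toPrincipalIdeal (𝓞 K) K).range (cl K) (by
    rintro _ ⟨x, rfl⟩; exact cl_pr x)).comp (ClassGroup.equiv (R := 𝓞 K) K).toMonoidHom

lemma cgA_odd (c : ClassGroup (𝓞 K)) (hc : cgA c = 1) : ∃ n : ℕ, Odd n ∧ c ^ n = 1 := by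
  obtain ⟨a, ha⟩ := QuotientGroup.mk_surjective (ClassGroup.equiv (R := 𝓞 K) K c)
  have h1 : cgA c = cl K a := by
    unfold cgA
    rw [MonoidHom.comp_apply]
    erw [← ha]
    rfl
  rw [h1, cl_eq_one] at hc
  obtain ⟨n, hn, h2⟩ := hc
  refine ⟨n, hn, ?_⟩
  apply (ClassGroup.equiv (R := 𝓞 K) K).injective
  rw [map_pow, ← ha, map_one, ← QuotientGroup.mk_pow, QuotientGroup.eq_one_iff]
  exact h2

theorem sylow_equiv (P : Sylow 2 (ClassGroup (𝓞 K))) : Nonempty (P ≃* A K) := by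
  haveI : Fact (Nat.Prime 2) := ⟨Nat.prime_two⟩
  let f : P →* A K := cgA.comp P.toSubgroup.subtype
  have hinj : Function.Injective f := by
    rw [injective_iff_map_eq_one]
    intro x hx
    obtain ⟨n, hn, h1⟩ := cgA_odd (x : ClassGroup (𝓞 K)) hx
    obtain ⟨j, hj⟩ := P.isPGroup' x
    have h1' : x ^ n = 1 := Subtype.ext h1
    have h2 : orderOf x ∣ n := orderOf_dvd_of_pow_eq_one h1'
    have h3 : orderOf x ∣ 2 ^ j := orderOf_dvd_of_pow_eq_one hj
    have h4 : Nat.Coprime n (2 ^ j) := (Nat.coprime_two_right.2 hn).pow_right j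
    have h5 : orderOf x ∣ 1 := by rw [← h4]; exact Nat.dvd_gcd h2 h3
    exact orderOf_eq_one_iff.1 (Nat.dvd_one.1 h5)
  have hcard : Nat.card P = Nat.card (A K) := by
    rw [Sylow.card_eq_multiplicity, A_card_eq]
  have hb : Function.Bijective f := (Nat.bijective_iff_injective_and_card f).2 ⟨hinj, hcard⟩
  exact ⟨MulEquiv.ofBijective f hb⟩

lemma h2_eq (F : IntermediateField ℚ ℝ) [NumberField F] : h2 F = Nat.card (A F) := by
  rw [A_card_eq, h2]
end transfer

section grp
lemma cyc_of_two {G : Type*} [CommGroup G] [Finite G] (hp : IsPGroup 2 G)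
    (h2 : ∀ x y : G, x ^ 2 = 1 → y ^ 2 = 1 → x ≠ 1 → y ≠ 1 → x = y) : IsCyclic G := by
  haveI : Fact (Nat.Prime 2) := ⟨Nat.prime_two⟩
  classical
  -- strong: take element of maximal order
  obtain ⟨g, hg⟩ := Finite.exists_max (fun x : G => orderOf x)
  refine ⟨⟨g, ?_⟩⟩
  -- by induction on exponent j with x^(2^j) = 1, x ∈ zpowers g
  suffices H : ∀ j : ℕ, ∀ x : G, x ^ (2 ^ j) = 1 → x ∈ Subgroup.zpowers g by
    intro x; obtain ⟨j, hj⟩ := hp x; exact H j x hj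
  intro j
  induction j with
  | zero => intro x hx; simp at hx; subst hx; exact Subgroup.one_mem _
  | succ j ih =>
    intro x hx
    have h1 : (x ^ 2) ^ (2 ^ j) = 1 := by rw [← pow_mul, ← pow_succ']; exact hx
    obtain ⟨i, hi⟩ := ih _ h1
    simp only at hi
    -- involution lies in zpowers g
    have hinv : ∀ y : G, y ^ 2 = 1 → y ∈ Subgroup.zpowers g := by
      intro y hy
      by_cases hy1 : y = 1
      · subst hy1; exact Subgroup.one_mem _
      obtain ⟨n, hn⟩ := hp g
      obtain ⟨t, ht⟩ := (Nat.dvd_prime_pow Nat.prime_two).1 (orderOf_dvd_of_pow_eq_one hn)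
      obtain ⟨-, ht⟩ := ht
      rcases t with _ | t
      · have := hg y
        simp only [ht, pow_zero] at this
        have h3 : orderOf y ≠ 1 := fun h => hy1 (orderOf_eq_one_iff.1 h)
        have h4 := orderOf_pos y
        omega
      · have h3 : (g ^ (2 ^ t)) ^ 2 = 1 := by
          rw [← pow_mul, ← pow_succ, ← ht, pow_orderOf_eq_one]
        have h4 : g ^ (2 ^ t) ≠ 1 := by
          intro h5
          have h6 := orderOf_dvd_of_pow_eq_one h5
          rw [ht] at h6
          have := Nat.le_of_dvd (by positivity) h6
          rw [pow_succ] at this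
          have : 0 < 2 ^ t := by positivity
          omega
        rw [h2 y _ hy h3 hy1 h4]
        exact Subgroup.pow_mem _ (Subgroup.mem_zpowers g) _
    rcases Int.even_or_odd' i with ⟨l, hl | hl⟩
    · have h3 : (x / g ^ l) ^ 2 = 1 := by
        rw [div_pow, ← hi, hl, div_eq_one, mul_comm, zpow_mul]; norm_cast
      have h4 := hinv _ h3
      have := Subgroup.mul_mem _ h4 (Subgroup.zpow_mem _ (Subgroup.mem_zpowers g) l)
      simpa using this
    · -- g = (x/g^l)^2, order of x/g^l is bigger unless trivial
      set y := x / g ^ l with hy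
      have h3 : y ^ 2 = g := by
        rw [hy, div_pow, ← hi, hl, zpow_add, zpow_one, mul_comm 2 l, zpow_mul]
        norm_cast
        exact mul_div_cancel_left _ _
      have h4 : orderOf y ∣ orderOf g := by
        have := hg y
        have hd : orderOf g ∣ orderOf y := by rw [← h3]; exact orderOf_pow_dvd 2
        have : orderOf y = orderOf g := le_antisymm this (Nat.le_of_dvd (orderOf_pos y) hd)
        rw [this]
      have h5 : g = 1 := by
        by_contra hg1
        have h6 : orderOf g = orderOf y / Nat.gcd (orderOf y) 2 := by
          rw [← h3, orderOf_pow]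
        have h7 := orderOf_pos y
        have h9 : orderOf y ≠ 1 := by
          intro h; rw [orderOf_eq_one_iff] at h; rw [h, one_pow] at h3; exact hg1 h3.symm
        obtain ⟨n, hn⟩ := hp y
        obtain ⟨t, -, ht⟩ := (Nat.dvd_prime_pow Nat.prime_two).1 (orderOf_dvd_of_pow_eq_one hn)
        have h8 : Nat.gcd (orderOf y) 2 = 2 := by
          rcases t with _ | t
          · exact absurd ht (by simpa using h9)
          · rw [ht]; exact Nat.gcd_eq_right ⟨2 ^ t, by rw [pow_succ']⟩
        rw [h8] at h6
        have := Nat.le_of_dvd (orderOf_pos g) h4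
        omega
      have h6 : y ^ 2 = 1 := by rw [h3, h5]
      have h7 := hinv _ h6
      have := Subgroup.mul_mem _ h7 (Subgroup.zpow_mem _ (Subgroup.mem_zpowers g) l)
      simpa [hy] using this

lemma exists_char {G : Type*} [CommGroup G] [Finite G] (c : G) (hc : ∀ y : G, y ^ 2 ≠ c) :
    ∃ H : Subgroup G, c ∉ H ∧ H.index = 2 := by
  let S : Subgroup G := (sq (X := G)).range
  have hcS : (QuotientGroup.mk c : G ⧸ S) ≠ 1 := by
    intro h
    rw [QuotientGroup.eq_one_iff] at h
    obtain ⟨y, hy⟩ := h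
    exact hc y hy
  haveI : Finite (G ⧸ S) := inferInstance
  haveI : NeZero (Monoid.exponent (G ⧸ S)) := ⟨Monoid.exponent_ne_zero_of_finite⟩
  obtain ⟨χ, hχ⟩ := CommGroup.exists_apply_ne_one_of_hasEnoughRootsOfUnity (G ⧸ S) ℂ hcS
  let f : G →* ℂˣ := χ.comp (QuotientGroup.mk' S)
  have hf2 : ∀ x, f x = 1 ∨ f x = -1 := by
    intro x
    have h1 : f x ^ 2 = 1 := by
      rw [← map_pow]
      have : (QuotientGroup.mk (x ^ 2) : G ⧸ S) = 1 := by
        rw [QuotientGroup.eq_one_iff]; exact ⟨x, rfl⟩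
      change χ (QuotientGroup.mk (x ^ 2)) = 1
      rw [this, map_one]
    have h2 : ((f x : ℂˣ) : ℂ) ^ 2 = 1 := by
      have := congrArg Units.val h1; simpa using this
    rcases mul_self_eq_one_iff.1 ((pow_two _).symm.trans h2) with h | h
    · left; ext; simpa using h
    · right; ext; simpa using h
  refine ⟨f.ker, fun h => hχ h, ?_⟩
  rw [Subgroup.index_eq_two_iff]
  have hfc : f c = -1 := (hf2 c).resolve_left hχ
  have hne : (1 : ℂˣ) ≠ -1 := by rw [← hfc]; exact fun h => hχ h.symm
  refine ⟨c, fun b => ?_⟩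
  rw [MonoidHom.mem_ker, MonoidHom.mem_ker, map_mul, hfc]
  rcases hf2 b with h | h
  · rw [h]; right; refine ⟨rfl, ?_⟩; simpa using hne.symm
  · rw [h]; left; refine ⟨by simp, hne.symm⟩

theorem grp_final {G : Type*} [CommGroup G] [Finite G] (hp : IsPGroup 2 G) (m : ℕ)
    (hcard : Nat.card G = 2 ^ (m + 1)) (c : G) (hc2 : c ^ 2 = 1) (hc : ∀ y : G, y ^ 2 ≠ c)
    (ht : Nat.card (sq (X := G)).ker ≤ 4) :
    Nonempty (G ≃* Multiplicative (ZMod 2 × ZMod (2 ^ m))) := by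
  obtain ⟨H, hcH, hH⟩ := exists_char c hc
  have hc1 : c ≠ 1 := fun h => hcH (h ▸ H.one_mem)
  have hHc : Nat.card H = 2 ^ m := by
    have := Subgroup.card_mul_index H
    rw [hH, hcard, pow_succ] at this
    omega
  have hcyc : IsCyclic H := by
    apply cyc_of_two (hp.to_subgroup H)
    intro x y hx hy hx1 hy1
    by_contra hxy
    have hx' : (x : G) ^ 2 = 1 := by exact_mod_cast congrArg Subtype.val hx
    have hy' : (y : G) ^ 2 = 1 := by exact_mod_cast congrArg Subtype.val hy
    have key : ({1, (x : G), (y : G), c, c * x} : Set G) ⊆ ((sq (X := G)).ker : Set G) := by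
      intro z hz
      change z ^ 2 = 1
      rcases hz with rfl | rfl | rfl | rfl | rfl
      · simp
      · exact hx'
      · exact hy'
      · exact hc2
      · rw [mul_pow, hc2, hx', one_mul]
    have h1 : ({1, (x : G), (y : G), c, c * x} : Set G).ncard = 5 := by
      have a1 : (x : G) ≠ 1 := fun h => hx1 (Subtype.ext h)
      have a2 : (y : G) ≠ 1 := fun h => hy1 (Subtype.ext h)
      have a3 : (x : G) ≠ y := fun h => hxy (Subtype.ext h)
      have a4 : ∀ z : H, c ≠ z := fun z h => hcH (h ▸ z.2)
      have a5 : ∀ z : H, c * x ≠ z := fun z h => hcH (by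
        have : c = (z / x : H) := by rw [Subgroup.coe_div, ← h]; simp
        rw [this]; exact (z / x).2)
      have a6 : c ≠ c * x := fun h => a1 (by simpa using h)
      have a7 : c * x ≠ 1 := fun h => a5 1 (by simpa using h)
      rw [Set.ncard_insert_of_notMem, Set.ncard_insert_of_notMem, Set.ncard_insert_of_notMem, Set.ncard_pair a6]
      · simp only [Set.mem_insert_iff, Set.mem_singleton_iff, not_or]
        exact ⟨(a4 y).symm, (a5 y).symm⟩
      · simp only [Set.mem_insert_iff, Set.mem_singleton_iff, not_or]
        exact ⟨a3, (a4 x).symm, (a5 x).symm⟩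
      · simp only [Set.mem_insert_iff, Set.mem_singleton_iff, not_or]
        exact ⟨a1.symm, a2.symm, hc1.symm, a7.symm⟩
    have h2 := Set.ncard_le_ncard key (Set.toFinite _)
    rw [h1, ← Nat.card_coe_set_eq] at h2
    have h3 : Nat.card ((sq (X := G)).ker : Set G) = Nat.card (sq (X := G)).ker := rfl
    omega
  -- product
  let Z := Subgroup.zpowers c
  have hZ : Nat.card Z = 2 := by
    rw [Nat.card_zpowers]
    exact orderOf_eq_prime hc2 hc1
  have hdis : Disjoint Z H := by
    rw [Subgroup.disjoint_def]
    rintro x ⟨n, rfl⟩ hx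
    simp only at hx ⊢
    rcases Int.even_or_odd' n with ⟨l, rfl | rfl⟩
    · rw [zpow_mul]; norm_cast; rw [hc2, one_zpow]
    · exfalso; apply hcH
      have : c ^ (2 * l + 1) = c := by
        rw [zpow_add, zpow_mul, zpow_one]; norm_cast; rw [hc2, one_zpow, one_mul]
      rwa [this] at hx
  let f : Z × H →* G := Z.subtype.coprod H.subtype
  have hfi : Function.Injective f := by
    rw [injective_iff_map_eq_one]
    rintro ⟨a, b⟩ hab
    have h1 : (a : G) * b = 1 := hab
    have h2 : (a : G) = (b : G)⁻¹ := eq_inv_of_mul_eq_one_left h1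
    have h3 : (a : G) = 1 := (Subgroup.disjoint_def.1 hdis) a.2 (h2 ▸ H.inv_mem b.2)
    have h4 : (b : G) = 1 := by rw [h3, one_mul] at h1; exact h1
    ext
    · exact h3
    · exact h4
  have hfb : Function.Bijective f := (Nat.bijective_iff_injective_and_card f).2 ⟨hfi, by
    rw [Nat.card_prod, hZ, hHc, hcard, pow_succ, mul_comm]⟩
  haveI : IsCyclic Z := inferInstance
  have e1 : Z ≃* Multiplicative (ZMod 2) := by
    have := zmodCyclicMulEquiv (G := Z) inferInstance
    rw [hZ] at this; exact this.symm
  have e2 : H ≃* Multiplicative (ZMod (2 ^ m)) := by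
    have := zmodCyclicMulEquiv (G := H) hcyc
    rw [hHc] at this; exact this.symm
  exact ⟨(MulEquiv.ofBijective f hfb).symm.trans ((e1.prodCongr e2).trans (MulEquiv.prodMultiplicative _ _).symm)⟩

end grp
end Wk

open IntermediateField NumberField
set_option linter.all false
namespace Wk
open scoped nonZeroDivisors
section ad
/-- `K(α)` -/
noncomputable def ad (K : IntermediateField ℚ ℝ) (α : ℝ) : IntermediateField ℚ ℝ := K ⊔ adjoin ℚ {α}

variable {K L : IntermediateField ℚ ℝ} {α β : ℝ}

lemma mem_ad : α ∈ ad K α :=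
  (le_sup_right : adjoin ℚ {α} ≤ ad K α) (mem_adjoin_simple_self ℚ α)

lemma le_ad : K ≤ ad K α := le_sup_left

lemma ad_le (h : K ≤ L) (hα : α ∈ L) : ad K α ≤ L :=
  sup_le h (adjoin_le_iff.2 (by simpa using hα))

/-- inclusion as a ring hom -/
noncomputable def inc (h : K ≤ L) : K →+* L := (inclusion h).toRingHom

@[simp] lemma coe_inc (h : K ≤ L) (x : K) : ((inc h x : L) : ℝ) = x := rfl

lemma ad_form (hα : α ^ 2 ∈ K) {x : ℝ} (hx : x ∈ ad K α) : ∃ a ∈ K, ∃ b ∈ K, x = a + b * α := by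
  by_cases hK : α ∈ K
  · exact ⟨x, ad_le le_rfl hK hx, 0, K.zero_mem, by ring⟩
  let S : IntermediateField ℚ ℝ :=
    { carrier := {x | ∃ a ∈ K, ∃ b ∈ K, x = a + b * α}
      mul_mem' := by
        rintro _ _ ⟨a, ha, b, hb, rfl⟩ ⟨c, hc, d, hd, rfl⟩
        exact ⟨a * c + b * d * α ^ 2, K.add_mem (K.mul_mem ha hc) (K.mul_mem (K.mul_mem hb hd) hα),
          a * d + b * c, K.add_mem (K.mul_mem ha hd) (K.mul_mem hb hc), by ring⟩
      add_mem' := by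
        rintro _ _ ⟨a, ha, b, hb, rfl⟩ ⟨c, hc, d, hd, rfl⟩
        exact ⟨a + c, K.add_mem ha hc, b + d, K.add_mem hb hd, by ring⟩
      algebraMap_mem' := fun r => ⟨algebraMap ℚ ℝ r, K.algebraMap_mem r, 0, K.zero_mem, by ring⟩
      inv_mem' := by
        rintro _ ⟨a, ha, b, hb, rfl⟩
        have hN : a ^ 2 - b ^ 2 * α ^ 2 ∈ K :=
          K.sub_mem (K.pow_mem ha 2) (K.mul_mem (K.pow_mem hb 2) hα)
        by_cases h0 : a ^ 2 - b ^ 2 * α ^ 2 = 0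
        · have hb0 : b = 0 := by
            by_contra hb0
            have : (a - b * α) * (a + b * α) = 0 := by linear_combination h0
            rcases mul_eq_zero.1 this with h | h
            · apply hK
              have : α = a / b := by field_simp; linear_combination -h
              rw [this]; exact K.div_mem ha hb
            · apply hK
              have : α = - a / b := by field_simp; linear_combination h
              rw [this]; exact K.div_mem (K.neg_mem ha) hb
          subst hb0
          exact ⟨a⁻¹, K.inv_mem ha, 0, K.zero_mem, by simp⟩
        · refine ⟨a / (a ^ 2 - b ^ 2 * α ^ 2), K.div_mem ha hN, -b / (a ^ 2 - b ^ 2 * α ^ 2),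
            K.div_mem (K.neg_mem hb) hN, ?_⟩
          have h1 : a + b * α ≠ 0 := by
            intro h; apply h0; linear_combination (a - b * α) * h
          field_simp
          ring }
  have : ad K α ≤ S := ad_le (fun y hy => ⟨y, hy, 0, K.zero_mem, by ring⟩) ⟨0, K.zero_mem, 1, K.one_mem, by ring⟩
  exact this hx

lemma ad_form' (hL : L = ad K α) (hK : K ≤ L) (hα : α ^ 2 ∈ K) (hα' : α ∈ L) (x : L) :
    ∃ a b : K, x = inc hK a + inc hK b * ⟨α, hα'⟩ := by
  obtain ⟨a, ha, b, hb, h⟩ := ad_form hα (show (x : ℝ) ∈ ad K α by rw [← hL]; exact x.2)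
  exact ⟨⟨a, ha⟩, ⟨b, hb⟩, Subtype.ext h⟩

lemma ad_uniq (hα : α ∉ K) {a b c d : K} (h : (a : ℝ) + b * α = c + d * α) : a = c ∧ b = d := by
  have hb : b = d := by
    by_contra hb
    have hb' : (b : ℝ) - d ≠ 0 := fun h' => hb (Subtype.ext (sub_eq_zero.1 h'))
    apply hα
    have : α = (c - a) / (b - d) := by field_simp; linear_combination h
    rw [this]
    exact K.div_mem (K.sub_mem c.2 a.2) (K.sub_mem b.2 d.2)
  subst hb
  exact ⟨Subtype.ext (by linear_combination h), rfl⟩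

theorem lift_hom (hL : L = ad K α) (hK : K ≤ L) (hα : α ^ 2 ∈ K) (hα' : α ∈ L) (hn : α ∉ K)
    {M : Type*} [Field M] (f : K →+* M) (y : M) (hy : y ^ 2 = f ⟨α ^ 2, hα⟩) :
    ∃ F : L →+* M, (∀ x : K, F (inc hK x) = f x) ∧ F ⟨α, hα'⟩ = y := by
  choose A B hAB using ad_form' hL hK hα hα'
  have hAB' : ∀ x : L, (x : ℝ) = A x + B x * α := fun x => congrArg Subtype.val (hAB x)
  have key : ∀ (x : L) (a b : K), (x : ℝ) = a + b * α → A x = a ∧ B x = b := fun x a b h =>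
    ad_uniq hn (by rw [← hAB' x, h])
  let F : L →+* M :=
    { toFun := fun x => f (A x) + f (B x) * y
      map_one' := by
        obtain ⟨h1, h2⟩ := key 1 1 0 (by simp)
        rw [h1, h2]; simp
      map_zero' := by
        obtain ⟨h1, h2⟩ := key 0 0 0 (by simp)
        rw [h1, h2]; simp
      map_mul' := fun u v => by
        obtain ⟨h1, h2⟩ := key (u * v) (A u * A v + B u * B v * ⟨α ^ 2, hα⟩) (A u * B v + B u * A v) (by
          push_cast
          rw [hAB' u, hAB' v]; ring)
        rw [h1, h2]; simp only [map_add, map_mul, ← hy]; ring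
      map_add' := fun u v => by
        obtain ⟨h1, h2⟩ := key (u + v) (A u + A v) (B u + B v) (by
          push_cast
          rw [hAB' u, hAB' v]; ring)
        rw [h1, h2]; simp only [map_add]; ring }
  refine ⟨F, fun x => ?_, ?_⟩
  · obtain ⟨h1, h2⟩ := key (inc hK x) x 0 (by simp)
    change f (A (inc hK x)) + f (B (inc hK x)) * y = f x
    rw [h1, h2]; simp
  · obtain ⟨h1, h2⟩ := key ⟨α, hα'⟩ 0 1 (by simp)
    change f (A ⟨α, hα'⟩) + f (B ⟨α, hα'⟩) * y = y
    rw [h1, h2]; simp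

/-- two homs agreeing on K and α agree -/
lemma hom_ext' (hL : L = ad K α) (hK : K ≤ L) (hα : α ^ 2 ∈ K) (hα' : α ∈ L)
    {M : Type*} [Field M] (F G : L →+* M) (h1 : ∀ x : K, F (inc hK x) = G (inc hK x))
    (h2 : F ⟨α, hα'⟩ = G ⟨α, hα'⟩) (x : L) : F x = G x := by
  obtain ⟨a, b, rfl⟩ := ad_form' hL hK hα hα' x
  simp only [map_add, map_mul, h1, h2]

lemma quad_of [NumberField K] [NumberField L] (hL : L = ad K α) (hK : K ≤ L) (hα : α ^ 2 ∈ K) (hα' : α ∈ L) (h0 : α ≠ 0)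
    (σ : L →+* L) (h1 : ∀ x, σ (inc hK x) = inc hK x) (h2 : σ ⟨α, hα'⟩ = -⟨α, hα'⟩) :
    IsQuad (inc hK) σ := by
  have h00 : (⟨α, hα'⟩ : L) ≠ 0 := fun h => h0 (congrArg Subtype.val h)
  refine ⟨fun x => ?_, fun x hx => ?_, h1, ⟨⟨α, hα'⟩, ?_⟩⟩
  · have := hom_ext' hL hK hα hα' (σ.comp σ) (RingHom.id L) (fun x => by simp [h1]) (by simp [h2]) x
    simpa using this
  · obtain ⟨a, b, rfl⟩ := ad_form' hL hK hα hα' x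
    simp only [map_add, map_mul, h1, h2] at hx
    have : inc hK b * (⟨α, hα'⟩ : L) = 0 := by
      have h3 : (2 : L) * (inc hK b * (⟨α, hα'⟩ : L)) = 0 := by linear_combination -hx
      simpa using h3
    exact ⟨a, by rw [this, add_zero]⟩
  · rw [h2]; intro h
    have h3 : (2 : L) * (⟨α, hα'⟩ : L) = 0 := by linear_combination -h
    exact h00 (by simpa using h3)

lemma quad_mk [NumberField K] [NumberField L] (hL : L = ad K α) (hK : K ≤ L) (hα : α ^ 2 ∈ K) (hα' : α ∈ L) (hn : α ∉ K) :
    ∃ σ : L →+* L, IsQuad (inc hK) σ ∧ σ ⟨α, hα'⟩ = -⟨α, hα'⟩ := by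
  obtain ⟨σ, h1, h2⟩ := lift_hom hL hK hα hα' hn (inc hK) (-⟨α, hα'⟩) (by
    rw [neg_sq]; exact Subtype.ext rfl)
  exact ⟨σ, quad_of hL hK hα hα' (fun h => hn (h ▸ K.zero_mem)) σ h1 h2, h2⟩

lemma nf_ad (K : IntermediateField ℚ ℝ) [NumberField K] (hα : α ^ 2 ∈ K) : NumberField (ad K α) := by
  have h1 : IsIntegral ℚ (α ^ 2) := by
    have := Algebra.IsIntegral.isIntegral (R := ℚ) (⟨α ^ 2, hα⟩ : K)
    exact this.map (K.val)
  have h2 : IsIntegral ℚ α := IsIntegral.of_pow two_pos h1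
  haveI : FiniteDimensional ℚ (adjoin ℚ {α}) := adjoin.finiteDimensional h2
  haveI : FiniteDimensional ℚ (ad K α) := IntermediateField.finiteDimensional_sup K (adjoin ℚ {α})
  exact ⟨⟩

lemma notin (hα : α ^ 2 ∈ K) (hβ : β ^ 2 ∈ K) (hβ' : β ∈ ad K α) : α ∈ K ∨ β ∈ K ∨ α * β ∈ K := by
  obtain ⟨a, ha, b, hb, h⟩ := ad_form hα hβ'
  by_cases hαK : α ∈ K
  · exact Or.inl hαK
  by_cases ha0 : a = 0
  · subst ha0
    right; right
    have : α * β = b * α ^ 2 := by rw [h]; ring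
    rw [this]; exact K.mul_mem hb hα
  by_cases hb0 : b = 0
  · subst hb0; right; left; rw [h]; simpa using ha
  left
  have : α = (β ^ 2 - a ^ 2 - b ^ 2 * α ^ 2) / (2 * a * b) := by
    rw [h]; field_simp; ring
  rw [this]
  exact K.div_mem (K.sub_mem (K.sub_mem hβ (K.pow_mem ha 2)) (K.mul_mem (K.pow_mem hb 2) hα))
    (K.mul_mem (K.mul_mem (by exact_mod_cast K.natCast_mem 2) ha) hb)

lemma tr_ad (hL : L = ad K α) (hK : K ≤ L) (hα : α ^ 2 ∈ K) (hα' : α ∈ L) [NumberField K] [NumberField L]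
    [IsTotallyReal K] (h : ∀ f : L →+* ℂ, (starRingEnd ℂ) (f ⟨α, hα'⟩) = f ⟨α, hα'⟩) : IsTotallyReal L := by
  refine ⟨fun v => ?_⟩
  rw [InfinitePlace.isReal_iff]
  apply RingHom.ext
  intro x
  refine hom_ext' hL hK hα hα' _ _ (fun y => ?_) (h _) x
  have hr : ComplexEmbedding.IsReal (v.embedding.comp (inc hK)) := by
    rw [← InfinitePlace.isReal_mk_iff]
    exact IsTotallyReal.isReal _
  exact RingHom.congr_fun hr y
end ad
end Wk

open IntermediateField NumberField
set_option linter.all false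
namespace Wk
open scoped nonZeroDivisors
section np
variable {K : Type*} [Field K] [NumberField K]
variable {L : Type*} [Field L] [NumberField L]
variable {φ : K →+* L} {σ : L →+* L}

/-- at most `c` nonzero primes of `K` contain `a` -/
def NP (K : Type*) [Field K] [NumberField K] (a c : ℕ) : Prop :=
  ∃ S : Finset (Ideal (𝓞 K)), S.card ≤ c ∧
    ∀ P : Ideal (𝓞 K), P ≠ ⊥ → P.IsPrime → (a : 𝓞 K) ∈ P → P ∈ S

/-- at most one prime of `K` contains `a` -/
def Uq (K : Type*) [Field K] [NumberField K] (a : ℕ) : Prop :=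
  ∀ P Q : Ideal (𝓞 K), P ≠ ⊥ → P.IsPrime → (a : 𝓞 K) ∈ P → Q ≠ ⊥ → Q.IsPrime → (a : 𝓞 K) ∈ Q → P = Q

lemma NP_mul {a b c d : ℕ} (h1 : NP K a c) (h2 : NP K b d) : NP K (a * b) (c + d) := by
  classical
  obtain ⟨S, hS, h⟩ := h1
  obtain ⟨T, hT, h'⟩ := h2
  refine ⟨S ∪ T, (Finset.card_union_le _ _).trans (by omega), fun P hP hPp hm => ?_⟩
  rw [Nat.cast_mul] at hm
  rw [Finset.mem_union]
  rcases hPp.mem_or_mem hm with h3 | h3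
  · exact Or.inl (h P hP hPp h3)
  · exact Or.inr (h' P hP hPp h3)

lemma NP_of_Uq {a : ℕ} (h : Uq K a) : NP K a 1 := by
  classical
  by_cases h0 : ∃ P : Ideal (𝓞 K), P ≠ ⊥ ∧ P.IsPrime ∧ (a : 𝓞 K) ∈ P
  · obtain ⟨P, h1, h2, h3⟩ := h0
    exact ⟨{P}, by simp, fun Q a1 a2 a3 => by simpa using h Q P a1 a2 a3 h1 h2 h3⟩
  · exact ⟨∅, by simp, fun Q a1 a2 a3 => absurd ⟨Q, a1, a2, a3⟩ h0⟩

lemma om_nat (φ : K →+* L) (a : ℕ) : om φ (a : 𝓞 K) = (a : 𝓞 L) := map_natCast _ _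

lemma comap_mem (φ : K →+* L) (P : Ideal (𝓞 L)) (a : ℕ) (h : (a : 𝓞 L) ∈ P) : (a : 𝓞 K) ∈ P.comap (om φ) := by
  rw [Ideal.mem_comap, om_nat]; exact h

lemma NP_quad (h : IsQuad φ σ) {a c : ℕ} (hc : NP K a c) : NP L a (2 * c) := by
  classical
  obtain ⟨S, hS, h'⟩ := hc
  let T : Ideal (𝓞 K) → Finset (Ideal (𝓞 L)) := fun p =>
    if hp : ∃ P : Ideal (𝓞 L), P ≠ ⊥ ∧ P.IsPrime ∧ P.comap (om φ) = p then {hp.choose, hp.choose.map (om σ)} else ∅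
  refine ⟨S.biUnion T, ?_, fun P hP hPp hm => ?_⟩
  · refine (Finset.card_biUnion_le_card_mul S T 2 (fun p _ => ?_)).trans (by omega)
    simp only [T]; split_ifs
    · exact Finset.card_le_two
    · simp
  · rw [Finset.mem_biUnion]
    refine ⟨P.comap (om φ), h' _ (comap_ne_bot φ P hP) (Ideal.comap_isPrime _ _) (comap_mem φ P a hm), ?_⟩
    have hp : ∃ P' : Ideal (𝓞 L), P' ≠ ⊥ ∧ P'.IsPrime ∧ P'.comap (om φ) = P.comap (om φ) := ⟨P, hP, hPp, rfl⟩
    simp only [T]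
    rw [dif_pos hp]
    obtain ⟨h1, h2, h3⟩ := hp.choose_spec
    rcases over_same h _ P h1 hP h3 with h4 | h4
    · rw [Finset.mem_insert]; exact Or.inl h4
    · rw [Finset.mem_insert, Finset.mem_singleton]; exact Or.inr h4

lemma Uq_sig (h : IsQuad φ σ) {a : ℕ} (hK : Uq K a)
    (hs : ∃ P : Ideal (𝓞 L), P ≠ ⊥ ∧ P.IsPrime ∧ (a : 𝓞 L) ∈ P ∧ P.map (om σ) = P) : Uq L a := by
  obtain ⟨P, h1, h2, h3, h4⟩ := hs
  have key : ∀ Q : Ideal (𝓞 L), Q ≠ ⊥ → Q.IsPrime → (a : 𝓞 L) ∈ Q → Q = P := by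
    intro Q b1 b2 b3
    have := hK _ _ (comap_ne_bot φ P h1) (Ideal.comap_isPrime _ _) (comap_mem φ P a h3)
      (comap_ne_bot φ Q b1) (Ideal.comap_isPrime _ _) (comap_mem φ Q a b3)
    rcases over_same h P Q h1 b1 this with h5 | h5
    · exact h5
    · rw [h5, h4]
  intro Q Q' a1 a2 a3 b1 b2 b3
  rw [key Q a1 a2 a3, key Q' b1 b2 b3]

lemma Uq_of_span (p : ℕ) (h : (Ideal.span {(p : 𝓞 K)}).IsPrime) (hp : p ≠ 0) : Uq K p := by
  have hb : Ideal.span {(p : 𝓞 K)} ≠ ⊥ := by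
    rw [Ne, Ideal.span_singleton_eq_bot]; exact_mod_cast hp
  have hm := h.isMaximal hb
  have key : ∀ Q : Ideal (𝓞 K), Q ≠ ⊥ → Q.IsPrime → (p : 𝓞 K) ∈ Q → Ideal.span {(p : 𝓞 K)} = Q := by
    intro Q _ b2 b3
    exact hm.eq_of_le b2.ne_top ((Ideal.span_singleton_le_iff_mem _).2 b3)
  intro Q Q' a1 a2 a3 b1 b2 b3
  rw [← key Q a1 a2 a3, ← key Q' b1 b2 b3]

theorem ri_dvd (h : IsQuad φ σ) {a c : ℕ} (hR : ∀ P, Ram φ σ P → (a : 𝓞 L) ∈ P) (hc : NP K a c) :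
    ri φ σ ∣ 2 ^ c := by
  obtain ⟨S, hS, h'⟩ := hc
  refine (ram_bound h S (fun P hP => ?_)).trans (pow_dvd_pow 2 hS)
  haveI := hP.2.1
  exact h' _ (comap_ne_bot φ P hP.1) (Ideal.comap_isPrime _ _) (comap_mem φ P a (hR P hP))

theorem ri_one (h : IsQuad φ σ) (hR : ∀ P, ¬ Ram φ σ P) : ri φ σ = 1 := by
  have := ram_bound h ∅ (fun P hP => absurd hP (hR P))
  simpa [ri] using this

lemma exists_prime_over (p : ℕ) (hp : p.Prime) : ∃ P : Ideal (𝓞 L), P ≠ ⊥ ∧ P.IsPrime ∧ (p : 𝓞 L) ∈ P := by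
  have hb : Ideal.span {(p : 𝓞 L)} ≠ ⊤ := by
    rw [Ne, Ideal.span_singleton_eq_top]
    intro hu
    have h1 : Ideal.absNorm (Ideal.span {(p : 𝓞 L)}) = 1 := by
      rw [Ideal.absNorm_eq_one_iff, Ideal.span_singleton_eq_top]; exact hu
    rw [Ideal.absNorm_span_singleton] at h1
    have h2 : Algebra.norm ℤ ((p : ℤ) : 𝓞 L) = (p : ℤ) ^ Module.finrank ℤ (𝓞 L) := by
      have := Algebra.norm_algebraMap (S := 𝓞 L) (p : ℤ)
      simpa using this
    rw [← Int.cast_natCast, h2, Int.natAbs_pow, Int.natAbs_natCast] at h1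
    have h3 : Module.finrank ℤ (𝓞 L) ≠ 0 := by
      rw [RingOfIntegers.rank]; exact Module.finrank_pos.ne'
    have := (Nat.pow_eq_one.1 h1).resolve_right h3
    exact hp.one_lt.ne' this
  obtain ⟨P, hP, hle⟩ := Ideal.exists_le_maximal _ hb
  have hm : (p : 𝓞 L) ∈ P := hle (Ideal.mem_span_singleton_self _)
  refine ⟨P, ?_, hP.isPrime, hm⟩
  rintro rfl
  rw [Ideal.mem_bot] at hm
  exact hp.ne_zero (by exact_mod_cast hm)

/-- a prime ideal containing a rational prime contains no coprime integer -/
lemma int_mem_dvd {p : ℕ} (hp : p.Prime) (P : Ideal (𝓞 L)) (hP : P.IsPrime) (hm : (p : 𝓞 L) ∈ P) (n : ℤ)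
    (hn : (n : 𝓞 L) ∈ P) : (p : ℤ) ∣ n := by
  by_contra hd
  have hc : IsCoprime (p : ℤ) n := (Nat.prime_iff_prime_int.1 hp).coprime_iff_not_dvd.2 hd
  obtain ⟨a, b, hab⟩ := hc
  apply hP.ne_top
  rw [Ideal.eq_top_iff_one]
  have : (1 : 𝓞 L) = (a : 𝓞 L) * (p : 𝓞 L) + (b : 𝓞 L) * (n : 𝓞 L) := by
    have := congrArg (Int.cast : ℤ → 𝓞 L) hab
    push_cast at this; exact this.symm
  rw [this]
  exact P.add_mem (P.mul_mem_left _ hm) (P.mul_mem_left _ hn)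

/-- ramification at 2 detected by an Eisenstein type element -/
lemma Uq_two (h : IsQuad φ σ) (h2 : (Ideal.span {((2:ℕ) : 𝓞 K)}).IsPrime) (β : 𝓞 L) (t : 𝓞 K) (n : ℤ)
    (ht : β + om σ β = om φ (2 * t)) (hn : β * om σ β = (n : 𝓞 L)) (hn4 : n % 4 = 2) : Uq L 2 := by
  have hK := Uq_of_span 2 h2 two_ne_zero
  obtain ⟨P, h1, h3, h4⟩ := exists_prime_over (L := L) 2 Nat.prime_two
  refine Uq_sig h hK ⟨P, h1, h3, h4, ?_⟩
  by_contra hne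
  have hcomap : P.comap (om φ) = Ideal.span {((2:ℕ) : 𝓞 K)} := by
    refine ((h2.isMaximal ?_).eq_of_le ?_ ?_).symm
    · rw [Ne, Ideal.span_singleton_eq_bot]; norm_num
    · exact (Ideal.comap_isPrime (om φ) P).ne_top
    · rw [Ideal.span_singleton_le_iff_mem]; exact comap_mem φ P 2 h4
  have hβ : ∀ Q : Ideal (𝓞 L), Q.IsPrime → ((2:ℕ) : 𝓞 L) ∈ Q → β ∈ Q := by
    intro Q hQ hm
    have e1 : β ^ 2 = om φ (2 * t) * β - (n : 𝓞 L) := by rw [← ht, ← hn]; ring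
    apply hQ.mem_of_pow_mem 2
    rw [e1]
    apply Q.sub_mem
    · apply Q.mul_mem_right
      rw [map_mul]; apply Q.mul_mem_right
      have : om φ (2 : 𝓞 K) = ((2:ℕ) : 𝓞 L) := by exact_mod_cast om_nat φ 2
      rw [this]; exact hm
    · obtain ⟨l, hl⟩ : (2:ℤ) ∣ n := by omega
      rw [hl]; push_cast; apply Q.mul_mem_right; exact_mod_cast hm
  haveI := h3
  rcases prime_cases h P h1 with ⟨_, h5, _⟩ | ⟨h5, _⟩ | ⟨h5, _⟩
  · haveI := h.map_prime P
    have m1 := hβ P h3 h4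
    have m2 : β ∈ P.map (om σ) := hβ _ inferInstance (by
      have := Ideal.mem_map_of_mem (om σ) h4
      rwa [om_nat] at this)
    have hsup : IsCoprime P (P.map (om σ)) := by
      have hb : P.map (om σ) ≠ ⊥ := map_ne_bot σ h1
      haveI a1 := h3.isMaximal h1
      haveI a2 := (h.map_prime P).isMaximal hb
      exact Ideal.isCoprime_of_isMaximal (Ne.symm hne)
    have m3 : β ∈ P * P.map (om σ) := by
      rw [← Ideal.inf_eq_mul_of_isCoprime hsup]; exact ⟨m1, m2⟩
    rw [← h5, hcomap, Ideal.map_span, Set.image_singleton, om_nat, Ideal.mem_span_singleton] at m3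
    obtain ⟨b, hb⟩ := m3
    have e2 : (n : 𝓞 L) = 4 * (b * om σ b) := by
      rw [← hn, hb, map_mul, om_nat]; push_cast; ring
    -- norm of n
    have e3 := congrArg (Algebra.norm ℤ) e2
    obtain ⟨c, hc⟩ := h.norm_int b
    have h40 : ((4:ℤ) : L) ≠ 0 := by norm_num
    -- b σ b = n/4 rational and integral
    have e4 : ((b * om σ b : 𝓞 L) : L) = algebraMap ℚ L ((n : ℚ) / 4) := by
      have := congrArg (algebraMap (𝓞 L) L) e2
      simp only [map_intCast, map_mul, map_ofNat] at this
      rw [map_div₀, map_intCast, map_ofNat, this]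
      simp
    have e5 : IsIntegral ℤ ((n : ℚ) / 4) := by
      have : IsIntegral ℤ (algebraMap ℚ L ((n : ℚ) / 4)) := by rw [← e4]; exact (b * om σ b).2
      exact (isIntegral_algebraMap_iff (algebraMap ℚ L).injective).1 this
    obtain ⟨z, hz⟩ := IsIntegrallyClosed.isIntegral_iff.1 e5
    have : (z : ℚ) * 4 = n := by
      rw [show (z : ℚ) = algebraMap ℤ ℚ z from rfl, hz]; field_simp
    have : z * 4 = n := by exact_mod_cast this
    omega
  · exact hne h5
  · exact hne h5
end np

section bot
instance nf_bot : NumberField (⊥ : IntermediateField ℚ ℝ) := ⟨⟩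

noncomputable abbrev Q0 : IntermediateField ℚ ℝ := ⊥

lemma bot_rat (x : Q0) : ∃ y : ℚ, x = algebraMap ℚ Q0 y := by
  obtain ⟨y, hy⟩ := mem_bot.1 x.2
  exact ⟨y, Subtype.ext hy.symm⟩

lemma bot_int (x : 𝓞 Q0) : ∃ n : ℤ, x = (n : 𝓞 Q0) := by
  obtain ⟨y, hy⟩ := bot_rat (x : Q0)
  have e5 : IsIntegral ℤ y := by
    have : IsIntegral ℤ (algebraMap ℚ Q0 y) := by rw [← hy]; exact x.2
    exact (isIntegral_algebraMap_iff (algebraMap ℚ Q0).injective).1 this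
  obtain ⟨z, hz⟩ := IsIntegrallyClosed.isIntegral_iff.1 e5
  refine ⟨z, RingOfIntegers.ext ?_⟩
  rw [hy, ← hz]; simp

instance tr_bot : IsTotallyReal Q0 := by
  refine ⟨fun v => ?_⟩
  rw [InfinitePlace.isReal_iff]
  apply RingHom.ext
  intro x
  obtain ⟨y, rfl⟩ := bot_rat x
  simp

lemma bot_ker (P : Ideal (𝓞 Q0)) (hP : P.IsPrime) (p : ℕ) (hp : p.Prime) (hm : (p : 𝓞 Q0) ∈ P) : P = Ideal.span {(p : 𝓞 Q0)} := by
  apply le_antisymm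
  · intro x hx
    obtain ⟨n, rfl⟩ := bot_int x
    obtain ⟨l, rfl⟩ := int_mem_dvd hp P hP hm n hx
    rw [Ideal.mem_span_singleton]; exact ⟨l, by push_cast; ring⟩
  · rwa [Ideal.span_singleton_le_iff_mem]

lemma bot_span (p : ℕ) (hp : p.Prime) : (Ideal.span {(p : 𝓞 Q0)}).IsPrime := by
  obtain ⟨P, -, h2, h3⟩ := exists_prime_over (L := Q0) p hp
  rw [← bot_ker P h2 p hp h3]; exact h2

lemma Uq_bot (p : ℕ) (hp : p.Prime) : Uq Q0 p := Uq_of_span p (bot_span p hp) hp.ne_zero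

lemma NP_bot (p : ℕ) (hp : p.Prime) : NP Q0 p 1 := NP_of_Uq (Uq_bot p hp)

lemma A_bot : Nat.card (A Q0) = 1 := by
  rw [A_card_eq]
  haveI : IsPrincipalIdealRing (𝓞 Q0) := by
    apply IsPrincipalIdealRing.of_surjective (Int.castRingHom (𝓞 Q0))
    intro x; obtain ⟨n, rfl⟩ := bot_int x; exact ⟨n, rfl⟩
  have : Nat.card (ClassGroup (𝓞 Q0)) = 1 := by
    rw [Nat.card_eq_fintype_card]
    convert card_classGroup_eq_one (R := 𝓞 Q0)
  rw [this]; simp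

variable {L : Type*} [Field L] [NumberField L] {φ : Q0 →+* L} {σ : L →+* L}

lemma frob_of_norm (P : Ideal (𝓞 L)) (hP : P ≠ ⊥) (hPp : P.IsPrime) (p : ℕ) (hp : p.Prime) (hm : (p : 𝓞 L) ∈ P)
    (hN : Ideal.absNorm P = Ideal.absNorm (P.comap (om φ))) (β : 𝓞 L) : β ^ p - β ∈ P := by
  haveI := Fact.mk hp
  obtain ⟨y, hy⟩ := same_norm_res φ P hP hN β
  obtain ⟨n, rfl⟩ := bot_int y
  rw [map_intCast] at hy
  have h1 : β ^ p - (n : 𝓞 L) ^ p ∈ P := P.mem_of_dvd (sub_dvd_pow_sub_pow _ _ _) hy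
  have h2 : (n : 𝓞 L) ^ p - (n : 𝓞 L) ∈ P := by
    have : (p : ℤ) ∣ n ^ p - n := by
      rw [← ZMod.intCast_zmod_eq_zero_iff_dvd]
      push_cast
      rw [ZMod.pow_card, sub_self]
    obtain ⟨l, hl⟩ := this
    have h3 : (n : 𝓞 L) ^ p - (n : 𝓞 L) = (p : 𝓞 L) * l := by
      have := congrArg (Int.cast : ℤ → 𝓞 L) hl
      push_cast at this; exact this
    rw [h3]; exact P.mul_mem_right _ hm
  have := P.sub_mem (P.add_mem h1 h2) hy
  convert this using 1; ring

lemma inert_of (h : IsQuad φ σ) (p : ℕ) (hp : p.Prime) (β : 𝓞 L)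
    (hβ : ∀ P : Ideal (𝓞 L), P.IsPrime → (p : 𝓞 L) ∈ P → β ^ p - β ∉ P) : (Ideal.span {(p : 𝓞 L)}).IsPrime := by
  obtain ⟨P, h1, h2, h3⟩ := exists_prime_over (L := L) p hp
  haveI := h2
  rcases prime_cases h P h1 with ⟨_, _, h5⟩ | ⟨_, h5, _⟩ | ⟨_, _, h5⟩
  · exact absurd (frob_of_norm P h1 h2 p hp h3 h5 β) (hβ P h2 h3)
  · have : P.comap (om φ) = Ideal.span {(p : 𝓞 Q0)} :=
      bot_ker _ (Ideal.comap_isPrime _ _) p hp (comap_mem φ P p h3)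
    rw [this, Ideal.map_span, Set.image_singleton, om_nat] at h5
    rw [h5]; exact h2
  · exact absurd (frob_of_norm P h1 h2 p hp h3 h5 β) (hβ P h2 h3)
end bot
end Wk

open IntermediateField NumberField
set_option linter.all false
namespace Wk
open scoped nonZeroDivisors
section grp2
variable {G : Type*} [CommGroup G] [Finite G]

lemma triv_of_ker (hp : IsPGroup 2 G) (h : Nat.card (sq (X := G)).ker = 1) : Nat.card G = 1 := by
  haveI : Fact (Nat.Prime 2) := ⟨Nat.prime_two⟩
  obtain ⟨n, hn⟩ := IsPGroup.iff_card.1 hp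
  rcases n with _ | n
  · simpa using hn
  · obtain ⟨x, hx⟩ := exists_prime_orderOf_dvd_card' (G := G) 2 (by rw [hn, pow_succ]; exact dvd_mul_left _ _)
    have h1 : x ∈ (sq (X := G)).ker := by
      rw [MonoidHom.mem_ker, sq_apply, ← hx, pow_orderOf_eq_one]
    rw [Subgroup.card_eq_one] at h
    rw [h, Subgroup.mem_bot] at h1
    rw [h1, orderOf_one] at hx
    omega

/-- nilpotency: if every element of a 2-group `G` lies in `H * G^2` then `H = G` -/
lemma burnside (hp : IsPGroup 2 G) (H : Subgroup G) (h : H ⊔ (sq (X := G)).range = ⊤) : H = ⊤ := by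
  haveI : Fact (Nat.Prime 2) := ⟨Nat.prime_two⟩
  have key : ∀ n : ℕ, ∀ x : G, ∃ y ∈ H, ∃ z, x = y * z ^ (2 ^ n) := by
    intro n
    induction n with
    | zero => intro x; exact ⟨1, H.one_mem, x, by simp⟩
    | succ n ih =>
      intro x
      obtain ⟨y, hy, z, rfl⟩ := ih x
      have hz : z ∈ H ⊔ (sq (X := G)).range := h ▸ Subgroup.mem_top z
      obtain ⟨a, ha, b, ⟨c, rfl⟩, rfl⟩ := Subgroup.mem_sup.1 hz
      refine ⟨y * a ^ 2 ^ n, H.mul_mem hy (H.pow_mem ha _), c, ?_⟩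
      rw [mul_pow, mul_assoc, sq_apply, ← pow_mul, ← pow_succ']
  rw [eq_top_iff]
  intro x _
  obtain ⟨n, hn⟩ := IsPGroup.iff_card.1 hp
  obtain ⟨y, hy, z, rfl⟩ := key n x
  rw [← hn, pow_card_eq_one', mul_one]; exact hy

lemma sq_index_eq : (sq (X := G)).range.index = Nat.card (sq (X := G)).ker := by
  have h1 := Subgroup.card_mul_index (sq (X := G)).range
  have h2 := Subgroup.card_mul_index (sq (X := G)).ker
  rw [Subgroup.index_ker] at h2
  have h3 : 0 < Nat.card (sq (X := G)).range := Nat.card_pos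
  apply Nat.eq_of_mul_eq_mul_left h3
  rw [h1, ← h2, mul_comm]

lemma gen1 (hp : IsPGroup 2 G) (c : G) (hc : ∀ y : G, y ^ 2 ≠ c) (hk : Nat.card (sq (X := G)).ker ≤ 2)
    (H : Subgroup G) (hH : c ∈ H) : H = ⊤ := by
  apply burnside hp
  by_contra hne
  have h1 : (H ⊔ (sq (X := G)).range).index ≠ 1 := by rwa [Ne, Subgroup.index_eq_one]
  have h2 : (sq (X := G)).range.relIndex (H ⊔ (sq (X := G)).range) * (H ⊔ (sq (X := G)).range).index
      = (sq (X := G)).range.index := Subgroup.relIndex_mul_index le_sup_right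
  rw [sq_index_eq] at h2
  have h3 : (H ⊔ (sq (X := G)).range).index ≠ 0 := Subgroup.index_ne_zero_of_finite
  have h4 : (sq (X := G)).range.relIndex (H ⊔ (sq (X := G)).range) ≠ 1 := by
    rw [Ne, Subgroup.relIndex_eq_one]
    intro h
    obtain ⟨y, hy⟩ := h (Subgroup.mem_sup_left hH : c ∈ _)
    exact hc y hy
  have h5 : (sq (X := G)).range.relIndex (H ⊔ (sq (X := G)).range) ≠ 0 := fun h => by
    rw [h, zero_mul] at h2
    exact Nat.card_pos.ne h2
  have : 2 ≤ (H ⊔ (sq (X := G)).range).index := by omega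
  have : 2 ≤ (sq (X := G)).range.relIndex (H ⊔ (sq (X := G)).range) := by omega
  nlinarith

lemma gen2 (hp : IsPGroup 2 G) (c d : G) (hc : ∀ y : G, y ^ 2 ≠ c) (hd : ∀ y : G, y ^ 2 ≠ d)
    (hcd : ∀ y : G, y ^ 2 ≠ c * d) (hk : Nat.card (sq (X := G)).ker ≤ 4)
    (H : Subgroup G) (hH : c ∈ H) (hH' : d ∈ H) : H = ⊤ := by
  apply burnside hp
  by_contra hne
  set S := (sq (X := G)).range with hS
  set T := H ⊔ S with hT
  have h1 : T.index ≠ 1 := by rwa [Ne, Subgroup.index_eq_one]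
  have h2 : S.relIndex T * T.index = S.index := Subgroup.relIndex_mul_index le_sup_right
  rw [hS, sq_index_eq] at h2
  have h3 : T.index ≠ 0 := Subgroup.index_ne_zero_of_finite
  -- four elements of T/S
  have hc' : c ∈ T := Subgroup.mem_sup_left hH
  have hd' : d ∈ T := Subgroup.mem_sup_left hH'
  have h4 : 3 ≤ S.relIndex T := by
    let f : Fin 3 → T ⧸ (S.subgroupOf T) := ![1, QuotientGroup.mk ⟨c, hc'⟩, QuotientGroup.mk ⟨d, hd'⟩]
    have e1 : (QuotientGroup.mk ⟨c, hc'⟩ : T ⧸ (S.subgroupOf T)) ≠ 1 := by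
      rw [Ne, QuotientGroup.eq_one_iff, Subgroup.mem_subgroupOf]
      rintro ⟨y, hy⟩; exact hc y hy
    have e2 : (QuotientGroup.mk ⟨d, hd'⟩ : T ⧸ (S.subgroupOf T)) ≠ 1 := by
      rw [Ne, QuotientGroup.eq_one_iff, Subgroup.mem_subgroupOf]
      rintro ⟨y, hy⟩; exact hd y hy
    have e3 : (QuotientGroup.mk ⟨c, hc'⟩ : T ⧸ (S.subgroupOf T)) ≠ QuotientGroup.mk ⟨d, hd'⟩ := by
      rw [Ne, QuotientGroup.eq, Subgroup.mem_subgroupOf]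
      rintro ⟨y, hy⟩
      apply hcd (c * y)
      have hy' : y ^ 2 = c⁻¹ * d := hy
      rw [mul_pow, hy', pow_two]; group
    have hf : Function.Injective f := by
      intro i j hij
      fin_cases i <;> fin_cases j <;> simp only [f, Fin.zero_eta, Fin.mk_one, Fin.reduceFinMk, Matrix.cons_val_zero, Matrix.cons_val_one, Matrix.cons_val] at hij ⊢
      any_goals exfalso
      · exact e1 hij.symm
      · exact e2 hij.symm
      · exact e1 hij
      · exact e3 hij
      · exact e2 hij
      · exact e3 hij.symm
    have := Nat.card_le_card_of_injective f hf
    rw [Nat.card_eq_fintype_card, Fintype.card_fin] at this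
    exact this
  have : 2 ≤ T.index := by omega
  nlinarith
end grp2

section acts
variable {K : Type*} [Field K] [NumberField K]
variable {L : Type*} [Field L] [NumberField L]
variable {φ : K →+* L} {σ : L →+* L}

lemma triv_elem (hK : Nat.card (A K) = 1) (x : A K) : x = 1 := by
  haveI := (Nat.card_eq_one_iff_unique.1 hK).1
  exact Subsingleton.elim _ _

lemma inv_of_triv (h : IsQuad φ σ) (hK : Nat.card (A K) = 1) (x : A L) : aMap σ x = x⁻¹ := by
  have := aMap_aNm h x
  rw [triv_elem hK (aNm h x), map_one] at this
  exact eq_inv_of_mul_eq_one_right this.symm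

lemma two_rank (h : IsQuad φ σ) [IsTotallyReal K] [IsTotallyReal L] (ι : L →+* ℝ) (hK : Nat.card (A K) = 1) {t : ℕ}
    (hr : ri φ σ ∣ 2 ^ t) : Nat.card (sq (X := A L)).ker * 2 * ei σ = ri φ σ := by
  have h1 := chev h ι hr
  rw [hK, mul_one] at h1
  rw [← h1]
  have : fixS (aMap σ) = (sq (X := A L)).ker := by
    ext x
    rw [mem_fixS, MonoidHom.mem_ker, sq_apply, inv_of_triv h hK, inv_eq_iff_mul_eq_one, pow_two]
  rw [this]

lemma A_triv (h : IsQuad φ σ) [IsTotallyReal K] [IsTotallyReal L] (ι : L →+* ℝ) (hK : Nat.card (A K) = 1)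
    (hr : ri φ σ ∣ 2) : Nat.card (A L) = 1 ∧ ei σ = 1 := by
  have h1 := two_rank h ι hK (t := 1) (by simpa using hr)
  have h2 : Nat.card (sq (X := A L)).ker ≠ 0 := Nat.card_pos.ne'
  have h3 : ri φ σ ≤ 2 := Nat.le_of_dvd two_pos hr
  have h4 : ei σ ≠ 0 := fun h0 => by
    rw [h0, mul_zero] at h1
    rw [← h1] at hr; omega
  have h5 : 1 ≤ Nat.card (sq (X := A L)).ker := by omega
  have h6 : 1 ≤ ei σ := by omega
  have h7 : Nat.card (sq (X := A L)).ker * ei σ ≤ 1 := by nlinarith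
  have h8 : Nat.card (sq (X := A L)).ker ≤ 1 := by nlinarith
  have h9 : ei σ ≤ 1 := by nlinarith
  exact ⟨triv_of_ker A_pgroup (by omega), by omega⟩

lemma card_fix_psi {G : Type*} [CommGroup G] [Finite G] (s : G →* G) :
    Nat.card (fixS s) * Nat.card (psi s).range = Nat.card G := by
  have := Subgroup.card_mul_index (psi s).ker
  rwa [Subgroup.index_ker, ker_psi] at this

variable {M₁ : Type*} [Field M₁] [NumberField M₁] {M₃ : Type*} [Field M₃] [NumberField M₃]
variable {φ₁ : M₁ →+* L} {σ₁ : L →+* L} {φ₃ : M₃ →+* L} {σ₃ : L →+* L}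

lemma biq (h₁ : IsQuad φ₁ σ₁) (h₃ : IsQuad φ₃ σ₃) (hM : Nat.card (A M₁) = 1)
    (hc : ∀ x, σ₁ (σ x) = σ₃ x) (x : A L) : psi (aMap σ) x = aMap φ₃ (aNm h₃ x) := by
  rw [psi_apply, aMap_aNm, div_eq_mul_inv, ← inv_of_triv h₁ hM, aMap_comp]
  congr 3
  exact RingHom.ext hc

lemma biq_card (h₁ : IsQuad φ₁ σ₁) (h₃ : IsQuad φ₃ σ₃) (hM : Nat.card (A M₁) = 1)
    (hc : ∀ x, σ₁ (σ x) = σ₃ x) :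
    Nat.card (A L) ≤ Nat.card (fixS (aMap σ)) * Nat.card (aMap φ₃).range := by
  rw [← card_fix_psi (aMap σ)]
  apply Nat.mul_le_mul_left
  apply Subgroup.card_le_of_le
  rintro _ ⟨x, rfl⟩
  rw [biq h₁ h₃ hM hc]; exact ⟨_, rfl⟩

/-- a square class has norm a square times a norm -/
lemma sq_class_norm {φ : Q0 →+* L} (h : IsQuad φ σ) (a : Id L) (y : A L) (hy : cl L a = y ^ 2) :
    ∃ (x : Lˣ) (z : ℚ) (e : ℤ), z ≠ 0 ∧ (e = 1 ∨ e = -1) ∧ (x : L) * σ x = φ (algebraMap ℚ Q0 (e * aN a * z ^ 2)) := by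
  obtain ⟨b, rfl⟩ := cl_surj y
  have h1 : cl L (a / b ^ 2) = 1 := by rw [map_div, map_pow, hy, div_self']
  obtain ⟨n, ⟨j, hn⟩, ⟨x, hx⟩⟩ := cl_eq_one.1 h1
  obtain ⟨w, hw⟩ := h.exists_norm x
  obtain ⟨w', hw'⟩ := bot_rat (w : Q0)
  have h2 : aN (pr L x) = |w'| := by
    have h3 := nI_pr h x w hw
    rw [← aN_nI h, h3, aN_pr, hw']
    rw [Algebra.norm_algebraMap]
    have : Module.finrank ℚ Q0 = 1 := IntermediateField.finrank_bot
    rw [this, pow_one]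
  have ha := aN_pos a
  have hb := aN_pos b
  rw [hx, map_pow, map_div, map_pow] at h2
  refine ⟨x, (aN a) ^ j / (aN b) ^ n, if 0 ≤ w' then 1 else -1, by positivity, by split_ifs <;> simp, ?_⟩
  rw [← hw, hw']
  congr 2
  have h4 : aN a * (aN a ^ j / aN b ^ n) ^ 2 = |w'| := by
    rw [← h2, hn, div_pow, div_pow, ← pow_mul, ← pow_mul, ← pow_mul, mul_comm (2 * j + 1) 2, mul_div_assoc', pow_succ (aN a), mul_comm j 2, mul_comm (aN a)]
  split_ifs with h5
  · rw [abs_of_nonneg h5] at h4; push_cast; linear_combination -h4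
  · rw [abs_of_neg (not_le.1 h5)] at h4; push_cast; linear_combination h4
end acts

section loc
/-- local non-norm criterion -/
lemma local_non (l : ℕ) [Fact l.Prime] (c w : ℤ) (hc : (l : ℤ) ∣ c) (hc2 : ¬ (l : ℤ) ^ 2 ∣ c)
    (hw : ¬ IsSquare (w : ZMod l)) (X Y Z : ℚ_[l]) (h : X ^ 2 - c * Y ^ 2 = w * Z ^ 2) : Z = 0 := by
  by_contra hZ
  obtain ⟨c', rfl⟩ := hc
  have hc' : ¬ (l : ℤ) ∣ c' := fun hd => hc2 (by rw [pow_two]; exact mul_dvd_mul_left _ hd)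
  have hl1 : (1 : ℝ) < l := by exact_mod_cast (Fact.out : l.Prime).one_lt
  have hnc : ‖(((l : ℤ) * c' : ℤ) : ℚ_[l])‖ = (l : ℝ)⁻¹ := by
    have h1 : ‖(c' : ℚ_[l])‖ = 1 := by
      have h2 := Padic.norm_int_le_one (p := l) c'
      have h3 := mt (Padic.norm_intCast_lt_one_iff (p := l) (k := c')).1 hc'
      exact le_antisymm h2 (not_lt.1 h3)
    push_cast
    rw [norm_mul, h1, mul_one, Padic.norm_p]
  set a := X / Z with ha
  set b := Y / Z with hb
  have h1 : a ^ 2 - (((l : ℤ) * c' : ℤ) : ℚ_[l]) * b ^ 2 = w := by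
    rw [ha, hb]; field_simp; linear_combination h
  have hw1 : ‖(w : ℚ_[l])‖ ≤ 1 := Padic.norm_int_le_one w
  -- |c b^2| ≠ |a|^2 unless zero
  have hne : a ≠ 0 → ‖a ^ 2‖ ≠ ‖(((l : ℤ) * c' : ℤ) : ℚ_[l]) * b ^ 2‖ := by
    intro ha0 heq
    have hb0 : b ≠ 0 := by
      rintro hb0; rw [hb0] at heq; simp at heq; exact ha0 heq
    rw [norm_mul, hnc, norm_pow, norm_pow] at heq
    obtain ⟨i, hi⟩ := Padic.padicNormE.image ha0
    obtain ⟨j, hj⟩ := Padic.padicNormE.image hb0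
    rw [hi, hj] at heq
    push_cast at heq
    have e : (l : ℝ) ^ (2 * (-i)) = (l : ℝ) ^ (-1 + 2 * (-j)) := by
      rw [zpow_add₀ (by positivity), mul_comm 2 (-i), mul_comm 2 (-j), zpow_mul, zpow_mul, zpow_neg_one]
      exact_mod_cast heq
    have := zpow_right_injective₀ (by positivity) hl1.ne' e
    omega
  have ha1 : ‖a‖ ≤ 1 := by
    by_contra hlt
    push Not at hlt
    have ha0 : a ≠ 0 := by rintro h0; rw [h0] at hlt; simp at hlt; linarith
    have := Padic.add_eq_max_of_ne (p := l) (q := a ^ 2) (r := -((((l : ℤ) * c' : ℤ) : ℚ_[l]) * b ^ 2)) (by rw [norm_neg]; exact hne ha0)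
    rw [← sub_eq_add_neg, h1] at this
    have h3 : ‖a ^ 2‖ ≤ 1 := (le_max_left _ _).trans (this ▸ hw1)
    rw [norm_pow] at h3
    nlinarith
  have hb1 : ‖(((l : ℤ) * c' : ℤ) : ℚ_[l]) * b ^ 2‖ ≤ 1 := by
    have : (((l : ℤ) * c' : ℤ) : ℚ_[l]) * b ^ 2 = a ^ 2 + -(w : ℚ_[l]) := by linear_combination -h1
    rw [this]
    refine (Padic.nonarchimedean _ _).trans (max_le ?_ (by rwa [norm_neg]))
    rw [norm_pow]; exact pow_le_one₀ (norm_nonneg _) ha1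
  have hb2 : ‖(((l : ℤ) * c' : ℤ) : ℚ_[l]) * b ^ 2‖ < 1 := by
    rcases eq_or_ne b 0 with hb0 | hb0
    · rw [hb0]; simp
    refine lt_of_le_of_ne hb1 ?_
    rw [norm_mul, hnc, norm_pow]
    obtain ⟨j, hj⟩ := Padic.padicNormE.image hb0
    rw [hj]; push_cast
    intro heq
    have e : (l : ℝ) ^ (-1 + 2 * (-j)) = (l : ℝ) ^ (0 : ℤ) := by
      rw [zpow_add₀ (by positivity), mul_comm 2 (-j), zpow_mul, zpow_neg_one, zpow_zero]
      exact_mod_cast heq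
    have := zpow_right_injective₀ (by positivity) hl1.ne' e
    omega
  -- reduce mod l
  let a' : ℤ_[l] := ⟨a, ha1⟩
  have h5 : a' ^ 2 - (w : ℤ_[l]) ∈ IsLocalRing.maximalIdeal ℤ_[l] := by
    rw [IsLocalRing.mem_maximalIdeal, PadicInt.mem_nonunits, PadicInt.norm_def]
    have : ((a' ^ 2 - (w : ℤ_[l]) : ℤ_[l]) : ℚ_[l]) = (((l : ℤ) * c' : ℤ) : ℚ_[l]) * b ^ 2 := by
      push_cast
      change a ^ 2 - (w : ℚ_[l]) = _
      push_cast at h1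
      linear_combination h1
    rw [this]; exact hb2
  rw [← PadicInt.ker_toZMod, RingHom.mem_ker, map_sub, map_pow, map_intCast, sub_eq_zero] at h5
  exact hw ⟨PadicInt.toZMod a', by rw [← h5, pow_two]⟩

variable {K : Type*} [Field K] [NumberField K]
variable {L : Type*} [Field L] [NumberField L]
variable {φ : K →+* L} {σ : L →+* L}

lemma nonnorm (h : IsQuad φ σ) (l : ℕ) [Fact l.Prime] (f : K →+* ℚ_[l]) (c w : ℤ) (hc : (l : ℤ) ∣ c) (hc2 : ¬ (l : ℤ) ^ 2 ∣ c)
    (hw : ¬ IsSquare (w : ZMod l)) (α : L) (hα : α ^ 2 = c) (hσ : σ α = -α) (x : L) (z : K)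
    (hx : x * σ x = φ (w * z ^ 2)) : z = 0 := by
  have hα0 : α ≠ 0 := by
    rintro rfl
    have : (c : L) = 0 := by rw [← hα]; ring
    have : c = 0 := by exact_mod_cast this
    exact hc2 (this ▸ dvd_zero _)
  obtain ⟨a, b, rfl⟩ := h.decomp hα0 hσ x
  have h1 : φ (a ^ 2 - c * b ^ 2) = φ (w * z ^ 2) := by
    rw [← hx]
    simp only [map_add, map_mul, h.map, hσ, map_sub, map_pow, map_intCast, ← hα]; ring
  have h2 := congrArg f (φ.injective h1)
  simp only [map_sub, map_mul, map_pow, map_intCast] at h2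
  have := local_non l c w hc hc2 hw _ _ _ h2
  exact f.injective (by rw [this, map_zero])
end loc
end Wk

open IntermediateField NumberField
set_option linter.all false
namespace Wk
open scoped nonZeroDivisors
section gen
variable {K : Type*} [Field K] [NumberField K]
variable {L : Type*} [Field L] [NumberField L]
variable {φ : K →+* L} {σ : L →+* L}

lemma int_of_sq {α : L} {c : ℕ} (hα : α ^ 2 = c) : ∃ a : 𝓞 L, (a : L) = α ∧ a ^ 2 = (c : 𝓞 L) := by
  have h1 : IsIntegral ℤ α := by
    apply IsIntegral.of_pow two_pos
    rw [hα]; exact_mod_cast isIntegral_algebraMap (R := ℤ) (x := (c : ℤ)) (A := L)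
  exact ⟨⟨α, h1⟩, rfl, RingOfIntegers.ext (by change α^2 = ((c:𝓞 L):L); rw [hα]; simp)⟩

/-- half-integers -/
lemma int_half {α : L} {c : ℕ} (hα : α ^ 2 = c) (hc : c % 4 = 1) :
    ∃ a : 𝓞 L, (a : L) = (1 + α) / 2 ∧ a ^ 2 - a = ((c / 4 : ℕ) : 𝓞 L) := by
  obtain ⟨d, hd⟩ : ∃ d, c = 4 * d + 1 := ⟨c / 4, by omega⟩
  have hd' : c / 4 = d := by omega
  have e : ((1 + α) / 2) ^ 2 - (1 + α) / 2 = (d : L) := by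
    rw [hd] at hα; push_cast at hα; linear_combination (1/4) * hα
  have h1 : IsIntegral ℤ ((1 + α) / 2) := by
    refine ⟨Polynomial.X ^ 2 - Polynomial.X - Polynomial.C (d : ℤ), ?_, ?_⟩
    · have : (Polynomial.X ^ 2 - Polynomial.X - Polynomial.C (d : ℤ) : Polynomial ℤ) = Polynomial.X ^ (1 + 1) + (- Polynomial.X - Polynomial.C (d : ℤ)) := by ring
      rw [this]
      apply Polynomial.monic_X_pow_add
      refine (Polynomial.degree_sub_le _ _).trans_lt (max_lt ?_ ?_)
      · rw [Polynomial.degree_neg, Polynomial.degree_X]; norm_num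
      · exact Polynomial.degree_C_le.trans_lt (by norm_num)
    · simp [Polynomial.eval₂_sub, e]
  rw [hd']
  exact ⟨⟨_, h1⟩, rfl, RingOfIntegers.ext (by change ((1+α)/2)^2-(1+α)/2 = ((d:𝓞 L):L); rw [e]; simp)⟩

lemma om_sig_eq {a : 𝓞 L} {b : 𝓞 L} (h : σ a = b) : om σ a = b := RingOfIntegers.ext h

lemma ram_mem (h : IsQuad φ σ) {α : L} {c : ℕ} (hα : α ^ 2 = c) (hσ : σ α = -α) (P : Ideal (𝓞 L)) (hR : Ram φ σ P)
    {a j : ℕ} (hd : 2 * c ∣ a ^ j) : (a : 𝓞 L) ∈ P := by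
  obtain ⟨b, hb, hb2⟩ := int_of_sq hα
  have h1 := hR.diff h b
  have h2 : om σ b = - b := om_sig_eq (by rw [hb, hσ]; simp [hb])
  rw [h2, sub_neg_eq_add] at h1
  have hp := hR.2.1
  obtain ⟨t, ht⟩ := hd
  apply hp.mem_of_pow_mem j
  have : (a : 𝓞 L) ^ j = (b + b) * (b * t) := by
    have e := congrArg (Nat.cast : ℕ → 𝓞 L) ht
    push_cast at e; rw [e, ← hb2]; ring
  rw [this]; exact P.mul_mem_right _ h1

lemma ram_mem' (h : IsQuad φ σ) {α : L} {c : ℕ} (hα : α ^ 2 = c) (hc : c % 4 = 1) (hσ : σ α = -α) (P : Ideal (𝓞 L)) (hR : Ram φ σ P) :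
    (c : 𝓞 L) ∈ P := by
  obtain ⟨b, hb, -⟩ := int_half hα hc
  obtain ⟨a, ha, ha2⟩ := int_of_sq hα
  have h1 := hR.diff h b
  have h2 : b - om σ b = a := RingOfIntegers.ext (by
    have : ((b - om σ b : 𝓞 L) : L) = b - σ b := rfl
    rw [this, hb, ha]
    simp only [map_div₀, map_add, map_one, map_ofNat, hσ]; ring)
  rw [h2] at h1
  rw [← ha2, pow_two]; exact P.mul_mem_left _ h1

lemma coprime_mem {P : Ideal (𝓞 L)} (hP : P.IsPrime) {a b : ℕ} (ha : (a : 𝓞 L) ∈ P) (hb : (b : 𝓞 L) ∈ P)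
    (hab : Nat.Coprime a b) : False := by
  have h1 : IsCoprime (a : ℤ) b := Nat.isCoprime_iff_coprime.2 hab
  obtain ⟨x, y, hxy⟩ := h1
  apply hP.ne_top
  rw [Ideal.eq_top_iff_one]
  have : (1 : 𝓞 L) = (x : 𝓞 L) * (a : 𝓞 L) + (y : 𝓞 L) * (b : 𝓞 L) := by
    have := congrArg (Int.cast : ℤ → 𝓞 L) hxy
    push_cast at this; exact this.symm
  rw [this]
  exact P.add_mem (P.mul_mem_left _ ha) (P.mul_mem_left _ hb)

/-- the unit of `L` given by a nonzero natural number -/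
noncomputable def nu0 (L : Type*) [Field L] [NumberField L] (a : ℕ) (ha : a ≠ 0) : Lˣ := Units.mk0 (a : L) (by exact_mod_cast ha)

lemma ram_ideal {a : ℕ} (ha : a ≠ 0) (β γ x y z : 𝓞 L) (h1 : β ^ 2 = a * γ) (h2 : a * x + β * y + γ * z = 1) :
    ∃ I : Id L, I ^ 2 = pr L (nu0 L a ha) := by
  have ha' : (a : 𝓞 L) ≠ 0 := by exact_mod_cast ha
  let J : Ideal (𝓞 L) := Ideal.span {(a : 𝓞 L), β}
  have haJ : (a : 𝓞 L) ∈ J := Ideal.subset_span (by simp)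
  have hbJ : β ∈ J := Ideal.subset_span (by simp)
  have hJ : J ≠ ⊥ := fun h => ha' (by rw [h] at haJ; simpa using haJ)
  have key : J * J = Ideal.span {(a : 𝓞 L)} := by
    apply le_antisymm
    · rw [Ideal.span_mul_span', Ideal.span_le]
      rintro _ ⟨u, hu, v, hv, rfl⟩
      simp only [Set.mem_insert_iff, Set.mem_singleton_iff] at hu hv
      simp only [SetLike.mem_coe, Ideal.mem_span_singleton]
      rcases hu with rfl | rfl <;> rcases hv with rfl | rfl
      · exact dvd_mul_right _ _
      · exact dvd_mul_right _ _
      · exact dvd_mul_left _ _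
      · rw [← pow_two, h1]; exact dvd_mul_right _ _
    · rw [Ideal.span_singleton_le_iff_mem]
      have : (a : 𝓞 L) = (a : 𝓞 L) * a * x + a * β * y + β * β * z := by
        linear_combination (-(a : 𝓞 L)) * h2 - z * h1
      rw [this]
      exact Ideal.add_mem _ (Ideal.add_mem _ (Ideal.mul_mem_right _ _ (Ideal.mul_mem_mul haJ haJ))
        (Ideal.mul_mem_right _ _ (Ideal.mul_mem_mul haJ hbJ))) (Ideal.mul_mem_right _ _ (Ideal.mul_mem_mul hbJ hbJ))
  refine ⟨idu J hJ, ?_⟩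
  ext1
  rw [pow_two, Units.val_mul, coe_idu, coe_pr, ← FractionalIdeal.coeIdeal_mul, key, FractionalIdeal.coeIdeal_span_singleton]
  congr 1

lemma aN_ram {a : ℕ} (ha : a ≠ 0) (hf : Module.finrank ℚ L = 2) (I : Id L) (hI : I ^ 2 = pr L (nu0 L a ha)) : aN I = a := by
  have h1 : aN I ^ 2 = (a : ℚ) ^ 2 := by
    rw [← map_pow, hI, aN_pr]
    have : ((nu0 L a ha : Lˣ) : L) = algebraMap ℚ L (a : ℚ) := by simp [nu0]
    rw [this, Algebra.norm_algebraMap, hf, abs_of_nonneg (by positivity)]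
  have h2 := aN_pos I
  exact (pow_left_inj₀ h2.le (by positivity) two_ne_zero).1 h1

lemma ei_norm (h : IsQuad φ σ) (he : ei σ = 1) (u : Kˣ) (hu : u ∈ (pr K).ker) : ∃ x : Lˣ, φ u = x * σ x := by
  rw [ei, Subgroup.relIndex_eq_one] at he
  have h1 : Units.map φ.toMonoidHom u ∈ (pr L).ker ⊓ fixS (um σ) := by
    rw [kerfix h]; exact ⟨u, hu, rfl⟩
  obtain ⟨x, hx⟩ := he h1
  refine ⟨x, ?_⟩
  have := congrArg Units.val hx
  exact this.symm

lemma neg_one_ker : (-1 : Kˣ) ∈ (pr K).ker := by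
  rw [mem_ker_pr]; exact ⟨-1, by ext; simp⟩

/-- embedding of `ℚ` -/
noncomputable def f0 (l : ℕ) [Fact l.Prime] : Q0 →+* ℚ_[l] :=
  (algebraMap ℚ ℚ_[l]).comp (IntermediateField.botEquiv ℚ ℝ).toRingEquiv.toRingHom
end gen

section overQ
variable {L : Type*} [Field L] [NumberField L] {φ : Q0 →+* L} {σ : L →+* L}

lemma finrank2 (h : IsQuad φ σ) : Module.finrank ℚ L = 2 := by
  rw [h.finrank.1, IntermediateField.finrank_bot]

lemma nonnormQ (h : IsQuad φ σ) (l : ℕ) [Fact l.Prime] {c : ℕ} (w : ℤ) (hc : l ∣ c) (hc2 : ¬ l ^ 2 ∣ c)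
    (hw : legendreSym l w = -1) (α : L) (hα : α ^ 2 = c) (hσ : σ α = -α) (x : L) (z : ℚ)
    (hx : x * σ x = φ (algebraMap ℚ Q0 (w * z ^ 2))) : z = 0 := by
  have := nonnorm h l (f0 l) c w (by exact_mod_cast hc) (by exact_mod_cast hc2)
    ((legendreSym.eq_neg_one_iff l).1 hw) α (by exact_mod_cast hα) hσ x (algebraMap ℚ Q0 z) (by rw [hx]; simp)
  exact (algebraMap ℚ Q0).injective (by rw [this, map_zero])

lemma not_sq (h : IsQuad φ σ) (l : ℕ) [Fact l.Prime] {c : ℕ} (w : ℕ) (hc : l ∣ c) (hc2 : ¬ l ^ 2 ∣ c)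
    (hw : legendreSym l w = -1) (hl : legendreSym l (-1) = 1) (α : L) (hα : α ^ 2 = c) (hσ : σ α = -α)
    (a : Id L) (ha : aN a = w) (y : A L) : y ^ 2 ≠ cl L a := by
  intro hy
  obtain ⟨x, z, e, hz, he, hx⟩ := sq_class_norm h a y hy.symm
  apply hz
  refine nonnormQ h l (e * w) hc hc2 ?_ α hα hσ x z (by rw [hx, ha]; push_cast; rfl)
  rw [legendreSym.mul, hw]
  rcases he with rfl | rfl
  · rw [legendreSym.at_one]; rfl
  · rw [hl]; rfl

lemma not_sq' (h : IsQuad φ σ) (l : ℕ) [Fact l.Prime] {c w : ℕ} (hc2 : ¬ l ^ 2 ∣ l * c)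
    (hw : legendreSym l c = -1) (hl : legendreSym l (-1) = 1) (α : L) (hα : α ^ 2 = ((l * c : ℕ) : L)) (hσ : σ α = -α)
    (a : Id L) (ha : aN a = l) (y : A L) : y ^ 2 ≠ cl L a := by
  intro hy
  obtain ⟨x, z, e, hz, he, hx⟩ := sq_class_norm h a y hy.symm
  have hl0 : (l : ℚ) ≠ 0 := by exact_mod_cast (Fact.out : l.Prime).ne_zero
  have : (l : ℚ) * z = 0 := by
    refine nonnormQ h l (-e * c) (dvd_mul_right _ _) hc2 ?_ α hα hσ (x * α) (l * z) ?_
    · rw [legendreSym.mul, hw]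
      rcases he with rfl | rfl
      · rw [hl]; rfl
      · rw [neg_neg, legendreSym.at_one]; rfl
    · rw [map_mul, hσ]
      have : (x : L) * α * (σ x * -α) = x * σ x * (-(α ^ 2)) := by ring
      rw [this, hx, hα, ha]
      have e2 : (((l * c : ℕ) : L)) = φ (algebraMap ℚ Q0 ((l * c : ℕ) : ℚ)) := by simp
      rw [e2, ← map_neg, ← map_neg, ← map_mul, ← map_mul]
      congr 2; push_cast; ring
  exact hz ((mul_eq_zero.1 this).resolve_left hl0)
end overQ

section Rq
lemma sqrt_sq_mem (K : IntermediateField ℚ ℝ) (n : ℕ) : (√(n:ℝ)) ^ 2 ∈ K := by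
  rw [Real.sq_sqrt (Nat.cast_nonneg n)]; exact IntermediateField.natCast_mem K n

/-- ℚ(√n) -/
noncomputable abbrev Rq (n : ℕ) : IntermediateField ℚ ℝ := ad Q0 (√(n:ℝ))

instance nf_ads (K : IntermediateField ℚ ℝ) [NumberField K] (n : ℕ) : NumberField (ad K (√(n:ℝ))) := nf_ad K (sqrt_sq_mem K n)

lemma tr_sqrt {L : Type*} [Field L] (α : L) (n : ℕ) (h : α ^ 2 = n) (f : L →+* ℂ) : (starRingEnd ℂ) (f α) = f α := by
  have h1 : (f α) ^ 2 = n := by rw [← map_pow, h, map_natCast]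
  have h2 : (f α) ^ 2 = ((√(n:ℝ) : ℝ) : ℂ) ^ 2 := by
    rw [h1]; norm_cast; rw [Real.sq_sqrt (Nat.cast_nonneg n)]
  rcases sq_eq_sq_iff_eq_or_eq_neg.1 h2 with h | h <;> rw [h] <;> simp

lemma coe_sq {K : IntermediateField ℚ ℝ} (n : ℕ) (h : √(n:ℝ) ∈ K) : (⟨√(n:ℝ), h⟩ : K) ^ 2 = n :=
  Subtype.ext (by push_cast; exact Real.sq_sqrt (Nat.cast_nonneg n))

instance tr_ads (K : IntermediateField ℚ ℝ) [NumberField K] [IsTotallyReal K] (n : ℕ) : IsTotallyReal (ad K (√(n:ℝ))) :=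
  tr_ad rfl le_ad (sqrt_sq_mem K n) mem_ad (fun f => tr_sqrt _ n (coe_sq n mem_ad) f)

/-- √n in ℚ(√n) -/
noncomputable def rt (n : ℕ) : Rq n := ⟨√(n:ℝ), mem_ad⟩
lemma rt_sq (n : ℕ) : rt n ^ 2 = n := coe_sq n _

lemma irr (n : ℕ) (hn : ¬ IsSquare n) : √(n:ℝ) ∉ Q0 := by
  intro h
  obtain ⟨y, hy⟩ := mem_bot.1 h
  exact (irrational_sqrt_natCast_iff.2 hn) ⟨y, hy⟩

lemma quadR (n : ℕ) (hn : ¬ IsSquare n) : ∃ σ : Rq n →+* Rq n, IsQuad (inc (le_ad : Q0 ≤ Rq n)) σ ∧ σ (rt n) = - rt n :=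
  quad_mk rfl le_ad (sqrt_sq_mem _ n) mem_ad (irr n hn)

lemma nsq_of (p n : ℕ) (hp : p.Prime) (h1 : p ∣ n) (h2 : ¬ p ^ 2 ∣ n) : ¬ IsSquare n := by
  rintro ⟨k, rfl⟩
  have : p ∣ k := by rcases (Nat.Prime.dvd_mul hp).1 h1 with h | h <;> exact h
  exact h2 (by rw [pow_two]; exact mul_dvd_mul this this)
end Rq
end Wk

open IntermediateField NumberField
set_option linter.all false
namespace Wk
open scoped nonZeroDivisors

/-- the sign -/
def ze (η : ℕ) : ℤ := if η = 2 then -1 else 1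

/-- the arithmetic hypotheses -/
structure Hyp (η q r s : ℕ) [Fact q.Prime] [Fact r.Prime] [Fact s.Prime] : Prop where
  hη : η = 1 ∨ η = 2
  hq4 : q % 4 = 3
  hr8 : r % 8 = 5
  hs8 : s % 8 = 5
  hqr : legendreSym r q = ze η
  hqs : legendreSym s q = ze η
  hrs : legendreSym s r = 1

lemma leg5 (l : ℕ) [Fact l.Prime] (h : l % 8 = 5) : legendreSym l 2 = -1 ∧ legendreSym l (-1) = 1 := by
  have h2 : l ≠ 2 := by omega
  refine ⟨?_, ?_⟩
  · rw [legendreSym.at_two h2, ZMod.χ₈_nat_mod_eight, h]; decide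
  · rw [legendreSym.at_neg_one h2, ZMod.χ₄_nat_one_mod_four (by omega)]

namespace Hyp
variable {η q r s : ℕ} [Fact q.Prime] [Fact r.Prime] [Fact s.Prime]

lemma sq_leg (h : Hyp η q r s) : legendreSym q s = ze η := by
  rw [← h.hqs, legendreSym.quadratic_reciprocity_one_mod_four (p := s) (q := q)]
  · have := h.hs8; omega
  · have := h.hq4; omega
lemma rq_leg (h : Hyp η q r s) : legendreSym q r = ze η := by
  rw [← h.hqr, legendreSym.quadratic_reciprocity_one_mod_four (p := r) (q := q)]
  · have := h.hr8; omega
  · have := h.hq4; omega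
lemma sr_leg (h : Hyp η q r s) : legendreSym r s = 1 := by
  rw [← h.hrs, legendreSym.quadratic_reciprocity_one_mod_four (p := s) (q := r)]
  · have := h.hs8; omega
  · have := h.hr8; omega
lemma swap (h : Hyp η q r s) : Hyp η q s r := ⟨h.hη, h.hq4, h.hs8, h.hr8, h.hqs, h.hqr, h.sr_leg⟩
lemma qm1 (h : Hyp η q r s) : legendreSym q (-1) = -1 := by
  have := h.hq4
  rw [legendreSym.at_neg_one (by omega), ZMod.χ₄_nat_three_mod_four this]
lemma r2 (h : Hyp η q r s) : legendreSym r 2 = -1 := (leg5 r h.hr8).1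
lemma rm1 (h : Hyp η q r s) : legendreSym r (-1) = 1 := (leg5 r h.hr8).2
lemma s2 (h : Hyp η q r s) : legendreSym s 2 = -1 := (leg5 s h.hs8).1
lemma sm1 (h : Hyp η q r s) : legendreSym s (-1) = 1 := (leg5 s h.hs8).2
lemma q_ne_r (h : Hyp η q r s) : q ≠ r := by have := h.hq4; have := h.hr8; omega
lemma q_ne_s (h : Hyp η q r s) : q ≠ s := by have := h.hq4; have := h.hs8; omega
lemma r_ne_s (h : Hyp η q r s) : r ≠ s := by
  rintro rfl
  have h1 := h.hrs
  have : legendreSym r (r:ℤ) = 0 := by rw [legendreSym.eq_zero_iff]; simp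
  omega
lemma ne_two (h : Hyp η q r s) : q ≠ 2 ∧ r ≠ 2 ∧ s ≠ 2 := by
  have := h.hq4; have := h.hr8; have := h.hs8; omega

/-- coprimality package -/
lemma cop (h : Hyp η q r s) : Nat.Coprime q r ∧ Nat.Coprime q s ∧ Nat.Coprime r s ∧ Nat.Coprime 2 q ∧ Nat.Coprime 2 r ∧ Nat.Coprime 2 s := by
  have a := (Fact.out : q.Prime); have b := (Fact.out : r.Prime); have c := (Fact.out : s.Prime)
  have := h.ne_two
  refine ⟨(Nat.coprime_primes a b).2 h.q_ne_r, (Nat.coprime_primes a c).2 h.q_ne_s, (Nat.coprime_primes b c).2 h.r_ne_s,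
    (Nat.coprime_primes Nat.prime_two a).2 (by omega), (Nat.coprime_primes Nat.prime_two b).2 (by omega), (Nat.coprime_primes Nat.prime_two c).2 (by omega)⟩
end Hyp

lemma cop_theta {θ l : ℕ} (hθ : θ = 1 ∨ θ = 2) (h : Nat.Coprime 2 l) : Nat.Coprime θ l := by
  rcases hθ with rfl | rfl
  · exact Nat.coprime_one_left l
  · exact h

/-- exact divisibility -/
lemma nsq_dvd {l c : ℕ} (hl : l.Prime) (h : Nat.Coprime l c) : ¬ l ^ 2 ∣ l * c := by
  intro h1
  rw [pow_two] at h1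
  have := Nat.dvd_of_mul_dvd_mul_left hl.pos h1
  have := Nat.Coprime.eq_one_of_dvd h this
  exact hl.one_lt.ne' this

section Q
variable {L : Type*} [Field L] [NumberField L] {φ : Q0 →+* L} {σ : L →+* L}

lemma ei_two {K L : Type*} [Field K] [NumberField K] [Field L] [NumberField L] {φ : K →+* L} {σ : L →+* L} (h : IsQuad φ σ) [IsTotallyReal K] (ι : K →+* ℝ)
    (hn : ∀ x : L, x * σ x ≠ -1) : 2 ∣ ei σ := by
  have h1 := ei_dvd h ι
  obtain ⟨k, -, hk⟩ := (Nat.dvd_prime_pow Nat.prime_two).1 h1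
  rcases Nat.eq_zero_or_pos k with rfl | hk0
  · exfalso
    obtain ⟨x, hx⟩ := ei_norm h (by simpa using hk) (-1) neg_one_ker
    apply hn x; rw [← hx]; simp
  · rw [hk]; exact dvd_pow_self 2 hk0.ne'

lemma m1_nonnorm (h : IsQuad φ σ) (l : ℕ) [Fact l.Prime] {c : ℕ} (hc : l ∣ c) (hc2 : ¬ l ^ 2 ∣ c)
    (hw : legendreSym l (-1) = -1) (α : L) (hα : α ^ 2 = c) (hσ : σ α = -α) (x : L) : x * σ x ≠ -1 := by
  intro hx
  have := nonnormQ h l (-1) hc hc2 hw α hα hσ x 1 (by rw [hx]; simp)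
  exact one_ne_zero this

/-- two-rank over ℚ -/
lemma rankQ (h : IsQuad φ σ) [IsTotallyReal L] (ι : L →+* ℝ) (l : ℕ) [Fact l.Prime] {c : ℕ} (hc : l ∣ c) (hc2 : ¬ l ^ 2 ∣ c)
    (hw : legendreSym l (-1) = -1) (α : L) (hα : α ^ 2 = c) (hσ : σ α = -α) {a j t : ℕ} (hd : 2 * c ∣ a ^ j) (hN : NP Q0 a t) :
    Nat.card (sq (X := A L)).ker * 4 ∣ 2 ^ t := by
  have h1 := ri_dvd h (fun P hR => ram_mem h hα hσ P hR hd) hN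
  have h2 := two_rank h ι A_bot h1
  obtain ⟨k, hk⟩ := ei_two h (ι.comp φ) (m1_nonnorm h l hc hc2 hw α hα hσ)
  rw [hk] at h2
  refine Dvd.dvd.trans ⟨k, ?_⟩ h1
  rw [← h2]; ring

lemma id_two (α : L) {n : ℕ} (hα : α ^ 2 = n) (hn : n % 4 = 3 ∨ n % 4 = 2) : ∃ I : Id L, I ^ 2 = pr L (nu0 L 2 two_ne_zero) := by
  obtain ⟨b, hb, hb2⟩ := int_of_sq hα
  rcases hn with hn | hn
  · obtain ⟨k, rfl⟩ : ∃ k, n = 4 * k + 3 := ⟨n / 4, by omega⟩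
    push_cast at hb2
    refine ram_ideal two_ne_zero (1 + b) (2 * k + 2 + b) (k + 1) 1 (-1) ?_ ?_
    · push_cast; linear_combination hb2
    · push_cast; ring
  · obtain ⟨k, rfl⟩ : ∃ k, n = 4 * k + 2 := ⟨n / 4, by omega⟩
    push_cast at hb2
    refine ram_ideal two_ne_zero b (2 * k + 1) (-k) 0 1 ?_ ?_
    · push_cast; linear_combination hb2
    · push_cast; ring

lemma id_l (α : L) {l c : ℕ} (hα : α ^ 2 = ((l * c : ℕ) : L)) (hl : l ≠ 0) (h : Nat.Coprime l c) : ∃ I : Id L, I ^ 2 = pr L (nu0 L l hl) := by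
  obtain ⟨b, hb, hb2⟩ := int_of_sq hα
  obtain ⟨x, y, hxy⟩ := Nat.isCoprime_iff_coprime.2 h
  push_cast at hb2
  refine ram_ideal hl b c x 0 y hb2 ?_
  have := congrArg (Int.cast : ℤ → 𝓞 L) hxy
  push_cast at this; linear_combination this
end Q

/-- the real embedding -/
noncomputable def rho (K : IntermediateField ℚ ℝ) : K →+* ℝ := K.val.toRingHom

section
variable {η q r s : ℕ} [Fact q.Prime] [Fact r.Prime] [Fact s.Prime]

lemma modθ {θ n : ℕ} (hθ : θ = 1 ∨ θ = 2) (hn : n % 4 = 3) : (θ * n) % 4 = 3 ∨ (θ * n) % 4 = 2 := by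
  rcases hθ with rfl | rfl <;> omega

lemma qs_mod (h : Hyp η q r s) : (q * s) % 4 = 3 := by
  rw [Nat.mul_mod, h.hq4, show s % 4 = 1 by have := h.hs8; omega]
lemma qrs_mod (h : Hyp η q r s) : (q * r * s) % 4 = 3 := by
  rw [Nat.mul_mod, qs_mod h.swap, show s % 4 = 1 by have := h.hs8; omega]

/-- A(ℚ√(θqs)) is generated by the prime above 2 -/
lemma smallgen (h : Hyp η q r s) {θ : ℕ} (hθ : θ = 1 ∨ θ = 2) :
    ∃ I : Id (Rq (θ * q * s)), I ^ 2 = pr _ (nu0 _ 2 two_ne_zero) ∧ ∀ H : Subgroup (A (Rq (θ * q * s))), cl _ I ∈ H → H = ⊤ := by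
  obtain ⟨c1, c2, c3, c4, c5, c6⟩ := h.cop
  have hq := (Fact.out : q.Prime); have hs := (Fact.out : s.Prime)
  have dq : q ∣ θ * q * s := ⟨θ * s, by ring⟩
  have ds : s ∣ θ * q * s := ⟨θ * q, by ring⟩
  have dq2 : ¬ q ^ 2 ∣ θ * q * s := by
    rw [show θ * q * s = q * (θ * s) by ring]
    exact nsq_dvd hq (Nat.Coprime.mul_right (cop_theta hθ c4).symm c2)
  have ds2 : ¬ s ^ 2 ∣ θ * q * s := by
    rw [show θ * q * s = s * (θ * q) by ring]
    exact nsq_dvd hs (Nat.Coprime.mul_right (cop_theta hθ c6).symm c2.symm)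
  obtain ⟨σ, hQ, hσ⟩ := quadR (θ * q * s) (nsq_of q _ hq dq dq2)
  obtain ⟨I, hI⟩ := id_two (rt (θ * q * s)) (rt_sq _) (by rw [mul_assoc]; exact modθ hθ (qs_mod h))
  refine ⟨I, hI, gen1 A_pgroup (cl _ I) ?_ ?_⟩
  · exact fun y => not_sq hQ s 2 ds ds2 (by exact_mod_cast h.s2) h.sm1 _ (rt_sq _) hσ I (aN_ram _ (finrank2 hQ) I hI) y
  · have := rankQ hQ (rho _) q dq dq2 h.qm1 _ (rt_sq _) hσ (a := 2 * q * s) (j := 2) (t := 3) ?_ ?_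
    · exact Nat.le_of_mul_le_mul_right (c := 4) ((Nat.le_of_dvd (by norm_num) this).trans (by norm_num)) (by norm_num)
    · rcases hθ with rfl | rfl
      · exact ⟨2 * q * s, by ring⟩
      · exact ⟨q * s, by ring⟩
    · exact NP_mul (NP_mul (NP_bot 2 Nat.prime_two) (NP_bot q hq)) (NP_bot s hs)

/-- the complementary index -/
lemma comp_leg (h : Hyp η q r s) {θ : ℕ} (hθ : η * θ = 2) : legendreSym r ((θ * q * s : ℕ)) = -1 := by
  push_cast
  rw [legendreSym.mul, legendreSym.mul, h.hqr, h.sr_leg]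
  rcases h.hη with rfl | rfl
  · obtain rfl : θ = 2 := by omega
    have := h.r2
    push_cast; rw [this]; decide
  · obtain rfl : θ = 1 := by omega
    push_cast; rw [legendreSym.at_one]; decide

lemma comp_th (h : Hyp η q r s) {θ : ℕ} (hθ : η * θ = 2) : θ = 1 ∨ θ = 2 := by
  rcases h.hη with rfl | rfl <;> omega

lemma biggen (h : Hyp η q r s) {θ : ℕ} (hθ : η * θ = 2) :
    ∃ I R : Id (Rq (θ * q * r * s)), I ^ 2 = pr _ (nu0 _ 2 two_ne_zero) ∧ R ^ 2 = pr _ (nu0 _ r (Fact.out : r.Prime).ne_zero) ∧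
      ∀ H : Subgroup (A (Rq (θ * q * r * s))), cl _ I ∈ H → cl _ R ∈ H → H = ⊤ := by
  have hθ' := comp_th h hθ
  obtain ⟨c1, c2, c3, c4, c5, c6⟩ := h.cop
  have hq := (Fact.out : q.Prime); have hs := (Fact.out : s.Prime); have hr := (Fact.out : r.Prime)
  have dq : q ∣ θ * q * r * s := ⟨θ * r * s, by ring⟩
  have ds : s ∣ θ * q * r * s := ⟨θ * q * r, by ring⟩
  have dq2 : ¬ q ^ 2 ∣ θ * q * r * s := by
    rw [show θ * q * r * s = q * (θ * r * s) by ring]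
    exact nsq_dvd hq (Nat.Coprime.mul_right (Nat.Coprime.mul_right (cop_theta hθ' c4).symm c1) c2)
  have ds2 : ¬ s ^ 2 ∣ θ * q * r * s := by
    rw [show θ * q * r * s = s * (θ * q * r) by ring]
    exact nsq_dvd hs (Nat.Coprime.mul_right (Nat.Coprime.mul_right (cop_theta hθ' c6).symm c2.symm) c3.symm)
  have er : θ * q * r * s = r * (θ * q * s) := by ring
  have cr : Nat.Coprime r (θ * q * s) := Nat.Coprime.mul_right (Nat.Coprime.mul_right (cop_theta hθ' c5).symm c1.symm) c3
  obtain ⟨σ, hQ, hσ⟩ := quadR (θ * q * r * s) (nsq_of q _ hq dq dq2)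
  obtain ⟨I, hI⟩ := id_two (rt (θ * q * r * s)) (rt_sq _) (by rw [mul_assoc, mul_assoc, ← mul_assoc q]; exact modθ hθ' (qrs_mod h))
  have hrt : (rt (θ * q * r * s)) ^ 2 = ((r * (θ * q * s) : ℕ) : Rq (θ * q * r * s)) := by rw [← er]; exact rt_sq _
  obtain ⟨R, hR⟩ := id_l (rt (θ * q * r * s)) hrt hr.ne_zero cr
  have aI := aN_ram _ (finrank2 hQ) I hI
  have aR := aN_ram _ (finrank2 hQ) R hR
  refine ⟨I, R, hI, hR, gen2 A_pgroup (cl _ I) (cl _ R) ?_ ?_ ?_ ?_⟩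
  · exact fun y => not_sq hQ s 2 ds ds2 (by exact_mod_cast h.s2) h.sm1 _ (rt_sq _) hσ I aI y
  · exact fun y => not_sq' (w := 0) hQ r (nsq_dvd hr cr) (comp_leg h hθ) h.rm1 _ hrt hσ R aR y
  · intro y
    rw [← map_mul]
    refine not_sq hQ s (2 * r) ds ds2 ?_ h.sm1 _ (rt_sq _) hσ (I * R) (by rw [map_mul, aI, aR]; push_cast; rfl) y
    have := h.s2; have := h.hrs
    push_cast; rw [legendreSym.mul]; simp [*]
  · have := rankQ hQ (rho _) q dq dq2 h.qm1 _ (rt_sq _) hσ (a := 2 * q * r * s) (j := 2) (t := 4) ?_ ?_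
    · exact Nat.le_of_mul_le_mul_right (c := 4) ((Nat.le_of_dvd (by norm_num) this).trans (by norm_num)) (by norm_num)
    · rcases hθ' with rfl | rfl
      · exact ⟨2 * q * r * s, by ring⟩
      · exact ⟨q * r * s, by ring⟩
    · exact NP_mul (NP_mul (NP_mul (NP_bot 2 Nat.prime_two) (NP_bot q hq)) (NP_bot r hr)) (NP_bot s hs)
end
end Wk

open IntermediateField NumberField
set_option linter.all false
namespace Wk
open scoped nonZeroDivisors

lemma sqf_dvd {d e b : ℕ} (hd : Squarefree d) (h : e ^ 2 ∣ d * b ^ 2) (hb : b ≠ 0) : e ∣ b := by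
  obtain ⟨g, e', b', hg, hco, rfl, rfl⟩ := Nat.exists_coprime' (m := e) (n := b) (Nat.gcd_pos_of_pos_right _ (Nat.pos_of_ne_zero hb))
  have h1 : e' ^ 2 ∣ d * b' ^ 2 := by
    rw [mul_pow, mul_pow, ← mul_assoc] at h
    exact Nat.dvd_of_mul_dvd_mul_right (pow_pos hg 2) h
  have h2 : e' ^ 2 ∣ d := Nat.Coprime.dvd_of_dvd_mul_right (Nat.Coprime.pow 2 2 hco) h1
  have := hd e' (by rwa [← pow_two])
  rw [Nat.isUnit_iff] at this
  rw [this, one_mul]; exact Dvd.intro_left _ rfl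

/-- squarefree part of 2(γ+1) -/
lemma pell_sf {d : ℕ} {g b : ℕ} (hb : b ≠ 0) (hd0 : d ≠ 0) (hP : g ^ 2 = d * b ^ 2 + 1) :
    ∃ a t : ℕ, 2 * (g + 1) = a * t ^ 2 ∧ t ≠ 0 ∧ Squarefree a ∧ ∀ l, l.Prime → l ∣ a → l ∣ 2 * d := by
  obtain ⟨a, t, h1, h2⟩ := Nat.sq_mul_squarefree (2 * (g + 1))
  have ht : t ≠ 0 := by rintro rfl; simp at h1
  refine ⟨a, t, by rw [← h1]; ring, ht, h2, ?_⟩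
  intro l hl hla
  by_contra hld
  have hl2 : ¬ l ∣ 2 := fun h => hld (h.mul_right d)
  have hld' : ¬ l ∣ d := fun h => hld (h.mul_left 2)
  have hg : 2 ≤ g := by
    by_contra h
    have : 0 < d * b ^ 2 := by positivity
    interval_cases g <;> omega
  obtain ⟨w, rfl⟩ : ∃ w, g = w + 1 := ⟨g - 1, by omega⟩
  have hw0 : w ≠ 0 := by omega
  have e1 : a * t ^ 2 * w = (2 * d) * b ^ 2 := by
    have : w * (w + 2) = d * b ^ 2 := by
      have : (w + 1) ^ 2 = w * (w + 2) + 1 := by ring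
      omega
    rw [mul_comm a, h1]
    calc _ = 2 * (w * (w + 2)) := by ring
      _ = _ := by rw [this]; ring
  have hlw : ¬ l ∣ w := by
    intro h
    have h3 : l ∣ 2 * (w + 1 + 1) := by rw [← h1]; exact hla.mul_left _
    have h4 : l ∣ 2 * w + 2 * 2 := by convert h3 using 1; ring
    have h5 := (Nat.dvd_add_right (h.mul_left 2)).1 h4
    rcases hl.dvd_mul.1 h5 with h | h <;> exact hl2 h
  have ha0 : a ≠ 0 := h2.ne_zero
  have e2 := congrArg (fun n => n.factorization l) e1
  rw [Nat.factorization_mul (by positivity) hw0, Nat.factorization_mul ha0 (by positivity), Nat.factorization_mul (by positivity) (by positivity),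
    Nat.factorization_pow, Nat.factorization_pow] at e2
  simp only [Finsupp.add_apply, Finsupp.smul_apply, smul_eq_mul, Nat.factorization_eq_zero_of_not_dvd hlw,
    Nat.factorization_eq_zero_of_not_dvd hld] at e2
  have h6 : a.factorization l = 1 := by
    have := h2.natFactorization_le_one l
    have := (hl.dvd_iff_one_le_factorization ha0).1 hla
    omega
  omega

lemma sf_dvd {a n : ℕ} (ha : Squarefree a) (hn : n ≠ 0) (h : ∀ l, l.Prime → l ∣ a → l ∣ n) : a ∣ n := by
  rw [← Nat.prod_primeFactors_of_squarefree ha]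
  refine (Finset.prod_primes_dvd n ?_ ?_)
  · intro l hl; exact (Nat.prime_of_mem_primeFactors hl).prime
  · intro l hl; exact h l (Nat.prime_of_mem_primeFactors hl) (Nat.dvd_of_mem_primeFactors hl)

section
variable {η q r s : ℕ} [Fact q.Prime] [Fact r.Prime] [Fact s.Prime]

lemma sf_qrs (h : Hyp η q r s) {θ : ℕ} (hθ : θ = 1 ∨ θ = 2) : Squarefree (θ * q * r * s) := by
  obtain ⟨c1, c2, c3, c4, c5, c6⟩ := h.cop
  have hq := (Fact.out : q.Prime); have hs := (Fact.out : s.Prime); have hr := (Fact.out : r.Prime)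
  have h1 : Squarefree θ := by
    rcases hθ with rfl | rfl
    · exact squarefree_one
    · exact Nat.prime_two.squarefree
  rw [Nat.squarefree_mul, Nat.squarefree_mul, Nat.squarefree_mul]
  · exact ⟨⟨⟨h1, hq.squarefree⟩, hr.squarefree⟩, hs.squarefree⟩
  · exact cop_theta hθ c4
  · exact Nat.Coprime.mul_left (cop_theta hθ c5) c1
  · exact Nat.Coprime.mul_left (Nat.Coprime.mul_left (cop_theta hθ c6) c2) c3

lemma div4 {q r s a : ℕ} (hq : q.Prime) (hr : r.Prime) (hs : s.Prime) (h : a ∣ 2 * q * r * s) :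
    ∃ i j k l : ℕ, i < 2 ∧ j < 2 ∧ k < 2 ∧ l < 2 ∧ a = 2 ^ i * q ^ j * r ^ k * s ^ l := by
  obtain ⟨x, a4, hx, h4, rfl⟩ := (Nat.dvd_mul).1 h
  obtain ⟨y, a3, hy, h3, rfl⟩ := (Nat.dvd_mul).1 hx
  obtain ⟨a1, a2, h1, h2, rfl⟩ := (Nat.dvd_mul).1 hy
  have key : ∀ p b : ℕ, p.Prime → b ∣ p → ∃ i, i < 2 ∧ b = p ^ i := by
    intro p b hp hb
    rcases (Nat.dvd_prime hp).1 hb with rfl | rfl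
    · exact ⟨0, by norm_num, by simp⟩
    · exact ⟨1, by norm_num, by simp⟩
  obtain ⟨i, hi, rfl⟩ := key _ _ Nat.prime_two h1
  obtain ⟨j, hj, rfl⟩ := key _ _ hq h2
  obtain ⟨k, hk, rfl⟩ := key _ _ hr h3
  obtain ⟨l, hl, rfl⟩ := key _ _ hs h4
  exact ⟨i, j, k, l, hi, hj, hk, hl, rfl⟩

/-- the norm tests -/
lemma pell_cases (h : Hyp η q r s) (a : ℕ) (ha : a ∣ 2 * q * r * s)
    (T : ∀ (p : ℕ) [Fact p.Prime] (w z : ℤ), p ∣ η * q * r * s → z ≠ 0 →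
      ((a : ℤ) = w * z ^ 2 ∨ -(a : ℤ) * (η * q * r * s : ℕ) = w * z ^ 2) → legendreSym p w ≠ -1) :
    a = 1 ∨ a = r * s ∨ (η = 1 ∧ (a = r ∨ a = s)) ∨ (η = 2 ∧ (a = 2 * q * r ∨ a = 2 * q * s)) := by
  have hq := (Fact.out : q.Prime); have hs := (Fact.out : s.Prime); have hr := (Fact.out : r.Prime)
  have dq : q ∣ η * q * r * s := ⟨η * r * s, by ring⟩
  have ds : s ∣ η * q * r * s := ⟨η * q * r, by ring⟩
  have dr : r ∣ η * q * r * s := ⟨η * q * s, by ring⟩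
  have q0 : (q:ℤ) ≠ 0 := by exact_mod_cast hq.ne_zero
  have r0 : (r:ℤ) ≠ 0 := by exact_mod_cast hr.ne_zero
  have s0 : (s:ℤ) ≠ 0 := by exact_mod_cast hs.ne_zero
  have Rr := fun w z => T r w z dr
  have Rq := fun w z => T q w z dq
  have L1 := h.sq_leg; have L2 := h.rq_leg; have L3 := h.sr_leg; have L4 := h.qm1; have L5 := h.r2; have L6 := h.rm1
  have L7 := h.hqr
  have f4 : legendreSym r 4 = 1 := by
    rw [show (4:ℤ) = 2 * 2 by norm_num, legendreSym.mul, L5]; rfl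
  have o1 : ∀ p : ℕ, [Fact p.Prime] → legendreSym p 1 = 1 := fun p _ => legendreSym.at_one p
  obtain ⟨i, j, k, l, hi, hj, hk, hl, rfl⟩ := div4 hq hr hs ha
  rcases h.hη with rfl | rfl
  · simp only [ze] at L1 L2 L7
    norm_num at L1 L2 L7
    have i0 : i = 0 := by
      by_contra hi0
      obtain rfl : i = 1 := by omega
      interval_cases k
      · refine Rr (2 * q ^ j * s ^ l) 1 one_ne_zero (Or.inl (by push_cast; ring)) ?_
        interval_cases j <;> interval_cases l <;> simp [legendreSym.mul, L3, L5, L7]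
      · refine Rr ((-1) * (2 * q ^ (j+1) * s ^ (l+1))) r r0 (Or.inr (by push_cast; ring)) ?_
        rw [legendreSym.mul, L6]
        interval_cases j <;> interval_cases l <;> simp [legendreSym.mul, L3, L5, L7, pow_succ]
    subst i0
    have j0 : j = 0 := by
      by_contra hj0
      obtain rfl : j = 1 := by omega
      refine Rq ((-1) * (r ^ (k+1) * s ^ (l+1))) q q0 (Or.inr (by push_cast; ring)) ?_
      rw [legendreSym.mul, L4]
      interval_cases k <;> interval_cases l <;> simp [legendreSym.mul, L1, L2, pow_succ]
    subst j0
    interval_cases k <;> interval_cases l <;> simp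
  · simp only [ze] at L1 L2 L7
    norm_num at L1 L2 L7
    have ij : i = j := by
      by_contra hi0
      interval_cases k
      · refine Rr (2 ^ i * q ^ j * s ^ l) 1 one_ne_zero (Or.inl (by push_cast; ring)) ?_
        interval_cases i <;> interval_cases j <;> first | exact absurd rfl hi0 | (interval_cases l <;> simp [legendreSym.mul, L3, L5, L7, o1, pow_succ, f4])
      · refine Rr ((-1) * (2 ^ (i+1) * q ^ (j+1) * s ^ (l+1))) r r0 (Or.inr (by push_cast; ring)) ?_
        rw [legendreSym.mul, L6]
        interval_cases i <;> interval_cases j <;> first | exact absurd rfl hi0 | (interval_cases l <;> simp [legendreSym.mul, L3, L5, L7, o1, pow_succ, f4])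
    subst ij
    interval_cases i
    · have kl : k = l := by
        by_contra hkl
        refine Rq (r ^ k * s ^ l) 1 one_ne_zero (Or.inl (by push_cast; ring)) ?_
        interval_cases k <;> interval_cases l <;> first | exact absurd rfl hkl | simp [legendreSym.mul, L1, L2, o1]
      subst kl
      interval_cases k <;> simp
    · have kl : k ≠ l := by
        rintro rfl
        refine Rq ((-1) * (r ^ (k+1) * s ^ (k+1))) (2 * q) (by simpa using q0) (Or.inr (by push_cast; ring)) ?_
        rw [legendreSym.mul, L4]
        interval_cases k <;> simp [legendreSym.mul, pow_succ, L1, L2]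
      interval_cases k <;> interval_cases l <;> first | exact absurd rfl kl | simp

set_option maxHeartbeats 1000000 in
/-- The Pell step. -/
lemma pell (h : Hyp η q r s) (γ γ' : ℤ) (hγ : 0 < γ) (hγ' : 0 < γ')
    (hPell : γ ^ 2 - (η * q * r * s : ℕ) * γ' ^ 2 = 1)
    (hfund : ∀ a b : ℤ, 0 < a → 0 < b → a ^ 2 - (η * q * r * s : ℕ) * b ^ 2 = 1 → γ ≤ a)
    (hnsq : ¬ ∃ t : ℤ, 2 ^ (if η = 1 then 1 else 0) * (q : ℤ) * (γ - 1) = t ^ 2) :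
    ∃ u : (Rq (η * q * r * s))ˣ, u ∈ (pr _).ker ∧ ∃ y : Rq (η * q * r * s), y ^ 2 = r * u ∨ y ^ 2 = s * u := by
  obtain ⟨c1, c2, c3, c4, c5, c6⟩ := h.cop
  have hq := (Fact.out : q.Prime); have hs := (Fact.out : s.Prime); have hr := (Fact.out : r.Prime)
  have hsf := sf_qrs h h.hη
  set d := η * q * r * s with hd
  have hd0 : d ≠ 0 := hsf.ne_zero
  have sq2 : ∀ p : ℕ, p.Prime → ¬ p ^ 2 ∣ d := by
    intro p hp h
    have := hsf p (by rwa [← pow_two])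
    exact hp.one_lt.ne' (Nat.isUnit_iff.1 this)
  have dq : q ∣ d := ⟨η * r * s, by rw [hd]; ring⟩
  obtain ⟨σ, hQ, hσ⟩ := quadR d (nsq_of q _ hq dq (sq2 q hq))
  have hrt := rt_sq d
  obtain ⟨g, rfl⟩ : ∃ g : ℕ, γ = g := ⟨γ.toNat, by omega⟩
  obtain ⟨b, rfl⟩ : ∃ b : ℕ, γ' = b := ⟨γ'.toNat, by omega⟩
  have hP : g ^ 2 = d * b ^ 2 + 1 := by
    have : (g:ℤ) ^ 2 = d * b ^ 2 + 1 := by linarith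
    exact_mod_cast this
  have hb : b ≠ 0 := by omega
  have hg1 : 1 < g := by
    by_contra hh
    have : 0 < d * b ^ 2 := by positivity
    have : g ^ 2 ≤ 1 := by nlinarith
    omega
  obtain ⟨a, t, hat, ht, hasf, hap⟩ := pell_sf hb hd0 hP
  have hadiv : a ∣ 2 * q * r * s := by
    apply sf_dvd hasf (by simp [hq.ne_zero, hr.ne_zero, hs.ne_zero])
    intro l hl hla
    have := hap l hl hla
    rcases h.hη with e | e <;> rw [hd, e] at this
    · convert this using 1; ring
    · have : l ∣ 2 * (2 * q * r * s) := this
      rcases hl.dvd_mul.1 this with h | h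
      · exact h.trans ⟨q * r * s, by ring⟩
      · exact h
  -- the element x
  have hPF : (g:Rq d) ^ 2 = d * b ^ 2 + 1 := by exact_mod_cast hP
  have hatF : (2:Rq d) * (g + 1) = a * t ^ 2 := by exact_mod_cast hat
  have htF : (t : Rq d) ≠ 0 := by exact_mod_cast ht
  set x : Rq d := (g + 1 + b * rt d) / t with hx
  have hxn : x * σ x = a := by
    rw [hx]; simp only [map_div₀, map_add, map_mul, map_natCast, map_one, hσ]
    field_simp
    linear_combination hatF + hPF - (b:Rq d)^2 * hrt
  have hxs : x ^ 2 = a * (g + b * rt d) := by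
    rw [hx]; field_simp
    linear_combination (g + b * rt d) * hatF - hPF + (b:Rq d)^2 * hrt
  have hcases := pell_cases h a hadiv (by
    intro p hp w z hpd hz hor hl
    have hzQ : (z : ℚ) ≠ 0 := by exact_mod_cast hz
    rcases hor with e | e
    · exact hzQ (nonnormQ hQ p w hpd (sq2 p hp.out) hl _ hrt hσ x z (by
        rw [hxn]
        have := congrArg (Int.cast : ℤ → Rq d) e
        push_cast at this; rw [this]; simp))
    · exact hzQ (nonnormQ hQ p w hpd (sq2 p hp.out) hl _ hrt hσ (x * rt d) z (by
        rw [map_mul, hσ]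
        have := congrArg (Int.cast : ℤ → Rq d) e
        have e3 : x * rt d * (σ x * -rt d) = - ((x * σ x) * (rt d) ^ 2) := by ring
        rw [e3, hxn, hrt]
        rw [Int.cast_mul, Int.cast_neg, Int.cast_natCast, Int.cast_natCast] at this
        rw [← neg_mul, this]; simp)))
  -- the unit
  obtain ⟨B, hB, hB2⟩ := int_of_sq hrt
  have hPO : (g:𝓞 (Rq d)) ^ 2 = d * b ^ 2 + 1 := by exact_mod_cast hP
  let U : (𝓞 (Rq d))ˣ := ⟨g + b * B, g - b * B, by linear_combination hPO - (b:𝓞 (Rq d))^2 * hB2, by linear_combination hPO - (b:𝓞 (Rq d))^2 * hB2⟩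
  have hU : ((Units.map (algebraMap (𝓞 (Rq d)) (Rq d)).toMonoidHom U : (Rq d)ˣ) : Rq d) = g + b * rt d := by
    rw [← hB]
    simp [U]
  refine ⟨Units.map (algebraMap (𝓞 (Rq d)) (Rq d)).toMonoidHom U, (mem_ker_pr _).2 ⟨U, rfl⟩, ?_⟩
  rw [hU]
  rcases hcases with rfl | rfl | ⟨he, rfl | rfl⟩ | ⟨he, rfl | rfl⟩
  · exfalso
    obtain ⟨e, rfl⟩ : 2 ∣ t := by
      have : 2 ∣ t ^ 2 := ⟨g + 1, by omega⟩
      exact Nat.prime_two.dvd_of_dvd_pow this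
    have h1 : g + 1 = 2 * e ^ 2 := by nlinarith
    have he0 : e ≠ 0 := by rintro rfl; simp at ht
    have h3 : g = 2 * e ^ 2 - 1 := by omega
    have he2 : 1 < e := by
      by_contra hh
      have : e = 1 := by omega
      subst this; omega
    have h2 : d * b ^ 2 = (2 * e) ^ 2 * (e ^ 2 - 1) := by
      obtain ⟨v, hv⟩ : ∃ v, e ^ 2 = v + 1 := ⟨e ^ 2 - 1, by
        have : 0 < e ^ 2 := by positivity
        omega⟩
      have : g = 2 * v + 1 := by omega
      rw [this] at hP; rw [mul_pow, hv]
      rw [Nat.add_sub_cancel]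
      have e9 : (2 * v + 1) ^ 2 = 2 ^ 2 * (v + 1) * v + 1 := by ring
      rw [e9] at hP
      exact (Nat.add_right_cancel hP).symm
    obtain ⟨f, rfl⟩ := sqf_dvd hsf ⟨_, h2⟩ hb
    have hf : 0 < f := Nat.pos_of_ne_zero (by rintro rfl; simp at hb)
    have h4 : d * f ^ 2 = e ^ 2 - 1 := by
      have : (2 * e) ^ 2 * (d * f ^ 2) = (2 * e) ^ 2 * (e ^ 2 - 1) := by rw [← h2]; ring
      exact Nat.eq_of_mul_eq_mul_left (by positivity) this
    have h5 : e ^ 2 = d * f ^ 2 + 1 := by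
      have : 0 < e ^ 2 := by positivity
      omega
    have h6 : (g:ℤ) ≤ e := hfund e f (by omega) (by omega) (by
      have : (e:ℤ) ^ 2 = d * f ^ 2 + 1 := by exact_mod_cast h5
      linarith)
    nlinarith
  · exfalso
    apply hnsq
    have rs0 : r * s ≠ 0 := mul_ne_zero hr.ne_zero hs.ne_zero
    have key : (if η = 1 then 2 else 1) * q * (g - 1) * t ^ 2 = (2 * q * b) ^ 2 := by
      obtain ⟨w, rfl⟩ : ∃ w, g = w + 1 := ⟨g - 1, by omega⟩
      have e1 : w * (w + 2) = d * b ^ 2 := by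
        have : (w + 1) ^ 2 = w * (w + 2) + 1 := by ring
        omega
      simp only [Nat.add_sub_cancel]
      apply Nat.eq_of_mul_eq_mul_left (Nat.pos_of_ne_zero rs0)
      calc r * s * ((if η = 1 then 2 else 1) * q * w * t ^ 2) = (if η = 1 then 2 else 1) * q * w * (r * s * t ^ 2) := by ring
        _ = (if η = 1 then 2 else 1) * q * w * (2 * (w + 1 + 1)) := by rw [hat]
        _ = (if η = 1 then 2 else 1) * q * 2 * (w * (w + 2)) := by ring
        _ = r * s * (2 * q * b) ^ 2 := by
          rw [e1, hd]
          rcases h.hη with e | e <;> rw [e] <;> norm_num <;> ring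
    have hdv : t ∣ 2 * q * b := (Nat.pow_dvd_pow_iff two_ne_zero).1 (Dvd.intro_left _ key)
    obtain ⟨f, hf⟩ := hdv
    refine ⟨f, ?_⟩
    have k2 : (if η = 1 then 2 else 1) * q * (g - 1) = f ^ 2 := by
      apply Nat.eq_of_mul_eq_mul_right (show 0 < t ^ 2 by positivity)
      rw [key, hf]; ring
    have : (((g - 1 : ℕ)) : ℤ) = (g:ℤ) - 1 := by push_cast [hg1.le]; ring
    rw [← this]
    have k3 := congrArg (Nat.cast : ℕ → ℤ) k2
    push_cast at k3
    rw [← k3]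
    rcases h.hη with e | e <;> rw [e] <;> norm_num
  · exact ⟨x, Or.inl hxs⟩
  · exact ⟨x, Or.inr hxs⟩
  · refine ⟨x * rt d / (2 * q * r), Or.inr ?_⟩
    have hq0 : (q : Rq d) ≠ 0 := by exact_mod_cast hq.ne_zero
    have hr0 : (r : Rq d) ≠ 0 := by exact_mod_cast hr.ne_zero
    have hdd : (d : Rq d) = 2 * q * r * s := by rw [hd, he]; push_cast; ring
    rw [div_pow, mul_pow, hxs, hrt, hdd]
    push_cast; field_simp
  · refine ⟨x * rt d / (2 * q * s), Or.inl ?_⟩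
    have hq0 : (q : Rq d) ≠ 0 := by exact_mod_cast hq.ne_zero
    have hr0 : (s : Rq d) ≠ 0 := by exact_mod_cast hs.ne_zero
    have hdd : (d : Rq d) = 2 * q * r * s := by rw [hd, he]; push_cast; ring
    rw [div_pow, mul_pow, hxs, hrt, hdd]
    push_cast; field_simp
end
end Wk

open IntermediateField NumberField
set_option linter.all false
namespace Wk
open scoped nonZeroDivisors

lemma rel_ne {G : Type*} [CommGroup G] {H K : Subgroup G} {x : G} (hx : x ∈ K) (hx' : x ∉ H) : H.relIndex K ≠ 1 := by
  rw [Ne, Subgroup.relIndex_eq_one]; exact fun h => hx' (h hx)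

lemma mem_sup_z {G : Type*} [CommGroup G] {H : Subgroup G} {x y : G} (hx2 : x ^ 2 ∈ H) (hy : y ∈ H ⊔ Subgroup.zpowers x) :
    y ∈ H ∨ ∃ z ∈ H, y = x * z := by
  obtain ⟨a, ha, b, hb, rfl⟩ := Subgroup.mem_sup.1 hy
  obtain ⟨n, rfl⟩ := Subgroup.mem_zpowers_iff.1 hb
  rcases Int.even_or_odd' n with ⟨k, rfl | rfl⟩
  · left; rw [zpow_mul, zpow_ofNat]; exact H.mul_mem ha (H.zpow_mem hx2 k)
  · right
    refine ⟨a * (x ^ 2) ^ k, H.mul_mem ha (H.zpow_mem hx2 k), ?_⟩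
    rw [zpow_add, zpow_mul, zpow_one, zpow_ofNat, mul_comm x, mul_assoc]

section
variable {K : Type*} [Field K] [NumberField K]

lemma units4 [IsTotallyReal K] (ι : K →+* ℝ) (hf : Module.finrank ℚ K = 2) (u : Kˣ) (hu : u ∈ (pr K).ker)
    (hu1 : ∀ v : Kˣ, u ≠ v ^ 2) (hu2 : ∀ v : Kˣ, u ≠ - v ^ 2) (w : Kˣ) (hw : w ∈ (pr K).ker) :
    ∃ v : Kˣ, v ∈ (pr K).ker ∧ (w = v ^ 2 ∨ w = - v ^ 2 ∨ w = u * v ^ 2 ∨ w = -(u * v ^ 2)) := by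
  set E := (pr K).ker
  set S := E.map sq with hS
  set T := S ⊔ Subgroup.zpowers (-1) with hT
  set U := T ⊔ Subgroup.zpowers u with hU
  have mS : ∀ x, x ∈ S → ∃ v ∈ E, x = v ^ 2 := by
    rintro x ⟨v, hv, rfl⟩; exact ⟨v, hv, sq_apply v⟩
  have sS : ∀ x ∈ E, x ^ 2 ∈ S := fun x hx => ⟨x, hx, sq_apply x⟩
  have mT : ∀ x, x ∈ T → ∃ v ∈ E, x = v ^ 2 ∨ x = - v ^ 2 := by
    intro x hx
    rcases mem_sup_z (H := S) (sS _ neg_one_ker) hx with h | ⟨z, hz, rfl⟩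
    · obtain ⟨v, hv, rfl⟩ := mS x h; exact ⟨v, hv, Or.inl rfl⟩
    · obtain ⟨v, hv, rfl⟩ := mS z hz; exact ⟨v, hv, Or.inr (by rw [neg_one_mul])⟩
  have hST : S ≤ T := le_sup_left
  have hTU : T ≤ U := le_sup_left
  have hSE : S ≤ E := by intro x hx; obtain ⟨v, hv, rfl⟩ := mS x hx; exact E.pow_mem hv 2
  have hTE : T ≤ E := sup_le hSE (by rw [Subgroup.zpowers_le]; exact neg_one_ker)
  have hUE : U ≤ E := sup_le hTE (by rw [Subgroup.zpowers_le]; exact hu)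
  have h1 : S.relIndex T * T.relIndex U * U.relIndex E = 2 ^ 2 := by
    rw [mul_assoc, Subgroup.relIndex_mul_relIndex _ _ _ hTU hUE, Subgroup.relIndex_mul_relIndex _ _ _ hST hTE, hS, sq_relIndex ι, hf]
  have a1 : S.relIndex T ≠ 1 := by
    refine rel_ne (x := -1) (Subgroup.mem_sup_right (Subgroup.mem_zpowers _)) ?_
    intro h
    obtain ⟨v, -, hv⟩ := mS _ h
    have := congrArg ι (congrArg Units.val hv)
    push_cast at this
    rw [map_neg, map_one, map_pow] at this
    nlinarith [sq_nonneg (ι v)]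
  have a2 : T.relIndex U ≠ 1 := by
    refine rel_ne (x := u) (Subgroup.mem_sup_right (Subgroup.mem_zpowers _)) ?_
    intro h
    obtain ⟨v, -, hv | hv⟩ := mT _ h
    · exact hu1 v hv
    · exact hu2 v hv
  have a3 : U.relIndex E = 1 := by
    have p1 : S.relIndex T ≠ 0 := by intro h; rw [h] at h1; simp at h1
    have p2 : T.relIndex U ≠ 0 := by intro h; rw [h] at h1; simp at h1
    have p3 : U.relIndex E ≠ 0 := by intro h; rw [h] at h1; simp at h1
    have q1 : 2 ≤ S.relIndex T := by omega
    have q2 : 2 ≤ T.relIndex U := by omega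
    have : 4 ≤ S.relIndex T * T.relIndex U := Nat.mul_le_mul q1 q2
    by_contra h
    have q3 : 2 ≤ U.relIndex E := by omega
    have := Nat.mul_le_mul this q3
    omega
  have hw' : w ∈ U := (Subgroup.relIndex_eq_one.1 a3) hw
  by_cases hwT : w ∈ T
  · obtain ⟨v, hv, h | h⟩ := mT w hwT
    · exact ⟨v, hv, Or.inl h⟩
    · exact ⟨v, hv, Or.inr (Or.inl h)⟩
  · rcases mem_sup_z (H := T) (hST (sS _ hu)) hw' with h | ⟨z, hz, rfl⟩
    · exact absurd h hwT
    · obtain ⟨v, hv, rfl | rfl⟩ := mT z hz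
      · exact ⟨v, hv, Or.inr (Or.inr (Or.inl rfl))⟩
      · exact ⟨v, hv, Or.inr (Or.inr (Or.inr (by rw [mul_neg])))⟩

variable {L : Type*} [Field L] [NumberField L] {φ : Q0 →+* L} {σ : L →+* L}

lemma aN_Q0 (y : Q0ˣ) (t : ℚ) (h : (y : Q0) = algebraMap ℚ Q0 t) : aN (pr Q0 y) = |t| := by
  rw [aN_pr, h, Algebra.norm_algebraMap, IntermediateField.finrank_bot, pow_one]

lemma normQ_abs (h : IsQuad φ σ) (x : Lˣ) : ∃ t : ℚ, |t| = aN (pr L x) ∧ (x : L) * σ x = φ (algebraMap ℚ Q0 t) := by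
  obtain ⟨y, hy⟩ := h.exists_norm x
  obtain ⟨t, ht⟩ := bot_rat (y : Q0)
  refine ⟨t, ?_, by rw [← hy, ht]⟩
  rw [← aN_Q0 y t ht, ← nI_pr h x y hy, aN_nI]

lemma norm_unit (h : IsQuad φ σ) (u : Lˣ) (hu : u ∈ (pr L).ker) : (u : L) * σ u = 1 ∨ (u : L) * σ u = -1 := by
  obtain ⟨t, h1, h2⟩ := normQ_abs h u
  rw [MonoidHom.mem_ker.1 hu, map_one] at h1
  rcases (abs_eq zero_le_one).1 h1 with rfl | rfl
  · left; rw [h2]; simp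
  · right; rw [h2]; simp

/-- a norm-one ideal is of the form `J^{σ-1}` -/
lemma ideal_h90 {k : Type*} [Field k] [NumberField k] {φ : k →+* L} {σ : L →+* L} (h : IsQuad φ σ) (a : Id L) (ha : a * iMap σ a = 1) : ∃ J : Id L, a * J = iMap σ J := by
  obtain ⟨n, d, hn, hd, hco, rfl⟩ := exists_idu_div_coprime a
  rw [map_div, iMap_idu, iMap_idu, div_mul_div_comm, div_eq_one, ← idu_mul, ← idu_mul, idu_inj] at ha
  refine ⟨idu d hd, ?_⟩
  rw [div_mul_cancel, iMap_idu, idu_inj]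
  have hco' : IsCoprime (Ideal.map (om σ) n) (Ideal.map (om σ) d) := by
    have := hco.map (Ideal.mapHom (om σ))
    exact this
  apply dvd_antisymm
  · apply hco.dvd_of_dvd_mul_left
    rw [← ha]; exact dvd_mul_right _ _
  · apply hco'.symm.dvd_of_dvd_mul_right
    rw [ha]; exact dvd_mul_left _ _

/-- from a norm `-1` element to a norm `-1` unit -/
lemma unit_neg (h : IsQuad φ σ) (hA : Nat.card (A L) = 1) (x : Lˣ) (hx : (x : L) * σ x = -1) :
    ∃ ε : Lˣ, ε ∈ (pr L).ker ∧ (ε : L) * σ ε = -1 := by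
  have hx' : x * um σ x = -1 := Units.ext hx
  have h1 : pr L x * iMap σ (pr L x) = 1 := by
    rw [iMap_pr, ← map_mul]
    have : x * Units.map σ.toMonoidHom x = -1 := Units.ext hx
    rw [this]; exact neg_one_ker
  obtain ⟨J, hJ⟩ := ideal_h90 h _ h1
  obtain ⟨n, hn, y, hy⟩ := cl_eq_one.1 (triv_elem hA (cl L J))
  refine ⟨x ^ n * y / Units.map σ.toMonoidHom y, ?_, ?_⟩
  · rw [MonoidHom.mem_ker, map_div, map_mul, ← iMap_pr, hy, map_pow, map_pow, ← mul_pow, hJ, div_self']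
  · have e1 : ((x ^ n * y / Units.map σ.toMonoidHom y : Lˣ) : L) = (x:L) ^ n * y / σ y := by simp
    rw [e1, map_div₀, map_mul, map_pow, h.inv]
    have hy0 : (y : L) ≠ 0 := y.ne_zero
    have hy1 : σ (y : L) ≠ 0 := by simpa using hy0
    have : (x:L) ^ n * σ (x:L) ^ n = -1 := by rw [← mul_pow, hx, hn.neg_one_pow]
    field_simp
    linear_combination this
end

/-- everything about ℚ(√r) -/
lemma kdata (r : ℕ) [Fact r.Prime] (hr8 : r % 8 = 5) : ∃ σ : Rq r →+* Rq r, IsQuad (inc (le_ad : Q0 ≤ Rq r)) σ ∧ σ (rt r) = - rt r ∧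
    Nat.card (A (Rq r)) = 1 ∧ (∃ ε : (Rq r)ˣ, ε ∈ (pr _).ker ∧ (ε : Rq r) * σ ε = -1) ∧
    (∀ u : (Rq r)ˣ, u ∈ (pr _).ker → (u : Rq r) * σ u = -1 ∨ ∃ v : (Rq r)ˣ, u = v ^ 2 ∨ u = - v ^ 2) ∧
    (Ideal.span {((2:ℕ) : 𝓞 (Rq r))}).IsPrime := by
  have hr := (Fact.out : r.Prime)
  obtain ⟨σ, hQ, hσ⟩ := quadR r (nsq_of r r hr dvd_rfl (by simpa using nsq_dvd hr (Nat.coprime_one_right r)))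
  have h1 : ri (inc (le_ad : Q0 ≤ Rq r)) σ ∣ 2 := by
    simpa using ri_dvd hQ (fun P hR => ram_mem' hQ (rt_sq r) (by omega) hσ P hR) (NP_bot r hr)
  obtain ⟨hA, hei⟩ := A_triv hQ (rho _) A_bot h1
  obtain ⟨x, hx⟩ := ei_norm hQ hei (-1) neg_one_ker
  obtain ⟨ε, hε, hε1⟩ := unit_neg hQ hA x (by rw [← hx]; simp)
  refine ⟨σ, hQ, hσ, hA, ⟨ε, hε, hε1⟩, ?_, ?_⟩
  · intro u hu
    have hsq : ∀ v : (Rq r)ˣ, (v : Rq r) ^ 2 * σ ((v : Rq r) ^ 2) ≠ -1 := by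
      intro v hv
      have e : (v : Rq r) ^ 2 * σ ((v : Rq r) ^ 2) = (v * σ v) ^ 2 := by rw [map_pow]; ring
      rw [e] at hv
      have := congrArg (rho _) hv
      rw [map_pow, map_neg, map_one] at this
      nlinarith [sq_nonneg (rho (Rq r) (v * σ v))]
    obtain ⟨v, hv, h | h | h | h⟩ := units4 (rho _) (finrank2 hQ) ε hε (by
        rintro v rfl; exact hsq v (by simpa using hε1)) (by
        rintro v rfl; exact hsq v (by simpa using hε1)) u hu
    · exact Or.inr ⟨v, Or.inl h⟩
    · exact Or.inr ⟨v, Or.inr h⟩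
    all_goals
      left
      have h3 : ((v : Rq r) * σ v) ^ 2 = 1 := by
        rcases norm_unit hQ v hv with e | e <;> rw [e] <;> norm_num
      rw [h]; push_cast
    · rw [map_mul, map_pow]; linear_combination hε1 * ((v : Rq r) * σ v) ^ 2 - h3
    · rw [map_neg, map_mul, map_pow]; linear_combination hε1 * ((v : Rq r) * σ v) ^ 2 - h3
  · obtain ⟨b, -, hb⟩ := int_half (rt_sq r) (by omega)
    refine inert_of hQ 2 Nat.prime_two b (fun P hP h2 hm => ?_)
    rw [hb] at hm
    refine coprime_mem hP h2 hm ?_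
    rw [Nat.coprime_two_left]; rw [Nat.odd_iff]; omega

lemma inert_q (q r : ℕ) [Fact q.Prime] [Fact r.Prime] (hq2 : q ≠ 2) (hqr : Nat.Coprime q r) (hl : legendreSym q r = -1)
    {σ : Rq r →+* Rq r} (hQ : IsQuad (inc (le_ad : Q0 ≤ Rq r)) σ) : (Ideal.span {((q:ℕ) : 𝓞 (Rq r))}).IsPrime := by
  have hq := (Fact.out : q.Prime)
  obtain ⟨b, -, hb⟩ := int_of_sq (rt_sq r)
  refine inert_of hQ q hq b (fun P hP h2 hm => ?_)
  have h1 : ((q:ℕ):ℤ) ∣ (r:ℤ) ^ (q / 2) + 1 := by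
    rw [← ZMod.intCast_zmod_eq_zero_iff_dvd]
    have := legendreSym.eq_pow q (r:ℤ)
    rw [hl] at this
    push_cast at this ⊢
    rw [← this]; ring
  obtain ⟨t, ht⟩ := h1
  have ht' := congrArg (Int.cast : ℤ → 𝓞 (Rq r)) ht
  push_cast at ht'
  have hodd : q = 2 * (q / 2) + 1 := by
    have := hq.eq_two_or_odd; omega
  have e : b * ((2:ℕ) : 𝓞 (Rq r)) = b * ((r:𝓞 (Rq r)) ^ (q/2) + 1) - (b ^ q - b) := by
    have : b ^ q = (b ^ 2) ^ (q/2) * b := by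
      conv_lhs => rw [hodd]
      rw [pow_succ, pow_mul]
    rw [this, hb]; push_cast; ring
  have h3 : b * ((2:ℕ) : 𝓞 (Rq r)) ∈ P := by
    rw [e, ht']
    exact P.sub_mem (P.mul_mem_left _ (P.mul_mem_right _ h2)) hm
  rcases hP.mem_or_mem h3 with h | h
  · refine coprime_mem hP h2 (b := r) ?_ hqr
    rw [← hb]; exact P.pow_mem_of_mem h 2 two_pos
  · exact coprime_mem hP h2 h ((Nat.coprime_primes hq Nat.prime_two).2 hq2)

lemma A_sqrt2 : Nat.card (A (Rq 2)) = 1 := by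
  obtain ⟨σ, hQ, hσ⟩ := quadR 2 (nsq_of 2 2 Nat.prime_two dvd_rfl (by norm_num))
  have h1 : ri (inc (le_ad : Q0 ≤ Rq 2)) σ ∣ 2 := by
    simpa using ri_dvd hQ (fun P hR => ram_mem hQ (rt_sq 2) hσ P hR (a := 2) (j := 2) (by norm_num)) (NP_bot 2 Nat.prime_two)
  exact (A_triv hQ (rho _) A_bot h1).1
end Wk

open IntermediateField NumberField
set_option linter.all false
namespace Wk
open scoped nonZeroDivisors

/-- biquadratic data -/
structure Biq (M L : IntermediateField ℚ ℝ) [NumberField M] [NumberField L] (a b c : ℕ) (σ₁ σ₂ σ₃ : L →+* L) : Prop where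
  la : ad M (√(a:ℝ)) ≤ L
  lb : ad M (√(b:ℝ)) ≤ L
  lc : ad M (√(c:ℝ)) ≤ L
  q1 : IsQuad (inc la) σ₁
  q2 : IsQuad (inc lb) σ₂
  q3 : IsQuad (inc lc) σ₃
  e12 : ∀ x, σ₁ (σ₂ x) = σ₃ x
  e21 : ∀ x, σ₂ (σ₁ x) = σ₃ x
  a1 : ∀ h, σ₁ ⟨√(a:ℝ), h⟩ = ⟨√(a:ℝ), h⟩
  b1 : ∀ h, σ₁ ⟨√(b:ℝ), h⟩ = -⟨√(b:ℝ), h⟩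
  a2 : ∀ h, σ₂ ⟨√(a:ℝ), h⟩ = -⟨√(a:ℝ), h⟩
  b2 : ∀ h, σ₂ ⟨√(b:ℝ), h⟩ = ⟨√(b:ℝ), h⟩

namespace Biq
variable {M L : IntermediateField ℚ ℝ} [NumberField M] [NumberField L] {a b c : ℕ} {σ₁ σ₂ σ₃ : L →+* L}
lemma e13 (B : Biq M L a b c σ₁ σ₂ σ₃) (x : L) : σ₁ (σ₃ x) = σ₂ x := by rw [← B.e12, B.q1.inv]
lemma e23 (B : Biq M L a b c σ₁ σ₂ σ₃) (x : L) : σ₂ (σ₃ x) = σ₁ x := by rw [← B.e21, B.q2.inv]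
lemma e31 (B : Biq M L a b c σ₁ σ₂ σ₃) (x : L) : σ₃ (σ₁ x) = σ₂ x := by rw [← B.e21, B.q1.inv]
lemma e32 (B : Biq M L a b c σ₁ σ₂ σ₃) (x : L) : σ₃ (σ₂ x) = σ₁ x := by rw [← B.e12, B.q2.inv]
lemma a3 (B : Biq M L a b c σ₁ σ₂ σ₃) (h) : σ₃ ⟨√(a:ℝ), h⟩ = -⟨√(a:ℝ), h⟩ := by rw [← B.e12, B.a2, map_neg, B.a1]
lemma b3 (B : Biq M L a b c σ₁ σ₂ σ₃) (h) : σ₃ ⟨√(b:ℝ), h⟩ = -⟨√(b:ℝ), h⟩ := by rw [← B.e12, B.b2, B.b1]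
end Biq

lemma sqrt_mul' (a b : ℕ) : √((a * b : ℕ) : ℝ) = √(a:ℝ) * √(b:ℝ) := by
  push_cast; exact Real.sqrt_mul (Nat.cast_nonneg a) _

lemma sqrt_rel {a b c t : ℕ} (h : a * b = t ^ 2 * c) : √(a:ℝ) * √(b:ℝ) = t * √(c:ℝ) := by
  rw [← sqrt_mul', h]; push_cast
  rw [Real.sqrt_mul (by positivity), Real.sqrt_sq (Nat.cast_nonneg t)]

lemma ad_self {K : IntermediateField ℚ ℝ} {α : ℝ} : α ∈ ad K α := mem_ad

lemma biq_fields {M L : IntermediateField ℚ ℝ} {a b c t : ℕ} (hL : L = ad (ad M (√(a:ℝ))) (√(b:ℝ)))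
    (ht : t ≠ 0) (hb0 : b ≠ 0) (habc : a * b = t ^ 2 * c) :
    L = ad (ad M (√(b:ℝ))) (√(a:ℝ)) ∧ L = ad (ad M (√(c:ℝ))) (√(b:ℝ)) := by
  have hrel := sqrt_rel habc
  have hM : M ≤ L := by rw [hL]; exact le_ad.trans le_ad
  have ha : √(a:ℝ) ∈ L := by rw [hL]; exact le_ad mem_ad
  have hb : √(b:ℝ) ∈ L := by rw [hL]; exact mem_ad
  have hbr : √(b:ℝ) ≠ 0 := by rw [Real.sqrt_ne_zero']; exact_mod_cast Nat.pos_of_ne_zero hb0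
  have htr : (t:ℝ) ≠ 0 := by exact_mod_cast ht
  have hc : √(c:ℝ) ∈ L := by
    have : √(c:ℝ) = √(a:ℝ) * √(b:ℝ) / t := by rw [hrel]; field_simp
    rw [this]; exact L.div_mem (L.mul_mem ha hb) (IntermediateField.natCast_mem L t)
  constructor
  · apply le_antisymm
    · rw [hL]; exact ad_le (ad_le (le_ad.trans le_ad) mem_ad) (le_ad mem_ad)
    · exact ad_le (ad_le hM hb) ha
  · apply le_antisymm
    · rw [hL]
      refine ad_le (ad_le (le_ad.trans le_ad) ?_) mem_ad
      have : √(a:ℝ) = t * √(c:ℝ) / √(b:ℝ) := by rw [← hrel]; field_simp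
      rw [this]
      exact IntermediateField.div_mem _ (IntermediateField.mul_mem _ (IntermediateField.natCast_mem _ t) (le_ad mem_ad)) mem_ad
    · exact ad_le (ad_le hM hc) hb

lemma biq_mk {M L : IntermediateField ℚ ℝ} [NumberField M] [NumberField L] {a b c t : ℕ} (hL : L = ad (ad M (√(a:ℝ))) (√(b:ℝ)))
    (ht : t ≠ 0) (hb0 : b ≠ 0) (habc : a * b = t ^ 2 * c) (ha : √(a:ℝ) ∉ M) (hb : √(b:ℝ) ∉ M) (hab : √(a:ℝ) * √(b:ℝ) ∉ M) :
    ∃ σ₁ σ₂ σ₃, Biq M L a b c σ₁ σ₂ σ₃ := by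
  obtain ⟨hL2, hL3⟩ := biq_fields hL ht hb0 habc
  have la : ad M (√(a:ℝ)) ≤ L := by rw [hL]; exact le_ad
  have lb : ad M (√(b:ℝ)) ≤ L := by rw [hL2]; exact le_ad
  have lc : ad M (√(c:ℝ)) ≤ L := by rw [hL3]; exact le_ad
  have ma := la mem_ad
  have mb := lb mem_ad
  have mc := lc mem_ad
  have hrel := sqrt_rel habc
  have htr : (t:ℝ) ≠ 0 := by exact_mod_cast ht
  have hbr : √(b:ℝ) ≠ 0 := by rw [Real.sqrt_ne_zero']; exact_mod_cast Nat.pos_of_ne_zero hb0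
  obtain ⟨σ₁, q1, b1⟩ := quad_mk hL la (sqrt_sq_mem _ b) mb (fun h => by
    rcases notin (sqrt_sq_mem M a) (sqrt_sq_mem M b) h with h | h | h
    · exact ha h
    · exact hb h
    · exact hab h)
  obtain ⟨σ₂, q2, a2⟩ := quad_mk hL2 lb (sqrt_sq_mem _ a) ma (fun h => by
    rcases notin (sqrt_sq_mem M b) (sqrt_sq_mem M a) h with h | h | h
    · exact hb h
    · exact ha h
    · exact hab (by rwa [mul_comm]))
  have a1 : σ₁ ⟨√(a:ℝ), ma⟩ = ⟨√(a:ℝ), ma⟩ := q1.map ⟨√(a:ℝ), mem_ad⟩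
  have b2 : σ₂ ⟨√(b:ℝ), mb⟩ = ⟨√(b:ℝ), mb⟩ := q2.map ⟨√(b:ℝ), mem_ad⟩
  have mM : M ≤ L := le_ad.trans la
  have f1 : ∀ x : M, σ₁ (inc mM x) = inc mM x := fun x => q1.map (inc le_ad x)
  have f2 : ∀ x : M, σ₂ (inc mM x) = inc mM x := fun x => q2.map (inc le_ad x)
  have e21 : ∀ x, σ₂ (σ₁ x) = σ₁ (σ₂ x) := by
    intro x
    refine hom_ext' hL la (sqrt_sq_mem _ b) mb (σ₂.comp σ₁) (σ₁.comp σ₂) ?_ ?_ x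
    · refine hom_ext' rfl le_ad (sqrt_sq_mem _ a) mem_ad ((σ₂.comp σ₁).comp (inc la)) ((σ₁.comp σ₂).comp (inc la)) ?_ ?_
      · intro y
        change σ₂ (σ₁ (inc mM y)) = σ₁ (σ₂ (inc mM y))
        rw [f1, f2, f1]
      · change σ₂ (σ₁ ⟨√(a:ℝ), ma⟩) = σ₁ (σ₂ ⟨√(a:ℝ), ma⟩)
        rw [a1, a2, map_neg, a1]
    · change σ₂ (σ₁ ⟨√(b:ℝ), mb⟩) = σ₁ (σ₂ ⟨√(b:ℝ), mb⟩)
      rw [b1, b2, map_neg, b2, b1]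
  refine ⟨σ₁, σ₂, σ₁.comp σ₂, la, lb, lc, q1, q2, ?_, fun _ => rfl, e21, fun _ => a1, fun _ => b1, fun _ => a2, fun _ => b2⟩
  refine quad_of hL3 lc (sqrt_sq_mem _ b) mb hbr (σ₁.comp σ₂) ?_ ?_
  · refine hom_ext' rfl le_ad (sqrt_sq_mem _ c) mem_ad ((σ₁.comp σ₂).comp (inc lc)) (inc lc) ?_ ?_
    · intro y
      change σ₁ (σ₂ (inc mM y)) = inc mM y
      rw [f2, f1]
    · change σ₁ (σ₂ ⟨√(c:ℝ), mc⟩) = ⟨√(c:ℝ), mc⟩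
      have : (⟨√(c:ℝ), mc⟩ : L) = ⟨√(a:ℝ), ma⟩ * ⟨√(b:ℝ), mb⟩ / (t : L) := by
        apply Subtype.ext
        push_cast
        rw [hrel]; field_simp
      rw [this]
      simp only [map_div₀, map_mul, map_natCast, a2, b2, map_neg, a1, b1]; ring
  · change σ₁ (σ₂ ⟨√(b:ℝ), mb⟩) = _
    rw [b2, b1]

section
variable {K : Type*} [Field K] [NumberField K] {L : Type*} [Field L] [NumberField L] {φ : K →+* L} {σ : L →+* L}

lemma Uq_sqrt (h : IsQuad φ σ) (h2 : (Ideal.span {((2:ℕ) : 𝓞 K)}).IsPrime) {α : L} {n : ℕ} (hα : α ^ 2 = n) (hσ : σ α = -α)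
    (hn : n % 4 = 3 ∨ n % 4 = 2) : Uq L 2 := by
  obtain ⟨b, hb, hb2⟩ := int_of_sq hα
  have hs : om σ b = - b := om_sig_eq (by rw [hb, hσ]; simp [hb])
  rcases hn with hn | hn
  · refine Uq_two h h2 (1 + b) 1 (1 - n) ?_ ?_ (by omega)
    · rw [map_add, map_one, hs]; simp [map_ofNat]; try ring
    · rw [map_add, map_one, hs]; push_cast; linear_combination -hb2
  · refine Uq_two h h2 b 0 (-n) ?_ ?_ (by omega)
    · rw [hs]; simp
    · rw [hs]; push_cast; linear_combination -hb2

lemma cl_one_of_sq {I : Id L} {x : Lˣ} (h : I ^ 2 = pr L x ^ 2) : cl L I = 1 := by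
  rw [Id_pow_inj two_ne_zero h, cl_pr]

lemma card_le_two {G : Type*} [CommGroup G] (c : G) (hc : c ^ 2 = 1) (h : ∀ H : Subgroup G, c ∈ H → H = ⊤) : Nat.card G ≤ 2 := by
  have h1 := h (Subgroup.zpowers c) (Subgroup.mem_zpowers c)
  have h2 : Nat.card (Subgroup.zpowers c) = Nat.card G := by rw [h1]; exact Subgroup.card_top
  rw [← h2, Nat.card_zpowers]
  exact orderOf_le_of_pow_eq_one two_pos hc

/-- adjoining √2: one ramified prime -/
lemma fix_two (h : IsQuad φ σ) [IsTotallyReal K] [IsTotallyReal L] (ι : L →+* ℝ) (hu : Uq K 2) {α : L} (hα : α ^ 2 = (2:ℕ)) (hσ : σ α = -α) :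
    ri φ σ ∣ 2 ∧ Nat.card (fixS (aMap σ)) ≤ Nat.card (A K) := by
  have h1 : ri φ σ ∣ 2 ^ 1 := ri_dvd h (fun P hR => ram_mem h hα hσ P hR (a := 2) (j := 2) (by norm_num)) (NP_of_Uq hu)
  have h2 := chev h ι h1
  refine ⟨by simpa using h1, ?_⟩
  have h3 : 0 < ei σ := by
    rcases Nat.eq_zero_or_pos (ei σ) with h0 | h0
    · have := ei_dvd h (ι.comp φ); rw [h0] at this; simp at this
    · exact h0
  have h4 : ri φ σ ≤ 2 := Nat.le_of_dvd two_pos (by simpa using h1)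
  have h5 : Nat.card (fixS (aMap σ)) * 2 * 1 ≤ Nat.card (fixS (aMap σ)) * 2 * ei σ := Nat.mul_le_mul_left _ h3
  have h6 : ri φ σ * Nat.card (A K) ≤ 2 * Nat.card (A K) := Nat.mul_le_mul_right _ h4
  omega

lemma fix_unram (h : IsQuad φ σ) [IsTotallyReal K] [IsTotallyReal L] (ι : L →+* ℝ) {α β : L} {r e : ℕ} (hα : α ^ 2 = r) (hσ : σ α = -α) (hr : r % 4 = 1)
    (hβ : β ^ 2 = e) (hσ' : σ β = -β) (hco : Nat.Coprime r (2 * e)) : 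
    Nat.card (fixS (aMap σ)) * 2 * ei σ = Nat.card (A K) := by
  have h1 : ri φ σ = 1 := ri_one h (fun P hR => 
    coprime_mem hR.2.1 (ram_mem' h hα hr hσ P hR) (ram_mem h hβ hσ' P hR (a := 2 * e) (j := 1) (by simp)) hco)
  have := chev h ι (t := 0) (by rw [h1]; simp)
  rw [h1, one_mul] at this; exact this

lemma range_one {G H : Type*} [CommGroup G] [CommGroup H] (f : G →* H) (h : f.ker = ⊤) : Nat.card f.range = 1 := by
  rw [MonoidHom.range_eq_bot_iff.2 (MonoidHom.ker_eq_top_iff.1 h)]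
  simp
end
end Wk

open IntermediateField NumberField
set_option linter.all false
namespace Wk
open scoped nonZeroDivisors

section
variable {K : Type*} [Field K] [NumberField K] {L : Type*} [Field L] [NumberField L] {φ : K →+* L}
/-- an ideal with I² = (n) dies when √(n·unit) is adjoined -/
lemma cap_one (φ : K →+* L) {I : Id K} {n : ℕ} (hn : n ≠ 0) (hI : I ^ 2 = pr K (nu0 K n hn)) (y : L) (u : Lˣ) (hu : u ∈ (pr L).ker)
    (hy : y ^ 2 = n * u) : aMap φ (cl K I) = 1 := by
  rw [aMap_cl]
  have hy0 : y ≠ 0 := by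
    rintro rfl
    rw [zero_pow two_ne_zero] at hy
    rcases mul_eq_zero.1 hy.symm with h | h
    · exact hn (by exact_mod_cast h)
    · exact u.ne_zero h
  apply cl_one_of_sq (x := Units.mk0 y hy0)
  rw [← map_pow, hI, iMap_pr, ← map_pow]
  have : (Units.mk0 y hy0) ^ 2 = Units.map φ.toMonoidHom (nu0 K n hn) * u := by
    apply Units.ext
    simp [hy, nu0]
  rw [this, map_mul, (MonoidHom.mem_ker).1 hu, mul_one]
end

lemma up2 {n c t : ℕ} (ht : t ≠ 0) (h : 2 * n = t ^ 2 * c) (hn : n % 4 = 3 ∨ n % 4 = 2) (h1 : ¬ IsSquare n) (h2 : ¬ IsSquare (2 * n))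
    (hk : ∀ hc : Rq c ≤ ad (Rq 2) (√(n:ℝ)), √((2:ℕ):ℝ) ∈ ad (Rq 2) (√(n:ℝ)) → Rq n ≤ ad (Rq 2) (√(n:ℝ)) → (aMap (inc hc)).ker = ⊤) :
    Nat.card (A (ad (Rq 2) (√(n:ℝ)))) ≤ Nat.card (A (Rq n)) := by
  have hn0 : n ≠ 0 := by rintro rfl; simp at h1
  obtain ⟨σ₁, σ₂, σ₃, B⟩ := biq_mk (M := Q0) (L := ad (Rq 2) (√(n:ℝ))) (a := 2) (b := n) rfl ht hn0 h
    (irr 2 (nsq_of 2 2 Nat.prime_two dvd_rfl (by norm_num))) (irr n h1) (by rw [← sqrt_mul']; exact irr _ h2)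
  obtain ⟨σ, hQ, hσ⟩ := quadR n h1
  have hu := Uq_sqrt hQ (bot_span 2 Nat.prime_two) (rt_sq n) hσ hn
  have ma := B.la mem_ad
  have f := fix_two B.q2 (rho _) hu (coe_sq 2 ma) (B.a2 ma)
  have := biq_card B.q1 B.q3 A_sqrt2 B.e12
  rw [range_one _ (hk B.lc ma B.lb), mul_one] at this
  exact this.trans f.2

section
variable {η q r s : ℕ} [Fact q.Prime] [Fact r.Prime] [Fact s.Prime]

lemma Hyp.th (h : Hyp η q r s) : ∃ θ : ℕ, η * θ = 2 := by
  rcases h.hη with h | h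
  · exact ⟨2, by rw [h]⟩
  · exact ⟨1, by rw [h]⟩

lemma Hyp.nqs (h : Hyp η q r s) {θ : ℕ} (hθ : θ = 1 ∨ θ = 2) : ¬ IsSquare (θ * q * s) ∧ ¬ IsSquare (2 * (θ * q * s)) := by
  obtain ⟨c1, c2, c3, c4, c5, c6⟩ := h.cop
  have hq := (Fact.out : q.Prime); have hs := (Fact.out : s.Prime)
  constructor
  · refine nsq_of q _ hq ⟨θ * s, by ring⟩ ?_
    rw [show θ * q * s = q * (θ * s) by ring]
    exact nsq_dvd hq (Nat.Coprime.mul_right (cop_theta hθ c4).symm c2)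
  · refine nsq_of q _ hq ⟨2 * θ * s, by ring⟩ ?_
    rw [show 2 * (θ * q * s) = q * (2 * θ * s) by ring]
    exact nsq_dvd hq (Nat.Coprime.mul_right (Nat.Coprime.mul_right c4.symm (cop_theta hθ c4).symm) c2)

lemma Hyp.nqrs (h : Hyp η q r s) {θ : ℕ} (hθ : θ = 1 ∨ θ = 2) : ¬ IsSquare (θ * q * r * s) ∧ ¬ IsSquare (2 * (θ * q * r * s)) := by
  obtain ⟨c1, c2, c3, c4, c5, c6⟩ := h.cop
  have hq := (Fact.out : q.Prime); have hs := (Fact.out : s.Prime)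
  constructor
  · refine nsq_of q _ hq ⟨θ * r * s, by ring⟩ ?_
    rw [show θ * q * r * s = q * (θ * r * s) by ring]
    exact nsq_dvd hq (Nat.Coprime.mul_right (Nat.Coprime.mul_right (cop_theta hθ c4).symm c1) c2)
  · refine nsq_of q _ hq ⟨2 * θ * r * s, by ring⟩ ?_
    rw [show 2 * (θ * q * r * s) = q * (2 * θ * r * s) by ring]
    exact nsq_dvd hq (Nat.Coprime.mul_right (Nat.Coprime.mul_right (Nat.Coprime.mul_right c4.symm (cop_theta hθ c4).symm) c1) c2)

lemma kp_card (h : Hyp η q r s) : Nat.card (A (Rq (η * q * s))) ≤ 2 := by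
  obtain ⟨I, hI, hg⟩ := smallgen h h.hη
  refine card_le_two (cl _ I) ?_ hg
  rw [← map_pow, hI, cl_pr]

lemma kp1_card (h : Hyp η q r s) : Nat.card (A (ad (Rq 2) (√((η * q * s : ℕ):ℝ)))) ≤ 2 := by
  obtain ⟨θ, hθ⟩ := h.th
  have hη0 : η ≠ 0 := by rintro rfl; omega
  obtain ⟨n1, n2⟩ := h.nqs h.hη
  refine (up2 (c := θ * q * s) hη0 (by linear_combination q * s * η * hθ.symm) (by rw [mul_assoc]; exact modθ h.hη (qs_mod h)) n1 n2 ?_).trans (kp_card h)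
  intro hc h2 _
  obtain ⟨I, hI, hg⟩ := smallgen h (comp_th h hθ)
  apply hg
  exact cap_one _ two_ne_zero hI ⟨_, h2⟩ 1 (one_mem _) (by rw [coe_sq]; simp)

lemma F1_card (h : Hyp η q r s) (hp : ∃ u : (Rq (η * q * r * s))ˣ, u ∈ (pr _).ker ∧ ∃ y : Rq (η * q * r * s), y ^ 2 = r * u ∨ y ^ 2 = s * u) : 
    Nat.card (A (ad (Rq 2) (√((η * q * r * s : ℕ):ℝ)))) ≤ Nat.card (A (Rq (η * q * r * s))) := by
  obtain ⟨θ, hθ⟩ := h.th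
  have hη0 : η ≠ 0 := by rintro rfl; omega
  obtain ⟨n1, n2⟩ := h.nqrs h.hη
  refine (up2 (c := θ * q * r * s) hη0 (by linear_combination q * s * r * η * hθ.symm) 
    (by rw [mul_assoc, mul_assoc, ← mul_assoc q]; exact modθ h.hη (qrs_mod h)) n1 n2 ?_)
  intro hc h2 hn
  obtain ⟨u, hu, y, hy⟩ := hp
  have hu' : Units.map (inc hn).toMonoidHom u ∈ (pr (ad (Rq 2) (√((η * q * r * s : ℕ):ℝ)))).ker := by
    rw [MonoidHom.mem_ker, ← iMap_pr, (MonoidHom.mem_ker).1 hu, map_one]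
  rcases hy with hy | hy
  · obtain ⟨I, R, hI, hR, hg⟩ := biggen h hθ
    apply hg
    · exact cap_one _ two_ne_zero hI ⟨_, h2⟩ 1 (one_mem _) (by rw [coe_sq]; simp)
    · refine cap_one _ (Fact.out : r.Prime).ne_zero hR (inc hn y) _ hu' ?_
      rw [← map_pow, hy]; simp
  · have hb := biggen h.swap hθ
    rw [mul_right_comm (θ * q) s r] at hb
    obtain ⟨I, R, hI, hR, hg⟩ := hb
    apply hg
    · exact cap_one _ two_ne_zero hI ⟨_, h2⟩ 1 (one_mem _) (by rw [coe_sq]; simp)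
    · refine cap_one _ (Fact.out : s.Prime).ne_zero hR (inc hn y) _ hu' ?_
      rw [← map_pow, hy]; simp

lemma k1_card (h : Hyp η q r s) : Nat.card (A (ad (Rq 2) (√(r:ℝ)))) = 1 := by
  obtain ⟨c1, c2, c3, c4, c5, c6⟩ := h.cop
  have hr := (Fact.out : r.Prime)
  obtain ⟨σ₁, σ₂, σ₃, B⟩ := biq_mk (M := Q0) (L := ad (Rq 2) (√(r:ℝ))) (a := 2) (b := r) (c := 2 * r) (t := 1) rfl one_ne_zero hr.ne_zero (by ring)
    (irr 2 (nsq_of 2 2 Nat.prime_two dvd_rfl (by norm_num)))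
    (irr r (nsq_of r r hr dvd_rfl (by simpa using nsq_dvd hr (Nat.coprime_one_right r)))) 
    (by rw [← sqrt_mul']; exact irr _ (nsq_of 2 _ Nat.prime_two ⟨r, rfl⟩ (nsq_dvd Nat.prime_two c5)))
  obtain ⟨σ, hQ, hσ, hA, -, -, hsp⟩ := kdata r h.hr8
  have ma := B.la mem_ad
  have f := fix_two B.q2 (rho _) (Uq_of_span 2 hsp two_ne_zero) (coe_sq 2 ma) (B.a2 ma)
  exact (A_triv B.q2 (rho _) hA f.1).1

/-- upper bound for `K = M(√r, √e)` -/
lemma K_card (h : Hyp η q r s) (M : IntermediateField ℚ ℝ) [NumberField M] [IsTotallyReal M] {σ₁ σ₂ σ₃}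
    (B : Biq M (ad (ad M (√(r:ℝ))) (√((η * q * s : ℕ):ℝ))) r (η * q * s) (η * q * r * s) σ₁ σ₂ σ₃)
    (hr1 : Nat.card (A (ad M (√(r:ℝ)))) = 1) (hk : Nat.card (A (ad M (√((η * q * s : ℕ):ℝ)))) ≤ 2) :
    Nat.card (A (ad (ad M (√(r:ℝ))) (√((η * q * s : ℕ):ℝ)))) ≤ Nat.card (A (ad M (√((η * q * r * s : ℕ):ℝ)))) := by
  obtain ⟨c1, c2, c3, c4, c5, c6⟩ := h.cop
  have h1 := biq_card B.q1 B.q2 hr1 B.e13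
  have h2 := fix_unram B.q3 (rho _) (coe_sq r (B.la mem_ad)) (B.a3 _) (by have := h.hr8; omega) (coe_sq (η * q * s) (B.lb mem_ad)) (B.b3 _)
    (Nat.Coprime.mul_right c5.symm (Nat.Coprime.mul_right (Nat.Coprime.mul_right (cop_theta h.hη c5).symm c1.symm) c3))
  have h3 : Nat.card (aMap (inc B.lb)).range ≤ 2 :=
    le_trans (Nat.card_le_card_of_surjective _ (MonoidHom.rangeRestrict_surjective (aMap (inc B.lb)))) hk
  have h4 : 0 < ei σ₃ := by
    rcases Nat.eq_zero_or_pos (ei σ₃) with h0 | h0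
    · have := ei_dvd B.q3 (rho _); rw [h0] at this; simp at this
    · exact h0
  calc _ ≤ _ := h1
    _ ≤ Nat.card (fixS (aMap σ₃)) * 2 := Nat.mul_le_mul_left _ h3
    _ ≤ Nat.card (fixS (aMap σ₃)) * 2 * ei σ₃ := Nat.le_mul_of_pos_right _ h4
    _ = _ := h2

lemma biqK (h : Hyp η q r s) : ∃ σ₁ σ₂ σ₃, Biq Q0 (ad (ad Q0 (√(r:ℝ))) (√((η * q * s : ℕ):ℝ))) r (η * q * s) (η * q * r * s) σ₁ σ₂ σ₃ := by
  have hr := (Fact.out : r.Prime)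
  have hn0 : η * q * s ≠ 0 := fun h0 => (h.nqs h.hη).1 (by rw [h0]; exact ⟨0, rfl⟩)
  refine biq_mk (M := Q0) (t := 1) rfl one_ne_zero hn0 (by ring)
    (irr r (nsq_of r r hr dvd_rfl (by simpa using nsq_dvd hr (Nat.coprime_one_right r)))) (irr _ (h.nqs h.hη).1) ?_
  rw [← sqrt_mul']; exact irr _ (by rw [show r * (η * q * s) = η * q * r * s by ring]; exact (h.nqrs h.hη).1)

lemma not_mem_R2 {n : ℕ} (h1 : ¬ IsSquare n) (h2 : ¬ IsSquare (2 * n)) : √(n:ℝ) ∉ Rq 2 := by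
  intro hm
  rcases notin (sqrt_sq_mem Q0 2) (sqrt_sq_mem Q0 n) hm with h | h | h
  · exact irr 2 (nsq_of 2 2 Nat.prime_two dvd_rfl (by norm_num)) h
  · exact irr n h1 h
  · rw [← sqrt_mul'] at h; exact irr _ h2 h

lemma Hyp.nr (h : Hyp η q r s) : ¬ IsSquare r ∧ ¬ IsSquare (2 * r) := by
  obtain ⟨c1, c2, c3, c4, c5, c6⟩ := h.cop
  have hr := (Fact.out : r.Prime)
  exact ⟨nsq_of r r hr dvd_rfl (by simpa using nsq_dvd hr (Nat.coprime_one_right r)), 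
    nsq_of 2 _ Nat.prime_two ⟨r, rfl⟩ (nsq_dvd Nat.prime_two c5)⟩

lemma biqK1 (h : Hyp η q r s) : ∃ σ₁ σ₂ σ₃, Biq (Rq 2) (ad (ad (Rq 2) (√(r:ℝ))) (√((η * q * s : ℕ):ℝ))) r (η * q * s) (η * q * r * s) σ₁ σ₂ σ₃ := by
  have hn0 : η * q * s ≠ 0 := fun h0 => (h.nqs h.hη).1 (by rw [h0]; exact ⟨0, rfl⟩)
  refine biq_mk (M := Rq 2) (t := 1) rfl one_ne_zero hn0 (by ring)
    (not_mem_R2 h.nr.1 h.nr.2) (not_mem_R2 (h.nqs h.hη).1 (h.nqs h.hη).2) ?_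
  rw [← sqrt_mul', show r * (η * q * s) = η * q * r * s by ring]; exact not_mem_R2 (h.nqrs h.hη).1 (h.nqrs h.hη).2

noncomputable abbrev Kf (M : IntermediateField ℚ ℝ) (r e : ℕ) := ad (ad M (√(r:ℝ))) (√(e:ℝ))

lemma K0_card (h : Hyp η q r s) : Nat.card (A (Kf Q0 r (η * q * s))) ≤ Nat.card (A (Rq (η * q * r * s))) := by
  obtain ⟨σ₁, σ₂, σ₃, B⟩ := biqK h
  obtain ⟨σ, hQ, hσ, hA, -, -, hsp⟩ := kdata r h.hr8
  exact K_card h Q0 B hA (kp_card h)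

lemma K1_card (h : Hyp η q r s) (hp : ∃ u : (Rq (η * q * r * s))ˣ, u ∈ (pr _).ker ∧ ∃ y : Rq (η * q * r * s), y ^ 2 = r * u ∨ y ^ 2 = s * u) :
    Nat.card (A (Kf (Rq 2) r (η * q * s))) ≤ Nat.card (A (Rq (η * q * r * s))) := by
  obtain ⟨σ₁, σ₂, σ₃, B⟩ := biqK1 h
  exact (K_card h (Rq 2) B (k1_card h) (kp1_card h)).trans (F1_card h hp)

end
end Wk

open IntermediateField NumberField
set_option linter.all false
namespace Wk
open scoped nonZeroDivisors

section
variable {L : Type*} [Field L] [NumberField L]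
/-- every residue is in the prime field -/
def Fr (P : Ideal (𝓞 L)) (p : ℕ) : Prop := ∀ x : 𝓞 L, x ^ p - x ∈ P

lemma Fr_step {K : Type*} [Field K] [NumberField K] {φ : K →+* L} {σ : L →+* L} (h : IsQuad φ σ) (P : Ideal (𝓞 L)) (hP : P.IsPrime)
    (p : ℕ) (hp : p.Prime) (hm : (p : 𝓞 L) ∈ P) (hK : Fr (P.comap (om φ)) p) (α : 𝓞 L) (hσ : om σ α = -α) (hα : α ^ p - α ∈ P)
    (h2 : 2 * α ∉ P) : Fr P p := by
  intro x
  haveI := Fact.mk hp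
  let π := Ideal.Quotient.mk P
  haveI hch : CharP (𝓞 L ⧸ P) p := by
    refine (CharP.charP_iff_prime_eq_zero hp).2 ?_
    have : π (p : 𝓞 L) = 0 := Ideal.Quotient.eq_zero_iff_mem.2 hm
    simpa using this
  obtain ⟨a, ha⟩ := h.fixed_int (x + om σ x) (by rw [map_add, om_inv h, add_comm])
  obtain ⟨b, hb⟩ := h.fixed_int ((x - om σ x) * α) (by rw [map_mul, map_sub, om_inv h, hσ]; ring)
  have key : ∀ y : 𝓞 L, y ^ p - y ∈ P → π y ^ p = π y := fun y hy => by
    rw [← map_pow]; exact Ideal.Quotient.eq.2 hy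
  have e1 : π (om φ a) ^ p = π (om φ a) := key _ (by have := hK a; rw [Ideal.mem_comap] at this; simpa using this)
  have e2 : π (om φ b) ^ p = π (om φ b) := key _ (by have := hK b; rw [Ideal.mem_comap] at this; simpa using this)
  have e3 := key _ hα
  have e4 : π (2 * α) * π x = π α * π (om φ a) + π (om φ b) := by
    rw [ha, hb, ← map_mul, ← map_mul, ← map_add]; congr 1; ring
  have e5 : π (2 * α) ^ p = π (2 * α) := by
    rw [two_mul, map_add, add_pow_char, e3]
  have e6 : π (2 * α) * π x ^ p = π (2 * α) * π x := by
    rw [← e5, ← mul_pow, e5, e4, add_pow_char, mul_pow, e1, e2, e3]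
  have e7 : π (2 * α) ≠ 0 := fun h0 => h2 (Ideal.Quotient.eq_zero_iff_mem.1 h0)
  have := mul_left_cancel₀ e7 e6
  rw [← map_pow] at this
  exact Ideal.Quotient.eq.1 this

lemma Fr_norm (P : Ideal (𝓞 L)) (hP : P.IsPrime) (hP0 : P ≠ ⊥)
    (p : ℕ) (hp : p.Prime) (hm : (p : 𝓞 L) ∈ P) (hF : Fr P p) : Ideal.absNorm P = p := by
  haveI := Fact.mk hp
  haveI hmax := hP.isMaximal hP0
  letI : Field (𝓞 L ⧸ P) := Ideal.Quotient.field P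
  haveI : Finite (𝓞 L ⧸ P) := Ideal.finiteQuotientOfFreeOfNeBot P hP0
  letI := Fintype.ofFinite (𝓞 L ⧸ P)
  haveI hch : CharP (𝓞 L ⧸ P) p := by
    refine (CharP.charP_iff_prime_eq_zero hp).2 ?_
    have : (Ideal.Quotient.mk P) (p : 𝓞 L) = 0 := Ideal.Quotient.eq_zero_iff_mem.2 hm
    simpa using this
  have hN : Ideal.absNorm P = Nat.card (𝓞 L ⧸ P) := by rw [Ideal.absNorm_apply, Submodule.cardQuot_apply]
  rw [hN]
  apply le_antisymm
  · have hall : ∀ x : 𝓞 L ⧸ P, x ^ p = x := by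
      intro x
      obtain ⟨y, rfl⟩ := Ideal.Quotient.mk_surjective x
      rw [← map_pow]; exact Ideal.Quotient.eq.2 (hF y)
    have h0 : (Polynomial.X ^ p - Polynomial.X : Polynomial (𝓞 L ⧸ P)) ≠ 0 := FiniteField.X_pow_card_sub_X_ne_zero _ hp.one_lt
    have hd : (Polynomial.X ^ p - Polynomial.X : Polynomial (𝓞 L ⧸ P)).natDegree = p := FiniteField.X_pow_card_sub_X_natDegree_eq _ hp.one_lt
    have hc := Polynomial.card_le_degree_of_subset_roots (p := (Polynomial.X ^ p - Polynomial.X : Polynomial (𝓞 L ⧸ P))) (Z := Finset.univ) (by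
      intro x _
      rw [Polynomial.mem_roots h0]
      simp [hall x])
    rw [hd] at hc
    rw [Nat.card_eq_fintype_card]; exact hc
  · have := (CharP.cast_eq_zero_iff (𝓞 L ⧸ P) p (Fintype.card (𝓞 L ⧸ P))).1 (by simp)
    rw [Nat.card_eq_fintype_card]
    exact Nat.le_of_dvd Fintype.card_pos this

lemma Fr_bot (P : Ideal (𝓞 Q0)) (p : ℕ) (hp : p.Prime) (hm : (p : 𝓞 Q0) ∈ P) : Fr P p := by
  intro x
  haveI := Fact.mk hp
  obtain ⟨n, rfl⟩ := bot_int x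
  have : (p : ℤ) ∣ n ^ p - n := by
    rw [← ZMod.intCast_zmod_eq_zero_iff_dvd]
    push_cast
    rw [ZMod.pow_card, sub_self]
  obtain ⟨l, hl⟩ := this
  have h3 : (n : 𝓞 Q0) ^ p - (n : 𝓞 Q0) = (p : 𝓞 Q0) * l := by
    have := congrArg (Int.cast : ℤ → 𝓞 Q0) hl
    push_cast at this; exact this
  rw [h3]; exact P.mul_mem_right _ hm

/-- √n lies in the prime field mod p when (n/p) = 1 -/
lemma Fr_sqrt (P : Ideal (𝓞 L)) (p : ℕ) [Fact p.Prime] (hp2 : p ≠ 2) (hm : (p : 𝓞 L) ∈ P) (n : ℕ) (hn : legendreSym p n = 1)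
    (α : 𝓞 L) (hα : α ^ 2 = n) : α ^ p - α ∈ P := by
  have hodd := (Fact.out : p.Prime).odd_of_ne_two hp2
  have h1 : (p : ℤ) ∣ (n : ℤ) ^ (p / 2) - 1 := by
    rw [← ZMod.intCast_zmod_eq_zero_iff_dvd]
    have := legendreSym.eq_pow p n
    rw [hn] at this
    push_cast at this ⊢
    rw [← this, sub_self]
  obtain ⟨l, hl⟩ := h1
  have h2 : (n : 𝓞 L) ^ (p / 2) - 1 = (p : 𝓞 L) * l := by
    have := congrArg (Int.cast : ℤ → 𝓞 L) hl
    push_cast at this; exact this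
  have h3 : α ^ p - α = p * (l * α) := by
    have : p = 2 * (p / 2) + 1 := (Nat.two_mul_div_two_add_one_of_odd hodd).symm
    rw [this, pow_succ, pow_mul, hα, ← this]
    linear_combination α * h2
  rw [h3]; exact P.mul_mem_right _ hm

lemma two_mul_notin (P : Ideal (𝓞 L)) (hP : P.IsPrime) (p : ℕ) [Fact p.Prime] (hp2 : p ≠ 2) (hm : (p : 𝓞 L) ∈ P) (n : ℕ) (hn : legendreSym p n = 1)
    (α : 𝓞 L) (hα : α ^ 2 = n) : 2 * α ∉ P := by
  have hp := (Fact.out : p.Prime)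
  intro h
  rcases hP.mem_or_mem h with h | h
  · exact coprime_mem hP hm (a := p) (b := 2) (by exact_mod_cast h) ((Nat.coprime_primes hp Nat.prime_two).2 hp2)
  · have h1 : (n : 𝓞 L) ∈ P := by rw [← hα]; exact P.pow_mem_of_mem h 2 two_pos
    have h2 : ¬ p ∣ n := by
      intro hd
      have : ((n : ℤ) : ZMod p) = 0 := by
        rw [ZMod.intCast_zmod_eq_zero_iff_dvd]; exact_mod_cast hd
      rw [(legendreSym.eq_zero_iff p n).2 this] at hn; omega
    exact coprime_mem hP hm h1 ((Nat.Prime.coprime_iff_not_dvd hp).2 h2)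
end

section
/-- Hensel -/
lemma padic_sqrt (l r : ℕ) [Fact l.Prime] (hl2 : l ≠ 2) (h : legendreSym l r = 1) : ∃ y : ℚ_[l], y ^ 2 = r := by
  have hr0 : ((r : ℤ) : ZMod l) ≠ 0 := fun h0 => by rw [(legendreSym.eq_zero_iff l r).2 h0] at h; omega
  obtain ⟨t, ht⟩ := (legendreSym.eq_one_iff l hr0).1 h
  obtain ⟨a, rfl⟩ := ZMod.natCast_zmod_surjective t
  have ha : ¬ (l : ℤ) ∣ 2 * a := by
    intro hd
    have h1 : ((2 * a : ℤ) : ZMod l) = 0 := (ZMod.intCast_zmod_eq_zero_iff_dvd _ _).2 hd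
    push_cast at h1
    rcases mul_eq_zero.1 h1 with h2 | h2
    · have : ((2:ℕ) : ZMod l) = 0 := by exact_mod_cast h2
      rw [ZMod.natCast_eq_zero_iff] at this
      exact hl2 ((Nat.prime_dvd_prime_iff_eq Fact.out Nat.prime_two).1 this)
    · rw [h2, mul_zero] at ht; exact hr0 ht
  have hd : (l : ℤ) ∣ a ^ 2 - r := by
    rw [← ZMod.intCast_zmod_eq_zero_iff_dvd]; push_cast at ht ⊢; rw [ht]; ring
  let F : Polynomial ℤ_[l] := Polynomial.X ^ 2 - Polynomial.C (r : ℤ_[l])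
  have e1 : ∀ z : ℤ_[l], Polynomial.aeval z F = z ^ 2 - r := fun z => by simp [F]
  have e2 : Polynomial.aeval (a : ℤ_[l]) (Polynomial.derivative F) = ((2 * a : ℤ) : ℤ_[l]) := by simp [F, one_add_one_eq_two]
  have n2 : ‖((2 * a : ℤ) : ℤ_[l])‖ = 1 := by
    refine le_antisymm (PadicInt.norm_le_one _) (not_lt.1 fun hlt => ha ?_)
    exact (PadicInt.norm_int_lt_one_iff_dvd _).1 hlt
  obtain ⟨z, hz, -⟩ := hensels_lemma (F := F) (a := (a : ℤ_[l])) (by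
    rw [e1, e2, n2, one_pow]
    have := (PadicInt.norm_int_lt_one_iff_dvd (p := l) (a ^ 2 - r : ℤ)).2 hd
    push_cast at this; exact this)
  rw [e1, sub_eq_zero] at hz
  refine ⟨z, ?_⟩
  have := congrArg (Subtype.val : ℤ_[l] → ℚ_[l]) hz
  simpa using this

lemma emb (l r : ℕ) [Fact l.Prime] (hl2 : l ≠ 2) (h : legendreSym l r = 1) (hr : ¬ IsSquare r) : Nonempty (Rq r →+* ℚ_[l]) := by
  obtain ⟨y, hy⟩ := padic_sqrt l r hl2 h
  obtain ⟨F, -⟩ := lift_hom (L := Rq r) rfl le_ad (sqrt_sq_mem Q0 r) mem_ad (irr r hr) (f0 l) y (by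
    rw [hy]
    have : (⟨(√(r:ℝ)) ^ 2, sqrt_sq_mem Q0 r⟩ : Q0) = (r : Q0) := by
      apply Subtype.ext; simp
    rw [this, map_natCast])
  exact ⟨F⟩
end
end Wk

open IntermediateField NumberField
set_option linter.all false
namespace Wk
open scoped nonZeroDivisors

section
variable {K : Type*} [Field K] [NumberField K] {L : Type*} [Field L] [NumberField L] {φ : K →+* L} {σ : L →+* L}

/-- square class ⇒ norm of ideal is norm of element, up to squares and units, when A(K) = 1 -/
lemma sq_class_rel (h : IsQuad φ σ) (hA : Nat.card (A K) = 1) (a : Id L) (w : Kˣ) (ha : nI h a = pr K w) (y : A L) (hy : cl L a = y ^ 2) :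
    ∃ (x : Lˣ) (z : Kˣ) (u : Kˣ), u ∈ (pr K).ker ∧ (x : L) * σ x = φ (w * u * z ^ 2) := by
  obtain ⟨b, rfl⟩ := cl_surj y
  have h1 : cl L (a / b ^ 2) = 1 := by rw [map_div, map_pow, hy, div_self']
  obtain ⟨n, ⟨j, hn⟩, ⟨x, hx⟩⟩ := cl_eq_one.1 h1
  have h2 : cl K (nI h b) = 1 := triv_elem hA _
  obtain ⟨n', ⟨j', hn'⟩, ⟨z, hz⟩⟩ := cl_eq_one.1 h2
  obtain ⟨v, hv⟩ := h.exists_norm (x ^ n')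
  have h3 := nI_pr h (x ^ n') v hv
  rw [map_pow, hx, map_pow, map_pow, map_div, map_pow, ha] at h3
  have h4 : pr K w * pr K (w ^ (2 * j * j' + j + j') / z ^ n) ^ 2 = pr K v := by
    rw [← h3, map_div, map_pow, map_pow, hz, hn, hn']
    generalize pr K w = W
    generalize nI h b = B
    rw [div_pow, div_pow, div_pow, mul_div_assoc']
    simp only [← pow_mul, ← pow_succ']
    congr 2 <;> ring
  rw [← map_pow, ← map_mul] at h4
  set Z := w ^ (2 * j * j' + j + j') / z ^ n
  refine ⟨x ^ n', Z, v / (w * Z ^ 2), ?_, ?_⟩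
  · rw [MonoidHom.mem_ker, map_div, h4, div_self']
  · rw [← hv]
    congr 1
    have : w * (v / (w * Z ^ 2)) * Z ^ 2 = v := by
      rw [mul_right_comm, mul_div_cancel]
    exact_mod_cast congrArg Units.val this.symm

end

section
variable {L : IntermediateField ℚ ℝ} [NumberField L] {a b c : ℕ} {σ₁ σ₂ σ₃ : L →+* L}

lemma Biq.res (B : Biq Q0 L a b c σ₁ σ₂ σ₃) {σ : Rq a →+* Rq a} (hQ : IsQuad (inc (le_ad : Q0 ≤ Rq a)) σ) (hσ : σ (rt a) = - rt a) (x : Rq a) :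
    σ₂ (inc B.la x) = inc B.la (σ x) := by
  suffices hh : (σ₂.comp (inc B.la)) x = ((inc B.la).comp σ) x by rwa [RingHom.comp_apply, RingHom.comp_apply] at hh
  refine hom_ext' (L := Rq a) rfl le_ad (sqrt_sq_mem _ a) mem_ad (σ₂.comp (inc B.la)) ((inc B.la).comp σ) ?_ ?_ x
  · intro y
    rw [RingHom.comp_apply, RingHom.comp_apply]
    have e : inc B.la (inc le_ad y) = inc B.lb (inc le_ad y) := Subtype.ext (by simp only [coe_inc, rt])
    rw [hQ.map, e, B.q2.map]
  · have e : inc B.la (rt a) = ⟨√(a:ℝ), B.la mem_ad⟩ := Subtype.ext (by simp only [coe_inc, rt])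
    rw [RingHom.comp_apply, RingHom.comp_apply]
    have e0 : (⟨√(a:ℝ), mem_ad⟩ : Rq a) = rt a := rfl
    rw [e0, hσ, map_neg, e, B.a2]

lemma Biq.res' (B : Biq Q0 L a b c σ₁ σ₂ σ₃) {σ : Rq a →+* Rq a} (hQ : IsQuad (inc (le_ad : Q0 ≤ Rq a)) σ) (hσ : σ (rt a) = - rt a) (x : Rq a) :
    σ₃ (inc B.la x) = inc B.la (σ x) := by
  rw [← B.e21, B.q1.map, B.res hQ hσ]

lemma Biq.resb (B : Biq Q0 L a b c σ₁ σ₂ σ₃) {σ : Rq b →+* Rq b} (hQ : IsQuad (inc (le_ad : Q0 ≤ Rq b)) σ) (hσ : σ (rt b) = - rt b) (x : Rq b) :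
    σ₁ (inc B.lb x) = inc B.lb (σ x) := by
  suffices hh : (σ₁.comp (inc B.lb)) x = ((inc B.lb).comp σ) x by rwa [RingHom.comp_apply, RingHom.comp_apply] at hh
  refine hom_ext' (L := Rq b) rfl le_ad (sqrt_sq_mem _ b) mem_ad (σ₁.comp (inc B.lb)) ((inc B.lb).comp σ) ?_ ?_ x
  · intro y
    rw [RingHom.comp_apply, RingHom.comp_apply]
    have e : inc B.lb (inc le_ad y) = inc B.la (inc le_ad y) := Subtype.ext (by simp only [coe_inc, rt])
    rw [hQ.map, e, B.q1.map]
  · have e : inc B.lb (rt b) = ⟨√(b:ℝ), B.lb mem_ad⟩ := Subtype.ext (by simp only [coe_inc, rt])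
    rw [RingHom.comp_apply, RingHom.comp_apply]
    have e0 : (⟨√(b:ℝ), mem_ad⟩ : Rq b) = rt b := rfl
    rw [e0, hσ, map_neg, e, B.b1]

/-- transitivity of norms -/
lemma Biq.normQ (B : Biq Q0 L a b c σ₁ σ₂ σ₃) {σ : Rq a →+* Rq a} (hQ : IsQuad (inc (le_ad : Q0 ≤ Rq a)) σ) (hσ : σ (rt a) = - rt a)
    {σ' : Rq b →+* Rq b} (hQ' : IsQuad (inc (le_ad : Q0 ≤ Rq b)) σ') (hσ' : σ' (rt b) = - rt b)
    (x : Lˣ) (z : Rq a) (hx : (x : L) * σ₁ x = inc B.la z) (t : Q0) (hz : z * σ z = inc le_ad t) : ∃ y : Rq b, y * σ' y = inc le_ad t := by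
  obtain ⟨y, hy⟩ := B.q2.exists_norm x
  refine ⟨y, (inc B.lb).injective ?_⟩
  rw [map_mul, ← B.resb hQ' hσ', hy, map_mul, B.e12]
  have h1 : inc B.la (z * σ z) = inc B.la (inc le_ad t) := by rw [hz]
  rw [map_mul, ← B.res hQ hσ, ← hx, map_mul, B.e21] at h1
  have : inc B.la (inc (le_ad : Q0 ≤ Rq a) t) = inc B.lb (inc (le_ad : Q0 ≤ Rq b) t) := Subtype.ext (by simp only [coe_inc])
  rw [← this, ← h1]; ring
end

section
variable {η q r s : ℕ} [Fact q.Prime] [Fact r.Prime] [Fact s.Prime]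

lemma Id_Q0 (a : Id Q0) (p : ℕ) (hp : p ≠ 0) (ha : aN a = p) : a = pr Q0 (nu0 Q0 p hp) := by
  obtain ⟨n, hn, ⟨x, hx⟩⟩ := cl_eq_one.1 (triv_elem A_bot (cl Q0 a))
  apply Id_pow_inj (n := n) (by rintro rfl; simp at hn)
  obtain ⟨t, ht⟩ := bot_rat (x : Q0)
  have h1 := aN_Q0 x t ht
  rw [hx, map_pow, ha] at h1
  rw [← hx, ← map_pow]
  rcases abs_choice t with h2 | h2
  · congr 1; apply Units.ext; rw [ht, ← h2, ← h1]; simp [nu0]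
  · have : x = (-1) * nu0 Q0 p hp ^ n := by
      apply Units.ext; rw [ht, ← neg_neg t, ← h2, ← h1]; simp [nu0]
    rw [this, map_mul, (MonoidHom.mem_ker).1 neg_one_ker, one_mul]

/-- exact divisibility of e = ηqs -/
lemma Hyp.e_div (h : Hyp η q r s) : q ∣ η * q * s ∧ ¬ q ^ 2 ∣ η * q * s ∧ s ∣ η * q * s ∧ ¬ s ^ 2 ∣ η * q * s := by
  obtain ⟨c1, c2, c3, c4, c5, c6⟩ := h.cop
  have hq := (Fact.out : q.Prime); have hs := (Fact.out : s.Prime)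
  refine ⟨⟨η * s, by ring⟩, ?_, ⟨η * q, by ring⟩, ?_⟩
  · rw [show η * q * s = q * (η * s) by ring]
    exact nsq_dvd hq (Nat.Coprime.mul_right (cop_theta h.hη c4).symm c2)
  · rw [show η * q * s = s * (η * q) by ring]
    exact nsq_dvd hs (Nat.Coprime.mul_right (cop_theta h.hη c6).symm c2.symm)

variable {σ₁ σ₂ σ₃ : (Kf Q0 r (η * q * s)) →+* (Kf Q0 r (η * q * s))}

lemma Q_nsq (h : Hyp η q r s) (B : Biq Q0 (Kf Q0 r (η * q * s)) r (η * q * s) (η * q * r * s) σ₁ σ₂ σ₃) (Q : Id (Kf Q0 r (η * q * s)))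
    (p : ℕ) (hQ : aN Q = p) (hp : legendreSym s p = -1) (y : A (Kf Q0 r (η * q * s))) : y ^ 2 ≠ cl _ Q := by
  intro hy
  obtain ⟨d1, d2, d3, d4⟩ := h.e_div
  obtain ⟨σ, hq, hσ⟩ := quadR (η * q * s) (h.nqs h.hη).1
  have h1 := congrArg (aNm B.q2) hy
  rw [map_pow, aNm_cl] at h1
  exact not_sq hq s p d3 d4 hp h.sm1 _ (rt_sq _) hσ (nI B.q2 Q) (by rw [aN_nI, hQ]) _ h1

lemma Q_nsq' (h : Hyp η q r s) (B : Biq Q0 (Kf Q0 r (η * q * s)) r (η * q * s) (η * q * r * s) σ₁ σ₂ σ₃) (Q : Id (Kf Q0 r (η * q * s)))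
    (p : ℕ) (hQ : aN Q = p) (hp : legendreSym s p = -1) (y : A (Kf Q0 r (η * q * s))) : y ^ 2 ≠ cl _ (Q * iMap σ₂ Q) := by
  intro hy
  obtain ⟨d1, d2, d3, d4⟩ := h.e_div
  obtain ⟨σ, hq, hσ, hA, -, hE, -⟩ := kdata r h.hr8
  obtain ⟨σ', hq', hσ'⟩ := quadR (η * q * s) (h.nqs h.hη).1
  have hp0 : p ≠ 0 := by
    rintro rfl
    rw [(legendreSym.eq_zero_iff s _).2 (by simp)] at hp; omega
  -- norm ideal is (p)
  have hn : nI B.q1 (Q * iMap σ₂ Q) = pr _ (nu0 _ p hp0) := by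
    apply nI_eq
    rw [map_mul]
    have e1 : iMap σ₁ (iMap σ₂ Q) = iMap σ₂ (iMap σ₁ Q) := by
      rw [iMap_comp, iMap_comp]
      congr 1
      rw [show σ₁.comp σ₂ = σ₂.comp σ₁ from RingHom.ext fun x => by simp [B.e12, B.e21]]
    have e2 : Q * iMap σ₂ Q * (iMap σ₁ Q * iMap σ₁ (iMap σ₂ Q)) = (Q * iMap σ₁ Q) * iMap σ₂ (Q * iMap σ₁ Q) := by
      rw [e1, map_mul]; exact mul_mul_mul_comm _ _ _ _
    rw [e2, ← iMap_nI B.q1]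
    have e3 : iMap σ₂ (iMap (inc B.la) (nI B.q1 Q)) = iMap (inc B.la) (iMap σ (nI B.q1 Q)) := by
      rw [iMap_comp, iMap_comp]
      congr 1
      rw [show σ₂.comp (inc B.la) = (inc B.la).comp σ from RingHom.ext fun x => B.res hq hσ x]
    rw [e3, ← map_mul, ← iMap_nI hq, Id_Q0 (nI hq (nI B.q1 Q)) p hp0 (by rw [aN_nI, aN_nI, hQ]), iMap_pr, iMap_pr, iMap_pr]
    exact congrArg _ (Units.ext (by simp [nu0]))
  obtain ⟨x, z, u, hu, hx⟩ := sq_class_rel B.q1 hA _ _ hn y hy.symm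
  rcases hE u hu with h1 | ⟨v, h1⟩
  · obtain ⟨t, ht0, ht⟩ := normQ_abs hq z
    obtain ⟨w, hw⟩ := B.normQ hq hσ hq' hσ' x _ hx (algebraMap ℚ Q0 ((-1:ℤ) * (p * t) ^ 2)) (by
      simp only [map_mul, map_pow]
      rw [show (inc le_ad (algebraMap ℚ Q0 t) : Rq r) = z * σ z from ht.symm]
      simp only [nu0, Units.val_mk0, map_natCast]
      have h1' : σ (u : Rq r) * u = -1 := by rw [mul_comm]; exact h1
      push_cast
      simp only [map_neg, map_one]
      linear_combination (p:Rq r)^2 * (z * σ z)^2 * h1)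
    have := nonnormQ hq' q (-1) d1 d2 h.qm1 _ (rt_sq _) hσ' w (p * t) hw
    rcases mul_eq_zero.1 this with h3 | h3
    · exact hp0 (by exact_mod_cast h3)
    · rw [h3] at ht; simp at ht
  · obtain ⟨f⟩ := emb s r (fun h0 => by have := h.hs8; omega) h.hrs h.nr.1
    have key : ∀ e : ℤ, (e = 1 ∨ e = -1) → (x : Kf Q0 r (η * q * s)) * σ₁ x = inc B.la ((e * p : ℤ) * ((v * z : (Rq r)ˣ) : Rq r) ^ 2) → False := by
      intro e he hx'
      have := nonnorm B.q1 s f (η * q * s : ℕ) (e * p) (by exact_mod_cast d3) (by exact_mod_cast d4) ?_ 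
        ⟨√((η * q * s : ℕ):ℝ), mem_ad⟩ (by rw [coe_sq]; simp) (B.b1 _) x _ hx'
      · exact (v * z).ne_zero this
      · apply (legendreSym.eq_neg_one_iff s).1
        rw [legendreSym.mul, hp]
        rcases he with rfl | rfl
        · rw [legendreSym.at_one]; rfl
        · rw [h.sm1]; rfl
    rcases h1 with h1 | h1
    · refine key 1 (Or.inl rfl) ?_
      rw [hx, h1]; congr 1; simp [nu0]; ring
    · refine key (-1) (Or.inr rfl) ?_
      rw [hx, h1]; congr 1; simp [nu0]; ring
end
end Wk

open IntermediateField NumberField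
set_option linter.all false
namespace Wk
open scoped nonZeroDivisors

lemma exists_norm_l (r s : ℕ) [Fact r.Prime] [Fact s.Prime] (hr8 : r % 8 = 5) (hs2 : s ≠ 2) (hrs : legendreSym s r = 1) : ∃ J : Id (Rq r), aN J = s := by
  obtain ⟨σ, hq, hσ, hA, -⟩ := kdata r hr8
  have hs := (Fact.out : s.Prime)
  obtain ⟨P, h1, h2, h3⟩ := exists_prime_over (L := Rq r) s hs
  obtain ⟨b, hb, hb2⟩ := int_of_sq (rt_sq r)
  have hsb : om σ b = - b := om_sig_eq (by rw [hb, hσ]; simp [hb])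
  have hF := Fr_step hq P h2 s hs h3 (Fr_bot _ s hs (comap_mem _ P s h3)) b hsb (Fr_sqrt P s hs2 h3 r hrs b hb2) (two_mul_notin P h2 s hs2 h3 r hrs b hb2)
  have hN := Fr_norm P h2 h1 s hs h3 hF
  exact ⟨idu P h1, by rw [aN_idu, hN]⟩

section
variable {η q r s : ℕ} [Fact q.Prime] [Fact r.Prime] [Fact s.Prime]
variable {σ₁ σ₂ σ₃ : (Kf Q0 r (η * q * s)) →+* (Kf Q0 r (η * q * s))}

lemma ei_one_of {K : Type*} [Field K] [NumberField K] {L : Type*} [Field L] [NumberField L] {φ : K →+* L} {σ : L →+* L} (h : IsQuad φ σ)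
    (hu : ∀ u ∈ (pr K).ker, ∃ x : L, x * σ x = φ u) : ei σ = 1 := by
  rw [ei, Subgroup.relIndex_eq_one, kerfix h]
  rintro _ ⟨u, hu1, rfl⟩
  obtain ⟨x, hx⟩ := hu u hu1
  have hx0 : x ≠ 0 := by
    rintro rfl
    rw [zero_mul] at hx
    exact (map_ne_zero φ).2 u.ne_zero hx.symm
  refine ⟨Units.mk0 x hx0, ?_⟩
  rw [nu_apply]
  exact Units.ext hx

lemma rs_norms (h : Hyp η q r s) (B : Biq Q0 (Kf Q0 r (η * q * s)) r (η * q * s) (η * q * r * s) σ₁ σ₂ σ₃) :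
    (∃ x : Kf Q0 r (η * q * s), x * σ₃ x = -1) ∧ (∃ x : Kf Q0 r (η * q * s), x * σ₃ x = (r : Kf Q0 r (η * q * s))) ∧
    (∃ x : Kf Q0 r (η * q * s), x * σ₃ x = (s : Kf Q0 r (η * q * s))) := by
  obtain ⟨σ, hq, hσ, hA, ⟨ε, hε, hε1⟩, -⟩ := kdata r h.hr8
  have key : ∀ y z : Rq r, y * σ y = z → inc B.la y * σ₃ (inc B.la y) = inc B.la z := by
    rintro y _ rfl
    rw [map_mul, B.res' hq hσ]
  refine ⟨⟨_, (key ε _ hε1).trans (by simp)⟩, ⟨_, (key (ε * rt r) r ?_).trans (by simp)⟩, ?_⟩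
  · rw [map_mul, hσ]
    linear_combination -(rt r)^2 * hε1 + rt_sq r
  · obtain ⟨J, hJ⟩ := exists_norm_l r s h.hr8 (by have := h.hs8; omega) h.hrs
    obtain ⟨n, ⟨j, hn⟩, ⟨x, hx⟩⟩ := cl_eq_one.1 (triv_elem hA (cl _ J))
    obtain ⟨t, ht, hxt⟩ := normQ_abs hq x
    rw [hx, map_pow, hJ] at ht
    have hs0 : (s : Rq r) ≠ 0 := by exact_mod_cast (Fact.out : s.Prime).ne_zero
    have hsr : ∀ ε' : Rq r, ε' * σ ε' * (x * σ x) = (s:Rq r) ^ n → ∃ y : Rq r, y * σ y = s := by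
      intro ε' he
      refine ⟨ε' * x / s ^ j, ?_⟩
      rw [map_div₀, map_mul, map_pow, map_natCast]
      rw [div_mul_div_comm, mul_mul_mul_comm, he, hn, ← pow_add, ← two_mul, pow_succ, mul_div_assoc, mul_div_cancel₀]
      exact pow_ne_zero _ hs0
    have : ∃ y : Rq r, y * σ y = s := by
      rcases abs_choice t with h2 | h2
      · refine hsr 1 ?_
        rw [hxt, ← h2, ht]; simp
      · refine hsr ε ?_
        rw [hxt, hε1, ← neg_neg t, ← h2, ht]; simp
    obtain ⟨y, hy⟩ := this
    exact ⟨_, (key y _ hy).trans (by simp)⟩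

lemma sqrt_notin_F (h : Hyp η q r s) (l : ℕ) (hl : l = r ∨ l = s) : √(l:ℝ) ∉ Rq (η * q * r * s) := by
  have hc : Nat.Coprime q l ∧ ¬ IsSquare l := by
    rcases hl with rfl | rfl
    · exact ⟨h.cop.1, h.nr.1⟩
    · exact ⟨h.cop.2.1, h.swap.nr.1⟩
  obtain ⟨c1, c2, c3, c4, c5, c6⟩ := h.cop
  have hq := (Fact.out : q.Prime)
  intro hm
  rcases notin (sqrt_sq_mem Q0 _) (sqrt_sq_mem Q0 l) hm with h1 | h1 | h1
  · exact irr _ (h.nqrs h.hη).1 h1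
  · exact irr l hc.2 h1
  · rw [← sqrt_mul'] at h1
    refine irr _ (nsq_of q _ hq ⟨η * r * s * l, by ring⟩ ?_) h1
    rw [show η * q * r * s * l = q * (η * r * s * l) by ring]
    exact nsq_dvd hq (Nat.Coprime.mul_right (Nat.Coprime.mul_right (Nat.Coprime.mul_right (cop_theta h.hη c4).symm c1) c2) hc.1)

lemma ei3 (h : Hyp η q r s) (B : Biq Q0 (Kf Q0 r (η * q * s)) r (η * q * s) (η * q * r * s) σ₁ σ₂ σ₃) 
    (hp : ∃ u : (Rq (η * q * r * s))ˣ, u ∈ (pr _).ker ∧ ∃ y : Rq (η * q * r * s), y ^ 2 = r * u ∨ y ^ 2 = s * u) : ei σ₃ = 1 := by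
  obtain ⟨⟨x₁, n₁⟩, nr, ns⟩ := rs_norms h B
  obtain ⟨u, hu, y, hy⟩ := hp
  have : ∃ l : ℕ, (l = r ∨ l = s) ∧ y ^ 2 = l * u ∧ ∃ x : Kf Q0 r (η * q * s), x * σ₃ x = (l : Kf Q0 r (η * q * s)) := by
    rcases hy with hy | hy
    · exact ⟨r, Or.inl rfl, hy, nr⟩
    · exact ⟨s, Or.inr rfl, hy, ns⟩
  obtain ⟨l, hl, hy, ⟨x, hx⟩⟩ := this
  have hl0 : l ≠ 0 := by
    rcases hl with rfl | rfl
    · exact (Fact.out : l.Prime).ne_zero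
    · exact (Fact.out : l.Prime).ne_zero
  obtain ⟨σ, hQ, hσ⟩ := quadR (η * q * r * s) (h.nqrs h.hη).1
  have hur : ((y:ℝ)) ^ 2 = l * ((u : Rq (η * q * r * s)) : ℝ) := by
    have := congrArg Subtype.val hy
    simpa using this
  have hu1 : ∀ v : (Rq (η * q * r * s))ˣ, u ≠ v ^ 2 := by
    rintro v rfl
    have hv : ((v : Rq (η * q * r * s)) : ℝ) ≠ 0 := by
      have := v.ne_zero; exact_mod_cast this
    have h1 : ((y : ℝ) / (v : Rq (η * q * r * s))) ^ 2 = l := by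
      rw [div_pow, hur]; push_cast; field_simp
    have h2 : √(l:ℝ) = |(y : ℝ) / (v : Rq (η * q * r * s))| := by rw [← h1, Real.sqrt_sq_eq_abs]
    apply sqrt_notin_F h l hl
    rw [h2]
    have h3 : (y : ℝ) / (v : Rq (η * q * r * s)) ∈ Rq (η * q * r * s) := IntermediateField.div_mem _ y.2 (v : Rq (η * q * r * s)).2
    rcases abs_choice ((y : ℝ) / (v : Rq (η * q * r * s))) with h4 | h4
    · rw [h4]; exact h3
    · rw [h4]; exact IntermediateField.neg_mem _ h3
  have hu2 : ∀ v : (Rq (η * q * r * s))ˣ, u ≠ - v ^ 2 := by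
    rintro v rfl
    have hv : ((v : Rq (η * q * r * s)) : ℝ) ≠ 0 := by
      have := v.ne_zero; exact_mod_cast this
    have h1 : (y:ℝ)^2 = - (l * ((v : Rq (η * q * r * s)) : ℝ)^2) := by
      rw [hur]; push_cast; ring
    have h2 : (0:ℝ) < l * ((v : Rq (η * q * r * s)) : ℝ)^2 := by
      have : (0:ℝ) < l := by exact_mod_cast Nat.pos_of_ne_zero hl0
      positivity
    nlinarith [sq_nonneg (y:ℝ)]
  have hl' : (l : Kf Q0 r (η * q * s)) ≠ 0 := by exact_mod_cast hl0
  have mulN : ∀ a b : Kf Q0 r (η * q * s), a * b * σ₃ (a * b) = (a * σ₃ a) * (b * σ₃ b) := fun a b => by rw [map_mul]; ring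
  have sqN : ∀ v : Rq (η * q * r * s), inc B.lc v * σ₃ (inc B.lc v) = inc B.lc (v ^ 2) := fun v => by rw [B.q3.map, map_pow, pow_two]
  have nu : (inc B.lc y * x * (l : Kf Q0 r (η * q * s))⁻¹) * σ₃ (inc B.lc y * x * (l : Kf Q0 r (η * q * s))⁻¹) = inc B.lc u := by
    rw [mulN, mulN, hx, sqN, hy]
    simp only [map_mul, map_inv₀, map_natCast]
    field_simp
  refine ei_one_of B.q3 fun w hw => ?_
  obtain ⟨v, -, hv⟩ := units4 (rho _) (finrank2 hQ) u hu hu1 hu2 w hw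
  rcases hv with rfl | rfl | rfl | rfl
  · exact ⟨_, sqN v⟩
  · refine ⟨inc B.lc v * x₁, ?_⟩
    rw [mulN, sqN, n₁]; simp
  · refine ⟨inc B.lc y * x * (l : Kf Q0 r (η * q * s))⁻¹ * inc B.lc v, (mulN (inc B.lc y * x * (l : Kf Q0 r (η * q * s))⁻¹) (inc B.lc v)).trans ?_⟩
    rw [nu, sqN, ← map_mul]; simp
  · refine ⟨inc B.lc y * x * (l : Kf Q0 r (η * q * s))⁻¹ * (inc B.lc v * x₁), (mulN (inc B.lc y * x * (l : Kf Q0 r (η * q * s))⁻¹) (inc B.lc v * x₁)).trans ?_⟩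
    rw [nu, mulN, sqN, n₁]; simp

lemma c_sq (h : Hyp η q r s) (x : A (Rq (η * q * s))) : x ^ 2 = 1 := by
  have h1 := kp_card h
  obtain ⟨n, hn⟩ := A_card (K := Rq (η * q * s))
  have h2 : Nat.card (A (Rq (η * q * s))) ∣ 2 := by
    rw [hn] at h1 ⊢
    have : n ≤ 1 := by
      by_contra hc
      have : 2 ^ 2 ≤ 2 ^ n := Nat.pow_le_pow_right two_pos (by omega)
      omega
    simpa using pow_dvd_pow 2 this
  exact orderOf_dvd_iff_pow_eq_one.1 ((orderOf_dvd_natCard x).trans h2)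

/-- order and structure at the bottom -/
lemma K0_order (h : Hyp η q r s) (B : Biq Q0 (Kf Q0 r (η * q * s)) r (η * q * s) (η * q * r * s) σ₁ σ₂ σ₃) 
    (hp : ∃ u : (Rq (η * q * r * s))ˣ, u ∈ (pr _).ker ∧ ∃ y : Rq (η * q * r * s), y ^ 2 = r * u ∨ y ^ 2 = s * u)
    (Q : Id (Kf Q0 r (η * q * s))) (p : ℕ) (hQ : aN Q = p) (hsp : legendreSym s p = -1) :
    Nat.card (A (Kf Q0 r (η * q * s))) = Nat.card (A (Rq (η * q * r * s))) ∧ (cl _ (Q * iMap σ₂ Q)) ^ 2 = 1 := by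
  obtain ⟨c1, c2, c3, c4, c5, c6⟩ := h.cop
  obtain ⟨σ, hQ', hσ, hA, -⟩ := kdata r h.hr8
  have hc := Q_nsq' h B Q p hQ hsp
  have e1 : cl _ (Q * iMap σ₂ Q) = aMap (inc B.lb) (aNm B.q2 (cl _ Q)) := by
    rw [aMap_aNm, map_mul, aMap_cl]
  constructor
  · apply le_antisymm (K0_card h)
    have h2 := fix_unram B.q3 (rho _) (coe_sq r (B.la mem_ad)) (B.a3 _) (by have := h.hr8; omega) (coe_sq (η * q * s) (B.lb mem_ad)) (B.b3 _)
      (Nat.Coprime.mul_right c5.symm (Nat.Coprime.mul_right (Nat.Coprime.mul_right (cop_theta h.hη c5).symm c1.symm) c3))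
    rw [ei3 h B hp, mul_one] at h2
    rw [← h2, ← card_fix_psi (aMap σ₃)]
    apply Nat.mul_le_mul_left
    by_contra hlt
    have h3 : Nat.card (psi (aMap σ₃)).range = 1 := by
      have : 0 < Nat.card (psi (aMap σ₃)).range := Nat.card_pos
      omega
    have h4 : (psi (aMap σ₃)).range = ⊥ := Subgroup.card_eq_one.1 h3
    have h5 : psi (aMap σ₃) (cl _ Q) ∈ (psi (aMap σ₃)).range := ⟨_, rfl⟩
    rw [h4, Subgroup.mem_bot, biq B.q1 B.q2 hA B.e13, ← e1] at h5
    exact hc 1 (by rw [h5, one_pow])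
  · rw [e1, ← map_pow, c_sq h, map_one]
end
end Wk

open IntermediateField NumberField
set_option linter.all false
namespace Wk
open scoped nonZeroDivisors

section
variable {K L : Type*} [Field K] [NumberField K] [Field L] [NumberField L] {φ : K →+* L} {σ : L →+* L}

lemma ei_two' (h : IsQuad φ σ) [IsTotallyReal K] (ι : K →+* ℝ) (u : Kˣ) (hu : u ∈ (pr K).ker)
    (hn : ∀ x : L, x * σ x ≠ φ u) : 2 ∣ ei σ := by
  have h1 := ei_dvd h ι
  obtain ⟨k, -, hk⟩ := (Nat.dvd_prime_pow Nat.prime_two).1 h1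
  rcases Nat.eq_zero_or_pos k with rfl | hk0
  · exfalso
    obtain ⟨x, hx⟩ := ei_norm h (by simpa using hk) u hu
    exact hn x hx.symm
  · rw [hk]; exact dvd_pow_self 2 hk0.ne'

lemma ei_four (h : IsQuad φ σ) [IsTotallyReal K] (ι : K →+* ℝ) (u : Kˣ) (hu : u ∈ (pr K).ker)
    (hn1 : ∀ x : L, x * σ x ≠ -1) (hn : ∀ x : L, x * σ x ≠ φ u) (hn' : ∀ x : L, x * σ x ≠ - φ u) : 4 ∣ ei σ := by
  have h1 := ei_dvd h ι
  obtain ⟨k, -, hk⟩ := (Nat.dvd_prime_pow Nat.prime_two).1 h1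
  by_cases hk2 : 2 ≤ k
  · rw [hk]; exact pow_dvd_pow 2 hk2
  exfalso
  have h2 := ei_two h ι hn1
  have h3 : ei σ = 2 := by
    have : k = 0 ∨ k = 1 := by omega
    rcases this with rfl | rfl
    · rw [hk] at h2; norm_num at h2
    · simpa using hk
  rw [ei, kerfix h] at h3
  have key : ∀ w : Kˣ, ∀ hw : w ∈ (pr K).ker, (∀ x : L, x * σ x ≠ φ w) → 
     (⟨Units.map φ.toMonoidHom w, ⟨w, hw, rfl⟩⟩ : (pr K).ker.map (Units.map φ.toMonoidHom)) ∉ (nu (um σ)).range.subgroupOf ((pr K).ker.map (Units.map φ.toMonoidHom)) := by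
    rintro w hw hx hmem
    rw [Subgroup.mem_subgroupOf] at hmem
    obtain ⟨x, hx'⟩ := hmem
    rw [nu_apply] at hx'
    exact hx x (congrArg Units.val hx')
  have a1 := key (-1) neg_one_ker (by simpa using hn1)
  have a2 := key u hu hn
  have a3 := key (-1 * u) (mul_mem neg_one_ker hu) (by simpa using hn')
  apply a3
  have h4 := (Subgroup.mul_mem_iff_of_index_two h3 (a := ⟨Units.map φ.toMonoidHom (-1), ⟨-1, neg_one_ker, rfl⟩⟩) (b := ⟨Units.map φ.toMonoidHom u, ⟨u, hu, rfl⟩⟩)).2 (by tauto)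
  convert h4 using 1
  apply Subtype.ext
  simp only [Subgroup.coe_mul, map_mul]
end

section
variable {η q r s : ℕ} [Fact q.Prime] [Fact r.Prime] [Fact s.Prime]
variable {σ₁ σ₂ σ₃ : (Kf Q0 r (η * q * s)) →+* (Kf Q0 r (η * q * s))}

lemma K0_rank (h : Hyp η q r s) (B : Biq Q0 (Kf Q0 r (η * q * s)) r (η * q * s) (η * q * r * s) σ₁ σ₂ σ₃) :
    Nat.card (sq (X := A (Kf Q0 r (η * q * s)))).ker ≤ 4 := by
  obtain ⟨σ, hQ, hσ, hA, ⟨ε, hε, hε1⟩, -, h2p⟩ := kdata r h.hr8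
  obtain ⟨σ', hQ', hσ'⟩ := quadR (η * q * s) (h.nqs h.hη).1
  obtain ⟨d1, d2, d3, d4⟩ := h.e_div
  have hq := (Fact.out : q.Prime)
  have hs := (Fact.out : s.Prime)
  have hram : ∀ P, Ram (inc B.la) σ₁ P → ((2 * q * s : ℕ) : 𝓞 (Kf Q0 r (η * q * s))) ∈ P := fun P hR => 
    ram_mem B.q1 (coe_sq (η * q * s) (B.lb mem_ad)) (B.b1 _) P hR (j := 2) (by
      rcases h.hη with rfl | rfl
      · exact ⟨2 * q * s, by ring⟩
      · exact ⟨q * s, by ring⟩)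
  have hnon : ∀ e : Rq r, e * σ e = -1 → ∀ x : Kf Q0 r (η * q * s), x * σ₁ x ≠ inc B.la e := by
    intro e he x hx
    have he0 : e ≠ 0 := by rintro rfl; simp at he
    have hx0 : x ≠ 0 := by
      rintro rfl
      rw [zero_mul] at hx
      exact he0 ((map_eq_zero (inc B.la)).1 hx.symm)
    obtain ⟨y, hy⟩ := B.normQ hQ hσ hQ' hσ' (Units.mk0 x hx0) e hx (-1) (by rw [he]; simp)
    exact m1_nonnorm hQ' q d1 d2 h.qm1 _ (rt_sq _) hσ' y (by rw [hy]; simp)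
  have n2 : NP (Rq r) 2 1 := NP_of_Uq (Uq_of_span 2 h2p two_ne_zero)
  have ns : NP (Rq r) s 2 := NP_quad hQ (NP_bot s hs)
  have hε2 : ((-ε : (Rq r)ˣ) : Rq r) * σ ((-ε : (Rq r)ˣ) : Rq r) = -1 := by
    simpa using hε1
  rcases h.hη with hη | hη
  · have nq : NP (Rq r) q 2 := NP_quad hQ (NP_bot q hq)
    have h1 := ri_dvd B.q1 hram (NP_mul (NP_mul n2 nq) ns)
    have h2 := two_rank B.q1 (rho _) hA h1
    obtain ⟨f⟩ := emb q r (by have := h.hq4; omega) (by rw [h.rq_leg, hη]; simp [ze]) h.nr.1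
    obtain ⟨k, hk⟩ := ei_four B.q1 (rho _) ε hε (fun x hx => by
      have := nonnorm B.q1 q f ((η * q * s : ℕ) : ℤ) (-1) (by exact_mod_cast d1) (by exact_mod_cast d2) 
        (by have := (legendreSym.eq_neg_one_iff q (a := -1)).1 h.qm1
            exact this) ⟨√((η * q * s : ℕ):ℝ), B.lb mem_ad⟩ (by rw [coe_sq]; push_cast; rfl) (B.b1 _) x 1 (by rw [hx]; simp)
      exact one_ne_zero this) (hnon _ hε1) (fun x hx => hnon _ hε2 x (by rw [hx]; simp))
    have h3 := Nat.le_of_dvd (by positivity) h1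
    have hk0 : 0 < k := by
      rcases Nat.eq_zero_or_pos k with rfl | h0
      · have := ei_dvd B.q1 (rho _); rw [hk] at this; simp at this
      · exact h0
    rw [← h2, hk] at h3
    have h4 : Nat.card (sq (X := A (Kf Q0 r (η * q * s)))).ker * 8 ≤ 4 * 8 := by
      refine le_trans ?_ h3
      rw [show ∀ a : ℕ, a * 2 * (4 * k) = a * 8 * k from fun a => by ring]
      exact Nat.le_mul_of_pos_right _ hk0
    exact Nat.le_of_mul_le_mul_right h4 (by norm_num)
  · have nq : NP (Rq r) q 1 := NP_of_Uq (Uq_of_span q (inert_q q r (by have := h.hq4; omega) h.cop.1 (by rw [h.rq_leg, hη]; simp [ze]) hQ) hq.ne_zero)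
    have h1 := ri_dvd B.q1 hram (NP_mul (NP_mul n2 nq) ns)
    have h2 := two_rank B.q1 (rho _) hA h1
    obtain ⟨k, hk⟩ := ei_two' B.q1 (rho _) ε hε (hnon _ hε1)
    have h3 := Nat.le_of_dvd (by positivity) h1
    have hk0 : 0 < k := by
      rcases Nat.eq_zero_or_pos k with rfl | h0
      · have := ei_dvd B.q1 (rho _); rw [hk] at this; simp at this
      · exact h0
    rw [← h2, hk] at h3
    have h4 : Nat.card (sq (X := A (Kf Q0 r (η * q * s)))).ker * 4 ≤ 4 * 4 := by
      refine le_trans ?_ h3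
      rw [show ∀ a : ℕ, a * 2 * (2 * k) = a * 4 * k from fun a => by ring]
      exact Nat.le_mul_of_pos_right _ hk0
    exact Nat.le_of_mul_le_mul_right h4 (by norm_num)
end
end Wk

open IntermediateField NumberField
set_option linter.all false
namespace Wk
open scoped nonZeroDivisors

lemma nil_group {G : Type*} [CommGroup G] [Finite G] (hp : IsPGroup 2 G) (f : G →* G) (hf : ∀ x, f (f (f (f x))) = x)
    (H : ∀ x, ∃ y, psi f x = psi f (f y) * psi f y) (x : G) : psi f x = 1 := by
  have key : ∀ x, ∃ y, psi f x = (psi f y) ^ 2 := by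
    intro x
    obtain ⟨a, ha⟩ := H x
    obtain ⟨b, hb⟩ := H a
    obtain ⟨c, hc⟩ := H b
    obtain ⟨d, hd⟩ := H c
    have comm : ∀ y, psi f (f y) = f (psi f y) := fun y => by simp only [psi_apply, map_div]
    have hf' := hf (psi f d)
    rw [comm] at ha hb hc hd
    refine ⟨d * (f d) ^ 2 * (f (f d)) ^ 3 * (f (f (f d))) ^ 2, ?_⟩
    simp only [map_mul, map_pow, comm]
    rw [ha, hb, hc, hd]
    simp only [map_mul, hf']
    generalize psi f d = u
    generalize f u = v
    generalize f v = w
    generalize f w = z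
    simp only [mul_pow, ← pow_mul]
    have : ∀ a b c d : Additive G, (a + d) + (d + c) + ((d + c) + (c + b)) + (((d + c) + (c + b)) + ((c + b) + (b + a))) = 2 • a + 4 • b + 6 • c + 4 • d := by
      intro a b c d; abel
    have e := congrArg Additive.toMul (this (Additive.ofMul u) (Additive.ofMul v) (Additive.ofMul w) (Additive.ofMul z))
    simp only [toMul_add, toMul_nsmul, toMul_ofMul] at e
    norm_num
    rw [← e]
  have key2 : ∀ k x, ∃ y, psi f x = (psi f y) ^ (2 ^ k) := by
    intro k
    induction k with
    | zero => exact fun x => ⟨x, by simp⟩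
    | succ k ih =>
      intro x
      obtain ⟨y, hy⟩ := ih x
      obtain ⟨z, hz⟩ := key y
      exact ⟨z, by rw [hy, hz, ← pow_mul, pow_succ']⟩
  obtain ⟨k, hk⟩ := (IsPGroup.iff_card (p := 2)).1 hp
  obtain ⟨y, hy⟩ := key2 k x
  rw [hy, ← hk, pow_card_eq_one']

section
variable {K L : Type*} [Field K] [NumberField K] [Field L] [NumberField L] {φ : K →+* L} {σ : L →+* L}

lemma nI_lift (h : IsQuad φ σ) (τ : L →+* L) (τ0 : K →+* K) (h1 : ∀ x, τ (φ x) = φ (τ0 x)) (h2 : ∀ x, τ (σ x) = σ (τ x)) (a : Id L) :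
    nI h (iMap τ a) = iMap τ0 (nI h a) := by
  apply nI_eq
  have e1 : φ.comp τ0 = τ.comp φ := RingHom.ext fun x => (h1 x).symm
  have e2 : σ.comp τ = τ.comp σ := RingHom.ext fun x => (h2 x).symm
  rw [iMap_comp, e1, ← iMap_comp, iMap_nI, map_mul, iMap_comp, iMap_comp, e2]

lemma aNm_lift (h : IsQuad φ σ) (τ : L →+* L) (τ0 : K →+* K) (h1 : ∀ x, τ (φ x) = φ (τ0 x)) (h2 : ∀ x, τ (σ x) = σ (τ x)) (a : A L) :
    aNm h (aMap τ a) = aMap τ0 (aNm h a) := by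
  obtain ⟨b, rfl⟩ := cl_surj a
  rw [aMap_cl, aNm_cl, aNm_cl, aMap_cl, nI_lift h τ τ0 h1 h2]

lemma psi_ker (h : IsQuad φ σ) : (psi (aMap σ)).range ≤ (aNm h).ker := by
  rintro _ ⟨x, rfl⟩
  rw [MonoidHom.mem_ker, psi_apply, map_div, aNm_sig, div_self']

/-- Fukuda, first part -/
lemma fuk1 (h : IsQuad φ σ) [IsTotallyReal K] [IsTotallyReal L] (ι : L →+* ℝ) (hu : Uq K 2)
    (hR : ∀ P, Ram φ σ P → ((2:ℕ) : 𝓞 L) ∈ P) (hs : Function.Surjective (aNm h)) :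
    Uq L 2 ∧ (aNm h).ker = (psi (aMap σ)).range := by
  have h1 : ri φ σ ∣ 2 ^ 1 := ri_dvd h hR (NP_of_Uq hu)
  have h2 := chev h ι h1
  have h3 := card_fix_psi (aMap σ)
  have h4 : Nat.card (aNm h).ker * Nat.card (A K) = Nat.card (A L) := by
    rw [Subgroup.card_eq_card_quotient_mul_card_subgroup (aNm h).ker, mul_comm, Nat.card_congr (QuotientGroup.quotientKerEquivOfSurjective _ hs).toEquiv]
  have h5 : Nat.card (psi (aMap σ)).range ≤ Nat.card (aNm h).ker := Nat.card_le_card_of_injective _ (Subgroup.inclusion_injective (psi_ker h))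
  have p1 : 0 < Nat.card (psi (aMap σ)).range := Nat.card_pos
  have p2 : 0 < Nat.card (aNm h).ker := Nat.card_pos
  have p3 : 0 < Nat.card (A K) := Nat.card_pos
  have p4 : 0 < Nat.card (fixS (aMap σ)) := Nat.card_pos
  have p5 : 0 < ei σ := by
    rcases Nat.eq_zero_or_pos (ei σ) with h0 | h0
    · have := ei_dvd h (ι.comp φ); rw [h0] at this; simp at this
    · exact h0
  have hri : ri φ σ ≤ 2 := Nat.le_of_dvd (by norm_num) h1
  have h6 : Nat.card (A K) ≤ Nat.card (fixS (aMap σ)) := by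
    by_contra hlt
    push Not at hlt
    have : Nat.card (fixS (aMap σ)) * Nat.card (psi (aMap σ)).range < Nat.card (A K) * Nat.card (aNm h).ker := 
      Nat.mul_lt_mul_of_lt_of_le hlt h5 p2
    rw [h3, ← h4, mul_comm] at this
    exact lt_irrefl _ this
  have h7 : ri φ σ = 2 := by
    refine le_antisymm hri ?_
    have : Nat.card (A K) * 2 ≤ ri φ σ * Nat.card (A K) := by
      rw [← h2]
      exact le_trans (Nat.mul_le_mul_right 2 h6) (Nat.le_mul_of_pos_right _ p5)
    rw [mul_comm] at this
    exact Nat.le_of_mul_le_mul_right this p3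
  have h8 : Nat.card (fixS (aMap σ)) ≤ Nat.card (A K) := by
    rw [h7, mul_comm 2] at h2
    have : Nat.card (fixS (aMap σ)) * 2 ≤ Nat.card (A K) * 2 := by
      rw [← h2]; exact Nat.le_mul_of_pos_right _ p5
    exact Nat.le_of_mul_le_mul_right this two_pos
  constructor
  · have : ∃ P, Ram φ σ P := by
      by_contra hc
      push Not at hc
      have := ri_one h hc
      omega
    obtain ⟨P, hP⟩ := this
    exact Uq_sig h hu ⟨P, hP.1, hP.2.1, hR P hP, hP.2.2.1⟩
  · symm
    apply Subgroup.eq_of_le_of_card_ge (psi_ker h)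
    have e : Nat.card (fixS (aMap σ)) = Nat.card (A K) := le_antisymm h8 h6
    rw [e, ← h4, mul_comm] at h3
    exact (Nat.eq_of_mul_eq_mul_right p3 h3).ge

/-- Fukuda, second part -/
lemma fuk2 (h : IsQuad φ σ) [IsTotallyReal K] [IsTotallyReal L] (ι : L →+* ℝ) (hu : Uq K 2)
    (hR : ∀ P, Ram φ σ P → ((2:ℕ) : 𝓞 L) ∈ P) (hs : Function.Surjective (aNm h))
    (τ : L →+* L) (τ0 : K →+* K) (h1 : ∀ x, τ (φ x) = φ (τ0 x)) (h2 : ∀ x, τ (τ x) = σ x)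
    (h3 : ∀ x, aMap τ0 x = x) : Function.Injective (aNm h) := by
  obtain ⟨-, hk⟩ := fuk1 h ι hu hR hs
  have e2 : ∀ x, aMap τ (aMap τ x) = aMap σ x := fun x => by
    rw [aMap_comp]; congr 2; exact RingHom.ext h2
  have key : ∀ x, ∃ y, psi (aMap τ) x = psi (aMap τ) (aMap τ y) * psi (aMap τ) y := by
    intro x
    have : psi (aMap τ) x ∈ (aNm h).ker := by
      rw [MonoidHom.mem_ker, psi_apply, map_div, aNm_lift h τ τ0 h1 (fun x => by rw [← h2, ← h2]), h3, div_self']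
    rw [hk] at this
    obtain ⟨y, hy⟩ := this
    refine ⟨y, ?_⟩
    rw [← hy]
    simp only [psi_apply, e2]
    rw [mul_comm, div_mul_div_cancel]
  have := nil_group (A_pgroup) (aMap τ) (fun x => by rw [e2, e2, aMap_sig_sig h]) key
  rw [injective_iff_map_eq_one]
  intro a ha
  have ha' : a ∈ (aNm h).ker := ha
  rw [hk] at ha'
  obtain ⟨y, rfl⟩ := ha'
  have e3 : aMap τ y = y := by
    have := this y
    rw [psi_apply, div_eq_one] at this; exact this.symm
  rw [psi_apply, ← e2, e3, e3, div_self']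
end
end Wk

open IntermediateField NumberField
set_option linter.all false
namespace Wk
open scoped nonZeroDivisors

noncomputable def xx (n : ℕ) : ℝ := 2 * Real.cos (2 * Real.pi / 2 ^ (n + 2))
noncomputable def zz (n : ℕ) : ℝ := 2 * Real.sin (2 * Real.pi / 2 ^ (n + 2))

lemma ang (n : ℕ) : 2 * Real.pi / 2 ^ (n + 2) = 2 * (2 * Real.pi / 2 ^ (n + 1 + 2)) := by
  have : (2:ℝ)^(n+1+2) = 2^(n+2)*2 := by ring
  rw [this]; field_simp

lemma xx_zero : xx 0 = 0 := by
  rw [xx, show 2 * Real.pi / 2 ^ (0 + 2) = Real.pi / 2 by norm_num; ring, Real.cos_pi_div_two, mul_zero]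

lemma zz_zero : zz 0 = 2 := by
  rw [zz, show 2 * Real.pi / 2 ^ (0 + 2) = Real.pi / 2 by norm_num; ring, Real.sin_pi_div_two, mul_one]

lemma xx_sq (n : ℕ) : xx (n + 1) ^ 2 = 2 + xx n := by
  simp only [xx]
  rw [ang n, Real.cos_two_mul]; ring

lemma xz (n : ℕ) : xx (n + 1) * zz (n + 1) = zz n := by
  simp only [xx, zz]
  rw [ang n, Real.sin_two_mul]; ring

lemma xz_sq (n : ℕ) : xx n ^ 2 + zz n ^ 2 = 4 := by
  simp only [xx, zz]
  have := Real.sin_sq_add_cos_sq (2 * Real.pi / 2 ^ (n + 2))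
  linear_combination 4 * this

lemma zz_sq (n : ℕ) : zz (n + 1) ^ 2 = 2 - xx n := by
  have := xz_sq (n+1); have := xx_sq n; linarith

lemma ang_lt (n : ℕ) : 0 < 2 * Real.pi / 2 ^ (n + 2) ∧ 2 * Real.pi / 2 ^ (n + 2) ≤ Real.pi / 2 := by
  have := Real.pi_pos
  refine ⟨by positivity, ?_⟩
  rw [div_le_div_iff₀ (by positivity) two_pos]
  have : (1:ℝ) ≤ 2 ^ n := one_le_pow₀ (by norm_num)
  rw [pow_add]; nlinarith

lemma zz_pos (n : ℕ) : 0 < zz n := by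
  obtain ⟨h1, h2⟩ := ang_lt n
  have := Real.pi_pos
  exact mul_pos two_pos (Real.sin_pos_of_pos_of_lt_pi h1 (by linarith))

lemma xx_pos (n : ℕ) : 0 < xx (n + 1) := by
  have h1 := zz_pos n
  have h2 := zz_pos (n+1)
  rw [← xz] at h1
  exact pos_of_mul_pos_left h1 h2.le

lemma xx_one : xx 1 = √((2:ℕ):ℝ) := by
  have h := xx_sq 0
  rw [xx_zero] at h
  rw [← Real.sqrt_sq (xx_pos 0).le, h]; norm_num

lemma xx_int (n : ℕ) : IsIntegral ℤ (xx n) := by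
  induction n with
  | zero => rw [xx_zero]; exact isIntegral_zero
  | succ n ih =>
    refine IsIntegral.of_pow (n := 2) two_pos ?_
    rw [xx_sq]
    exact IsIntegral.add (by simpa using isIntegral_algebraMap (R := ℤ) (A := ℝ) (x := 2)) ih

lemma zz_int (n : ℕ) : IsIntegral ℤ (zz n) := by
  have h2 : IsIntegral ℤ (2:ℝ) := by simpa using isIntegral_algebraMap (R := ℤ) (A := ℝ) (x := 2)
  cases n with
  | zero => rw [zz_zero]; exact h2
  | succ n =>
    refine IsIntegral.of_pow (n := 2) two_pos ?_
    rw [zz_sq]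
    exact IsIntegral.sub h2 (xx_int n)

/-- the tower -/
noncomputable def T (M : IntermediateField ℚ ℝ) : ℕ → IntermediateField ℚ ℝ
  | 0 => M
  | n + 1 => ad (T M n) (xx (n + 1))

section
variable (M : IntermediateField ℚ ℝ)

lemma T_succ (n : ℕ) : T M (n + 1) = ad (T M n) (xx (n + 1)) := rfl
lemma T_le (n : ℕ) : T M n ≤ T M (n + 1) := le_ad
lemma xx_T (n : ℕ) : xx n ∈ T M n := by
  cases n with
  | zero => rw [xx_zero]; exact (T M 0).zero_mem
  | succ n => exact mem_ad
lemma xx_T' (n : ℕ) : xx (n + 1) ^ 2 ∈ T M n := by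
  rw [xx_sq]; exact add_mem (by exact_mod_cast IntermediateField.natCast_mem (T M n) 2) (xx_T M n)
lemma zz_T (n : ℕ) : zz n ∈ T M n := by
  induction n with
  | zero => rw [zz_zero]; exact_mod_cast IntermediateField.natCast_mem (T M 0) 2
  | succ n ih =>
    rw [← mul_div_cancel_left₀ (zz (n+1)) (xx_pos n).ne', xz]
    exact div_mem (T_le M n ih) (xx_T M (n+1))

/-- divisibility of two -/
lemma ww (n : ℕ) : ∃ w, w ∈ T M n ∧ IsIntegral ℤ w ∧ w * zz n = 2 := by
  induction n with
  | zero => exact ⟨1, one_mem _, isIntegral_one, by rw [zz_zero]; norm_num⟩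
  | succ n ih =>
    obtain ⟨w, h1, h2, h3⟩ := ih
    exact ⟨w * xx (n+1), mul_mem (T_le M n h1) (xx_T M _), h2.mul (xx_int _), by rw [mul_assoc, xz, h3]⟩

lemma layer_eq (n : ℕ) : layer M n = T M n := by
  have hl : ∀ n, layer M n = ad M (xx n) := fun _ => rfl
  have hx : ∀ n, xx n ∈ layer M (n + 1) := fun n => by
    have h1 : xx (n+1) ∈ layer M (n + 1) := by rw [hl]; exact mem_ad
    have : xx n = xx (n+1) ^ 2 - 2 := by rw [xx_sq]; ring
    rw [this]
    exact sub_mem (pow_mem h1 2) (by exact_mod_cast IntermediateField.natCast_mem _ 2)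
  induction n with
  | zero =>
    rw [hl, xx_zero]
    exact le_antisymm (ad_le le_rfl (zero_mem _)) le_ad
  | succ n ih =>
    rw [T_succ, ← ih]
    apply le_antisymm
    · rw [hl]; exact ad_le (le_trans (by rw [hl]; exact le_ad) le_ad) mem_ad
    · refine ad_le ?_ (by rw [hl]; exact mem_ad)
      rw [hl n]; exact ad_le (by rw [hl]; exact le_ad) (hx n)

instance nf_T [NumberField M] (n : ℕ) : NumberField (T M n) := by
  induction n with
  | zero => assumption
  | succ n ih => exact nf_ad _ (xx_T' M n)

lemma T_real (n : ℕ) (f : T M n →+* ℂ) : ∃ y : ℝ, |y| ≤ 2 ∧ f ⟨xx n, xx_T M n⟩ = y := by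
  induction n with
  | zero => 
    refine ⟨0, by norm_num, ?_⟩
    rw [show (⟨xx 0, xx_T M 0⟩ : T M 0) = 0 from Subtype.ext xx_zero]; simp
  | succ n ih =>
    obtain ⟨y, hy, hf⟩ := ih (f.comp (inc (T_le M n)))
    have e : (⟨xx (n+1), xx_T M (n+1)⟩ : T M (n+1)) ^ 2 = 2 + inc (T_le M n) ⟨xx n, xx_T M n⟩ := by
      exact Subtype.ext (xx_sq n)
    have e2 := congrArg f e
    rw [map_pow, map_add, map_ofNat] at e2
    rw [RingHom.comp_apply] at hf
    rw [hf] at e2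
    have h0 : 0 ≤ 2 + y := by have := (abs_le.1 hy).1; linarith
    have h3 : (f ⟨xx (n+1), xx_T M (n+1)⟩ - (√(2 + y) : ℝ)) * (f ⟨xx (n+1), xx_T M (n+1)⟩ + (√(2 + y) : ℝ)) = 0 := by
      have : ((√(2 + y) : ℝ) : ℂ) ^ 2 = 2 + y := by
        rw [← Complex.ofReal_pow, Real.sq_sqrt h0]; push_cast; rfl
      linear_combination e2 - this
    have h4 : √(2 + y) ≤ 2 := by
      rw [Real.sqrt_le_left (by norm_num)]; have := (abs_le.1 hy).2; linarith
    rcases mul_eq_zero.1 h3 with h3 | h3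
    · exact ⟨√(2 + y), by rwa [abs_of_nonneg (Real.sqrt_nonneg _)], by linear_combination h3⟩
    · exact ⟨-√(2 + y), by rwa [abs_neg, abs_of_nonneg (Real.sqrt_nonneg _)], by push_cast; linear_combination h3⟩

instance tr_T [NumberField M] [IsTotallyReal M] (n : ℕ) : IsTotallyReal (T M n) := by
  induction n with
  | zero => assumption
  | succ n ih =>
    refine tr_ad (K := T M n) rfl (T_le M n) (xx_T' M n) (xx_T M (n+1)) ?_
    intro f
    obtain ⟨y, -, hy⟩ := T_real M (n+1) f
    rw [hy, Complex.conj_ofReal]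

lemma xx_notin [NumberField M] (h : √((2:ℕ):ℝ) ∉ M) (n : ℕ) : xx (n + 1) ∉ T M n := by
  induction n with
  | zero => rw [xx_one]; exact h
  | succ n ih =>
    intro hm
    obtain ⟨g, hg, hg1⟩ := quad_mk (K := T M n) (L := T M (n+1)) rfl (T_le M n) (xx_T' M n) (xx_T M (n+1)) ih
    set x : T M (n+1) := ⟨xx (n+1), xx_T M (n+1)⟩ with hx
    set a : T M (n+1) := ⟨xx (n+1+1), hm⟩ with ha
    set z : T M (n+1) := ⟨zz (n+1), zz_T M (n+1)⟩ with hz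
    have e1 : a ^ 2 = 2 + x := Subtype.ext (xx_sq (n+1))
    have e2 : x ^ 2 + z ^ 2 = 4 := Subtype.ext (xz_sq (n+1))
    have e3 : x * z = inc (T_le M n) ⟨zz n, zz_T M n⟩ := Subtype.ext (xz n)
    have x0 : x ≠ 0 := fun h => (xx_pos n).ne' (congrArg Subtype.val h)
    have z0 : z ≠ 0 := fun h => (zz_pos (n+1)).ne' (congrArg Subtype.val h)
    have e4 : g z = - z := by
      have := congrArg g e3
      rw [hg.map, ← e3, map_mul, hg1] at this
      have h : x * (g z + z) = 0 := by linear_combination -this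
      exact eq_neg_of_add_eq_zero_left ((mul_eq_zero.1 h).resolve_left x0)
    have e5 : (g a) ^ 2 = 2 - x := by
      rw [← map_pow, e1, map_add, hg1, map_ofNat, sub_eq_add_neg]
    have e6 : g (a * g a) = a * g a := by rw [map_mul, hg.inv, mul_comm]
    have e7 : (a * g a - z) * (a * g a + z) = 0 := by linear_combination (g a)^2 * e1 + (2 + x) * e5 - e2
    rcases mul_eq_zero.1 e7 with h | h
    · rw [sub_eq_zero.1 h, e4] at e6
      exact z0 (by have : 2 * z = 0 := by linear_combination -e6
                   simpa using this)
    · rw [eq_neg_of_add_eq_zero_left h, map_neg, e4] at e6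
      exact z0 (by have : 2 * z = 0 := by linear_combination e6
                   simpa using this)
end
end Wk

open IntermediateField NumberField
set_option linter.all false
namespace Wk
open scoped nonZeroDivisors

lemma dick_cos (θ : ℝ) (k : ℕ) : (Polynomial.dickson 1 (1:ℝ) k).eval (2 * Real.cos θ) = 2 * Real.cos (k * θ) ∧
    (Polynomial.dickson 1 (1:ℝ) (k+1)).eval (2 * Real.cos θ) = 2 * Real.cos ((k+1:ℕ) * θ) := by
  induction k with
  | zero => constructor <;> simp <;> norm_num
  | succ k ih =>
    refine ⟨ih.2, ?_⟩
    rw [Polynomial.dickson_add_two]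
    simp only [Polynomial.eval_sub, Polynomial.eval_mul, Polynomial.eval_X, Polynomial.eval_C, ih.1, ih.2]
    push_cast
    have := Real.cos_add ((k+1) * θ) θ
    have h2 := Real.cos_sub ((k+1) * θ) θ
    rw [show ((k:ℝ)+1+1) * θ = (k+1)*θ + θ by ring, show (k:ℝ) * θ = (k+1)*θ - θ by ring, this, h2]; ring

lemma dick_xx (n p : ℕ) (hp : 2 ^ (n + 2) ∣ p - 1) (hp1 : 1 ≤ p) : (Polynomial.dickson 1 (1:ℝ) p).eval (xx n) = xx n := by
  obtain ⟨t, ht⟩ := hp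
  have hp' : p = 2 ^ (n+2) * t + 1 := by omega
  rw [xx, (dick_cos _ p).1]
  congr 1
  rw [hp', show (((2 ^ (n+2) * t + 1 : ℕ) : ℝ)) * (2 * Real.pi / 2 ^ (n + 2)) = 2 * Real.pi / 2 ^ (n + 2) + t * (2 * Real.pi) by
    push_cast; field_simp; ring]
  exact Real.cos_add_nat_mul_two_pi _ _

lemma dick_mod {R : Type*} [CommRing R] (p : ℕ) [Fact p.Prime] (x : R) : ∃ y : R, (Polynomial.dickson 1 (1:R) p).eval x = x ^ p + p * y := by
  have h : (Polynomial.C (p:ℤ)) ∣ (Polynomial.dickson 1 (1:ℤ) p - Polynomial.X ^ p) := by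
    rw [Polynomial.C_dvd_iff_dvd_coeff]
    intro i
    have h1 : (Polynomial.dickson 1 (1:ℤ) p - Polynomial.X ^ p).map (Int.castRingHom (ZMod p)) = 0 := by
      rw [Polynomial.map_sub, Polynomial.map_dickson, Polynomial.map_pow, Polynomial.map_X, map_one, Polynomial.dickson_one_one_zmod_p, sub_self]
    have h2 := congrArg (fun f => f.coeff i) h1
    simp only [Polynomial.coeff_map, Polynomial.coeff_zero] at h2
    exact (ZMod.intCast_zmod_eq_zero_iff_dvd _ p).1 h2
  obtain ⟨G, hG⟩ := h
  refine ⟨(G.map (Int.castRingHom R)).eval x, ?_⟩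
  have h3 := congrArg (fun f => (f.map (Int.castRingHom R)).eval x) hG
  simp only [Polynomial.map_sub, Polynomial.map_dickson, Polynomial.map_pow, Polynomial.map_X, map_one, Polynomial.map_mul, Polynomial.map_C,
    Polynomial.eval_sub, Polynomial.eval_mul, Polynomial.eval_C, Polynomial.eval_pow, Polynomial.eval_X] at h3
  rw [sub_eq_iff_eq_add] at h3
  rw [h3]; simp [add_comm]

/-- integers from reals -/
lemma mk_int {K : IntermediateField ℚ ℝ} [NumberField K] {x : ℝ} (hx : x ∈ K) (hi : IsIntegral ℤ x) : ∃ X : 𝓞 K, (X : K) = ⟨x, hx⟩ := by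
  have : IsIntegral ℤ (⟨x, hx⟩ : K) := by
    rw [← isIntegral_algebraMap_iff (B := ℝ) (FaithfulSMul.algebraMap_injective K ℝ)]
    exact hi
  exact ⟨⟨_, this⟩, rfl⟩

section
variable (M : IntermediateField ℚ ℝ) [NumberField M]

lemma xx_frob (n p : ℕ) [Fact p.Prime] (hp : 2 ^ (n + 2) ∣ p - 1) (P : Ideal (𝓞 (T M n))) (hm : (p : 𝓞 (T M n)) ∈ P) (X : 𝓞 (T M n))
    (hX : (X : T M n) = ⟨xx n, xx_T M n⟩) : X ^ p - X ∈ P := by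
  obtain ⟨y, hy⟩ := dick_mod p X
  have hinj : Function.Injective (((T M n).val.toRingHom).comp (algebraMap (𝓞 (T M n)) (T M n))) :=
    fun a b hab => RingOfIntegers.coe_injective (Subtype.ext hab)
  have e : (Polynomial.dickson 1 (1:𝓞 (T M n)) p).eval X = X := by
    apply hinj
    have h1 : (((T M n).val.toRingHom).comp (algebraMap (𝓞 (T M n)) (T M n))) X = xx n := congrArg Subtype.val hX
    rw [← Polynomial.eval_map_apply, Polynomial.map_dickson, map_one, h1]
    exact dick_xx n p hp (Fact.out : p.Prime).one_lt.le
  rw [e] at hy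
  have : X ^ p - X = - (p * y) := by linear_combination -hy
  rw [this]
  exact neg_mem (Ideal.mul_mem_right _ _ hm)

lemma xx_dvd (n : ℕ) : ∃ X Y : 𝓞 (T M (n+1)), (X : T M (n+1)) = ⟨xx (n+1), xx_T M (n+1)⟩ ∧ X * Y = 2 := by
  obtain ⟨w, h1, h2, h3⟩ := ww M n
  obtain ⟨X, hX⟩ := mk_int (xx_T M (n+1)) (xx_int (n+1))
  obtain ⟨Y, hY⟩ := mk_int (mul_mem (T_le M n h1) (zz_T M (n+1))) (h2.mul (zz_int (n+1)))
  refine ⟨X, Y, hX, ?_⟩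
  apply RingOfIntegers.ext
  change (X : T M (n+1)) * (Y : T M (n+1)) = ((2 : 𝓞 (T M (n+1))) : T M (n+1))
  rw [hX, hY]
  apply Subtype.ext
  have : xx (n+1) * (w * zz (n+1)) = 2 := by rw [mul_left_comm, xz, h3]
  exact this

lemma T_ram (n : ℕ) {g : T M (n+1) →+* T M (n+1)} (hg : IsQuad (inc (T_le M n)) g) (hg1 : g ⟨xx (n+1), xx_T M (n+1)⟩ = - ⟨xx (n+1), xx_T M (n+1)⟩)
    (P : Ideal (𝓞 (T M (n+1)))) (hR : Ram (inc (T_le M n)) g P) : ((2:ℕ) : 𝓞 (T M (n+1))) ∈ P := by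
  obtain ⟨X, Y, hX, hXY⟩ := xx_dvd M n
  have h1 : om g X = - X := om_sig_eq (by rw [hX, hg1]; simp [hX])
  have h2 := hR.diff hg X
  rw [h1] at h2
  have h3 := Ideal.mul_mem_right Y P h2
  have h4 : (2 : 𝓞 (T M (n+1))) * 2 ∈ P := by
    have : (2 : 𝓞 (T M (n+1))) * 2 = (X - -X) * Y := by linear_combination -2 * hXY
    rwa [this]
  push_cast
  rcases hR.2.1.mem_or_mem h4 with h | h <;> exact h

lemma T_Fr (h2 : √((2:ℕ):ℝ) ∉ M) (p : ℕ) [Fact p.Prime] (hp2 : p ≠ 2)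
    (hM : ∀ P : Ideal (𝓞 M), P.IsPrime → (p : 𝓞 M) ∈ P → Fr P p) (n : ℕ) (hp : 2 ^ (n + 2) ∣ p - 1) :
    ∀ P : Ideal (𝓞 (T M n)), P.IsPrime → (p : 𝓞 (T M n)) ∈ P → Fr P p := by
  induction n with
  | zero => exact hM
  | succ n ih =>
    intro P hP hm
    obtain ⟨g, hg, hg1⟩ := quad_mk (K := T M n) (L := T M (n+1)) rfl (T_le M n) (xx_T' M n) (xx_T M (n+1)) (xx_notin M h2 n)
    obtain ⟨X, Y, hX, hXY⟩ := xx_dvd M n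
    have h1 : om g X = - X := om_sig_eq (by rw [hX, hg1]; simp [hX])
    refine Fr_step hg P hP p Fact.out hm (ih ((pow_dvd_pow 2 (by omega)).trans hp) _ (Ideal.comap_isPrime _ _) (comap_mem _ P p hm)) X h1 (xx_frob M (n+1) p hp P hm X hX) ?_
    intro h3
    have h4 : ((4:ℕ) : 𝓞 (T M (n+1))) ∈ P := by
      have : ((4:ℕ) : 𝓞 (T M (n+1))) = (2 * X) * Y := by push_cast; linear_combination -2 * hXY
      rw [this]; exact Ideal.mul_mem_right _ _ h3
    refine coprime_mem hP hm h4 ?_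
    have : Nat.Coprime p 2 := (Nat.coprime_primes Fact.out Nat.prime_two).2 hp2
    exact Nat.Coprime.mul_right this this
end
end Wk

open IntermediateField NumberField
set_option linter.all false
namespace Wk
open scoped nonZeroDivisors

section
variable {M : IntermediateField ℚ ℝ} [NumberField M] [IsTotallyReal M]

structure Dat (τ0 : M →+* M) (n : ℕ) (N : Id (T M n) →* Id M) (ν : A (T M n) →* A M) (τ : T M n →+* T M n) : Prop where
  c : ∀ a, ν (cl _ a) = cl _ (N a)
  a : ∀ a, aN (N a) = aN a
  e : ∀ a, N (iMap τ a) = iMap τ0 (N a)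
  t : τ ⟨xx n, xx_T M n⟩ = ⟨xx n, xx_T M n⟩
  b : Function.Bijective ν
  u : Uq (T M n) 2

lemma tower_lift (h2 : √((2:ℕ):ℝ) ∉ M) (n : ℕ) (τ : T M n →+* T M n) (ht : τ ⟨xx n, xx_T M n⟩ = ⟨xx n, xx_T M n⟩) :
    ∃ τ' : T M (n+1) →+* T M (n+1), (∀ x, τ' (inc (T_le M n) x) = inc (T_le M n) (τ x)) ∧ τ' ⟨xx (n+1), xx_T M (n+1)⟩ = ⟨xx (n+1), xx_T M (n+1)⟩ := by
  obtain ⟨F, h1, h3⟩ := lift_hom (K := T M n) (L := T M (n+1)) rfl (T_le M n) (xx_T' M n) (xx_T M (n+1)) (xx_notin M h2 n)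
    ((inc (T_le M n)).comp τ) ⟨xx (n+1), xx_T M (n+1)⟩ (by
      have : (⟨xx (n+1) ^ 2, xx_T' M n⟩ : T M n) = 2 + ⟨xx n, xx_T M n⟩ := Subtype.ext (xx_sq n)
      rw [this, map_add, map_ofNat, RingHom.comp_apply, ht]
      exact Subtype.ext (xx_sq n))
  exact ⟨F, h1, h3⟩

lemma step1 (h2 : √((2:ℕ):ℝ) ∉ M) (τ0 : M →+* M) 
    (hG : ∀ n, ∃ P : Id (T M n), ∀ H : Subgroup (A M), ∀ Q : Id M, aN Q = aN P → cl _ Q ∈ H → cl _ (iMap τ0 Q) ∈ H → H = ⊤)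
    (n : ℕ) {N ν τ} (D : Dat τ0 n N ν τ) {g : T M (n+1) →+* T M (n+1)} (hg : IsQuad (inc (T_le M n)) g) 
    (hg1 : g ⟨xx (n+1), xx_T M (n+1)⟩ = - ⟨xx (n+1), xx_T M (n+1)⟩) :
    Function.Surjective (aNm hg) ∧ (Function.Injective (aNm hg) → ∃ N' ν' τ', Dat τ0 (n+1) N' ν' τ') := by
  obtain ⟨τ', t1, t2⟩ := tower_lift h2 n τ D.t
  have t3 : ∀ x, τ' (g x) = g (τ' x) := hom_ext' (K := T M n) (L := T M (n+1)) rfl (T_le M n) (xx_T' M n) (xx_T M (n+1)) (τ'.comp g) (g.comp τ')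
    (fun x => by rw [RingHom.comp_apply, RingHom.comp_apply, hg.map, t1, hg.map]) 
    (by rw [RingHom.comp_apply, RingHom.comp_apply, hg1, t2, map_neg, t2, hg1])
  have c' : ∀ a, (ν.comp (aNm hg)) (cl _ a) = cl _ ((N.comp (nI hg)) a) := fun a => by
    rw [MonoidHom.comp_apply, MonoidHom.comp_apply, aNm_cl, D.c]
  have a' : ∀ a, aN ((N.comp (nI hg)) a) = aN a := fun a => by rw [MonoidHom.comp_apply, D.a, aN_nI]
  have e' : ∀ a, (N.comp (nI hg)) (iMap τ' a) = iMap τ0 ((N.comp (nI hg)) a) := fun a => by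
    rw [MonoidHom.comp_apply, MonoidHom.comp_apply, nI_lift hg τ' τ t1 t3, D.e]
  have hs : Function.Surjective (ν.comp (aNm hg)) := by
    obtain ⟨P, hP⟩ := hG (n+1)
    rw [← MonoidHom.range_eq_top]
    refine hP _ ((N.comp (nI hg)) P) (a' P) ⟨cl _ P, c' P⟩ ⟨cl _ (iMap τ' P), ?_⟩
    rw [c', e']
  have hs' : Function.Surjective (aNm hg) := by
    intro y
    obtain ⟨x, hx⟩ := hs (ν y)
    exact ⟨x, D.b.1 hx⟩
  refine ⟨hs', fun hi => ⟨N.comp (nI hg), ν.comp (aNm hg), τ', c', a', e', t2, ⟨?_, hs⟩, ?_⟩⟩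
  · exact D.b.1.comp hi
  · exact (fuk1 hg (rho _) D.u (T_ram M n hg hg1) hs').1

lemma g_triv {K L : Type*} [Field K] [NumberField K] [Field L] [NumberField L] {φ : K →+* L} {σ : L →+* L} (h : IsQuad φ σ)
   (hi : Function.Injective (aNm h)) (x : A L) : aMap σ x = x := hi (aNm_sig h x)

theorem tower (h2 : √((2:ℕ):ℝ) ∉ M) (τ0 : M →+* M) 
    (hG : ∀ n, ∃ P : Id (T M n), ∀ H : Subgroup (A M), ∀ Q : Id M, aN Q = aN P → cl _ Q ∈ H → cl _ (iMap τ0 Q) ∈ H → H = ⊤)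
    (hU : Uq M 2) (h1 : Nat.card (A (T M 1)) ≤ Nat.card (A M)) (n : ℕ) : 
    (∃ N ν τ, Dat τ0 (n+1) N ν τ) ∧ ∃ g : T M (n+1) →+* T M (n+1), IsQuad (inc (T_le M n)) g ∧
      g ⟨xx (n+1), xx_T M (n+1)⟩ = - ⟨xx (n+1), xx_T M (n+1)⟩ ∧ ∀ x, aMap g x = x := by
  induction n with
  | zero =>
    have D : Dat τ0 0 (MonoidHom.id (Id M)) (MonoidHom.id (A M)) τ0 := by
      refine ⟨fun _ => rfl, fun _ => rfl, fun _ => rfl, ?_, Function.bijective_id, hU⟩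
      rw [show (⟨xx 0, xx_T M 0⟩ : T M 0) = 0 from Subtype.ext xx_zero]
      exact map_zero τ0
    obtain ⟨g, hg, hg1⟩ := quad_mk (K := T M 0) (L := T M (0+1)) rfl (T_le M 0) (xx_T' M 0) (xx_T M (0+1)) (xx_notin M h2 0)
    obtain ⟨hs, hD⟩ := step1 h2 τ0 hG 0 D hg hg1
    have hi : Function.Injective (aNm hg) := by
      have := Function.Surjective.bijective_of_nat_card_le hs h1
      exact this.1
    exact ⟨hD hi, g, hg, hg1, g_triv hg hi⟩
  | succ n ih =>
    obtain ⟨⟨N, ν, τ, D⟩, g, hg, hg1, hgt⟩ := ih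
    obtain ⟨g', hg', hg1'⟩ := quad_mk (K := T M (n+1)) (L := T M (n+1+1)) rfl (T_le M (n+1)) (xx_T' M (n+1)) (xx_T M (n+1+1)) (xx_notin M h2 (n+1))
    obtain ⟨hs, hD⟩ := step1 h2 τ0 hG (n+1) D hg' hg1'
    set x : T M (n+1) := ⟨xx (n+1), xx_T M (n+1)⟩ with hx
    set z : T M (n+1) := ⟨zz (n+1), zz_T M (n+1)⟩ with hz
    have e3 : x * z = inc (T_le M n) ⟨zz n, zz_T M n⟩ := Subtype.ext (xz n)
    have x0 : x ≠ 0 := fun h => (xx_pos n).ne' (congrArg Subtype.val h)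
    have e4 : g z = - z := by
      have := congrArg g e3
      rw [hg.map, ← e3, map_mul, hg1] at this
      have h : x * (g z + z) = 0 := by linear_combination -this
      exact eq_neg_of_add_eq_zero_left ((mul_eq_zero.1 h).resolve_left x0)
    obtain ⟨F, f1, f2⟩ := lift_hom (K := T M (n+1)) (L := T M (n+1+1)) rfl (T_le M (n+1)) (xx_T' M (n+1)) (xx_T M (n+1+1)) (xx_notin M h2 (n+1))
      ((inc (T_le M (n+1))).comp g) ⟨zz (n+1+1), zz_T M (n+1+1)⟩ (by
        have : (⟨xx (n+1+1) ^ 2, xx_T' M (n+1)⟩ : T M (n+1)) = 2 + x := Subtype.ext (xx_sq (n+1))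
        rw [this, map_add, map_ofNat, RingHom.comp_apply, hg1, map_neg]
        apply Subtype.ext
        have := zz_sq (n+1)
        rw [sub_eq_add_neg] at this
        exact this)
    have f3 : ∀ x, F (F x) = g' x := by
      refine hom_ext' (K := T M (n+1)) (L := T M (n+1+1)) rfl (T_le M (n+1)) (xx_T' M (n+1)) (xx_T M (n+1+1)) (F.comp F) g' (fun x => ?_) ?_
      · rw [RingHom.comp_apply, f1, RingHom.comp_apply, f1, RingHom.comp_apply, hg.inv, hg'.map]
      · rw [RingHom.comp_apply, f2, hg1']
        set X : T M (n+1+1) := ⟨xx (n+1+1), xx_T M (n+1+1)⟩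
        set Z : T M (n+1+1) := ⟨zz (n+1+1), zz_T M (n+1+1)⟩
        have e5 : X * Z = inc (T_le M (n+1)) z := Subtype.ext (xz (n+1))
        have e6 := congrArg F e5
        rw [map_mul, f2, f1, RingHom.comp_apply, e4, map_neg, ← e5] at e6
        have Z0 : Z ≠ 0 := fun h => (zz_pos (n+1+1)).ne' (congrArg Subtype.val h)
        apply mul_left_cancel₀ Z0
        rw [e6]; ring
    have hi := fuk2 hg' (rho _) D.u (T_ram M (n+1) hg' hg1') hs F g f1 f3 hgt
    exact ⟨hD hi, g', hg', hg1', g_triv hg' hi⟩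
end
end Wk

open IntermediateField NumberField
set_option linter.all false
namespace Wk
open scoped nonZeroDivisors

lemma exists_nonres (q : ℕ) [Fact q.Prime] (hq : q ≠ 2) : ∃ a : ℕ, legendreSym q a = -1 := by
  obtain ⟨x, hx⟩ := FiniteField.exists_nonsquare (F := ZMod q) (by rwa [ZMod.ringChar_zmod_n])
  refine ⟨x.val, (legendreSym.eq_neg_one_iff q).2 ?_⟩
  simpa using hx

lemma leg_congr (q : ℕ) [Fact q.Prime] {a b : ℕ} (h : a ≡ b [MOD q]) : legendreSym q a = legendreSym q b := by
  rw [legendreSym.mod q a, legendreSym.mod q b]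
  congr 1
  exact_mod_cast h

section
variable {η q r s : ℕ} [Fact q.Prime] [Fact r.Prime] [Fact s.Prime]

lemma dir (h : Hyp η q r s) (N : ℕ) : ∃ p : ℕ, ∃ _ : Fact p.Prime, p ≠ 2 ∧ 2 ^ (N + 3) ∣ p - 1 ∧ legendreSym p r = 1 ∧
    legendreSym p (η * q * s : ℕ) = 1 ∧ legendreSym s p = -1 := by
  obtain ⟨c1, c2, c3, c4, c5, c6⟩ := h.cop
  have hq2 : q ≠ 2 := by have := h.hq4; omega
  have hr2 : r ≠ 2 := by have := h.hr8; omega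
  have hs2 : s ≠ 2 := by have := h.hs8; omega
  obtain ⟨a, ha⟩ := exists_nonres q hq2
  obtain ⟨b, hb⟩ := exists_nonres s hs2
  have nd : ∀ (l x : ℕ) [Fact l.Prime], legendreSym l x = -1 → Nat.Coprime l x := by
    intro l x _ hx
    rw [Nat.Prime.coprime_iff_not_dvd Fact.out]
    intro hd
    have : legendreSym l x = 0 := (legendreSym.eq_zero_iff l x).2 (by exact_mod_cast (ZMod.natCast_eq_zero_iff x l).2 hd)
    omega
  have k1 : Nat.Coprime (2 ^ (N+3)) r := Nat.Coprime.pow_left _ c5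
  obtain ⟨u, hu1, hu2⟩ := Nat.chineseRemainder k1 1 1
  have k2 : Nat.Coprime (2 ^ (N+3) * r) q := Nat.Coprime.mul_left (Nat.Coprime.pow_left _ c4) c1.symm
  obtain ⟨v, hv1, hv2⟩ := Nat.chineseRemainder k2 u a
  have k3 : Nat.Coprime (2 ^ (N+3) * r * q) s := Nat.Coprime.mul_left (Nat.Coprime.mul_left (Nat.Coprime.pow_left _ c6) c3) c2
  obtain ⟨w, hw1, hw2⟩ := Nat.chineseRemainder k3 v b
  have w2 : w ≡ 1 [MOD 2 ^ (N+3)] := ((hw1.of_mul_right _).of_mul_right _).trans ((hv1.of_mul_right _).trans hu1)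
  have wr : w ≡ 1 [MOD r] := ((hw1.of_mul_right _).of_mul_left _).trans ((hv1.of_mul_left _).trans hu2)
  have wq : w ≡ a [MOD q] := (hw1.of_mul_left _).trans hv2
  have ws : w ≡ b [MOD s] := hw2
  have lr1 : legendreSym r w = 1 := by rw [leg_congr r wr]; simp
  have lq1 : legendreSym q w = -1 := by rw [leg_congr q wq, ha]
  have ls1 : legendreSym s w = -1 := by rw [leg_congr s ws, hb]
  have cw : Nat.Coprime w (2 ^ (N+3) * r * q * s) := by
    refine Nat.Coprime.mul_right (Nat.Coprime.mul_right (Nat.Coprime.mul_right ?_ ?_) (nd q w lq1).symm) (nd s w ls1).symm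
    · rw [Nat.Coprime, w2.gcd_eq]; simp
    · rw [Nat.Coprime, wr.gcd_eq]; simp
  have hne : 2 ^ (N+3) * r * q * s ≠ 0 := by
    have := (Fact.out : q.Prime).pos; have := (Fact.out : r.Prime).pos; have := (Fact.out : s.Prime).pos
    positivity
  obtain ⟨p, hpg, hp, hpw⟩ := Nat.forall_exists_prime_gt_and_modEq (q + r + s + 2) hne cw
  have p2 : p ≡ 1 [MOD 2 ^ (N+3)] := (((hpw.of_mul_right _).of_mul_right _).of_mul_right _).trans w2
  have pr' : legendreSym r p = 1 := by rw [leg_congr r (((hpw.of_mul_right _).of_mul_right _).of_mul_left _), lr1]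
  have pq' : legendreSym q p = -1 := by rw [leg_congr q ((hpw.of_mul_right _).of_mul_left _), lq1]
  have ps' : legendreSym s p = -1 := by rw [leg_congr s (hpw.of_mul_left _), ls1]
  have : Fact p.Prime := ⟨hp⟩
  have hp2 : p ≠ 2 := by omega
  have p8 : p % 8 = 1 := by
    have : p ≡ 1 [MOD 8] := p2.of_dvd (by rw [show 8 = 2 ^ 3 by norm_num]; exact pow_dvd_pow 2 (by omega))
    exact this
  have hdvd : 2 ^ (N+3) ∣ p - 1 := (Nat.modEq_iff_dvd' hp.one_lt.le).1 p2.symm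
  have rec' : ∀ (l : ℕ) [Fact l.Prime], l ≠ 2 → legendreSym p l = legendreSym l p := fun l _ hl =>
    (legendreSym.quadratic_reciprocity_one_mod_four (p := p) (q := l) (by omega) hl).symm
  refine ⟨p, this, hp2, hdvd, by rw [rec' r hr2, pr'], ?_, ps'⟩
  push_cast
  rw [legendreSym.mul, legendreSym.mul, rec' q hq2, rec' s hs2, pq', ps']
  rcases h.hη with rfl | rfl
  · simp
  · have : legendreSym p 2 = 1 := by
      rw [legendreSym.at_two hp2, ZMod.χ₈_nat_mod_eight, p8]; decide
    push_cast; rw [this]; norm_num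

variable {σ₁ σ₂ σ₃ : (Kf Q0 r (η * q * s)) →+* (Kf Q0 r (η * q * s))}

lemma K0_Fr (h : Hyp η q r s) (B : Biq Q0 (Kf Q0 r (η * q * s)) r (η * q * s) (η * q * r * s) σ₁ σ₂ σ₃) (p : ℕ) [Fact p.Prime] (hp2 : p ≠ 2)
    (h1 : legendreSym p r = 1) (h2 : legendreSym p (η * q * s : ℕ) = 1) (P : Ideal (𝓞 (Kf Q0 r (η * q * s)))) (hP : P.IsPrime)
    (hm : (p : 𝓞 (Kf Q0 r (η * q * s))) ∈ P) : Fr P p := by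
  obtain ⟨σ, hq, hσ, hA, -⟩ := kdata r h.hr8
  have hp := (Fact.out : p.Prime)
  have F1 : ∀ P : Ideal (𝓞 (Rq r)), P.IsPrime → (p : 𝓞 (Rq r)) ∈ P → Fr P p := by
    intro P hP hm
    obtain ⟨b, hb, hb2⟩ := int_of_sq (rt_sq r)
    have hsb : om σ b = - b := om_sig_eq (by rw [hb, hσ]; simp [hb])
    exact Fr_step hq P hP p hp hm (Fr_bot _ p hp (comap_mem _ P p hm)) b hsb (Fr_sqrt P p hp2 hm r h1 b hb2) (two_mul_notin P hP p hp2 hm r h1 b hb2)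
  obtain ⟨b, hb, hb2⟩ := int_of_sq (coe_sq (η * q * s) (B.lb mem_ad))
  have hsb : om σ₁ b = - b := om_sig_eq (by rw [hb, B.b1]; simp [hb])
  exact Fr_step B.q1 P hP p hp hm (F1 _ (Ideal.comap_isPrime _ _) (comap_mem _ P p hm)) b hsb (Fr_sqrt P p hp2 hm _ h2 b hb2)
    (two_mul_notin P hP p hp2 hm _ h2 b hb2)

lemma two_notin (h : Hyp η q r s) : √((2:ℕ):ℝ) ∉ Kf Q0 r (η * q * s) := by
  obtain ⟨c1, c2, c3, c4, c5, c6⟩ := h.cop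
  have n2 : ¬ IsSquare 2 := by
    rintro ⟨x, hx⟩
    have : x < 2 := by nlinarith
    interval_cases x <;> omega
  have e1 := h.nqs h.hη
  have e2 := h.nqrs h.hη
  have e3 := h.nr
  have key : ∀ n : ℕ, ¬ IsSquare n → ¬ IsSquare (r * n) → √(n:ℝ) ∉ Rq r := by
    intro n h1 h2 hm
    rcases notin (sqrt_sq_mem Q0 r) (sqrt_sq_mem Q0 n) hm with h3 | h3 | h3
    · exact irr r e3.1 h3
    · exact irr n h1 h3
    · rw [← sqrt_mul'] at h3; exact irr _ h2 h3
  intro hm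
  rcases notin (sqrt_sq_mem (Rq r) (η * q * s)) (sqrt_sq_mem (Rq r) 2) hm with h3 | h3 | h3
  · exact key _ e1.1 (by rw [show r * (η * q * s) = η * q * r * s by ring]; exact e2.1) h3
  · exact key 2 n2 (by rw [mul_comm]; exact e3.2) h3
  · rw [← sqrt_mul'] at h3
    exact key _ (by rw [mul_comm]; exact e1.2) (by rw [show r * (η * q * s * 2) = 2 * (η * q * r * s) by ring]; exact e2.2) h3

lemma A_congr {F G : IntermediateField ℚ ℝ} [NumberField F] [NumberField G] (h : F = G) : Nat.card (A F) = Nat.card (A G) := by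
  subst h; rfl

lemma T_one_eq (r e : ℕ) : T (Kf Q0 r e) 1 = Kf (Rq 2) r e := by
  rw [T_succ, xx_one]
  change ad (Kf Q0 r e) _ = _
  simp only [Kf, Rq, ad]
  rw [sup_right_comm, sup_right_comm Q0]

lemma K0_eq (r e : ℕ) : adjoin ℚ {√(r:ℝ), √(e:ℝ)} = Kf Q0 r e := by
  simp only [Kf, Q0, ad, bot_sup_eq]
  rw [← adjoin_union]; rfl
end
end Wk

open IntermediateField NumberField
set_option linter.all false
namespace Wk
open scoped nonZeroDivisors

section
variable {η q r s : ℕ} [Fact q.Prime] [Fact r.Prime] [Fact s.Prime]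
variable {σ₁ σ₂ σ₃ : (Kf Q0 r (η * q * s)) →+* (Kf Q0 r (η * q * s))}

lemma prime_T (h : Hyp η q r s) (B : Biq Q0 (Kf Q0 r (η * q * s)) r (η * q * s) (η * q * r * s) σ₁ σ₂ σ₃) (n : ℕ) :
    ∃ P : Id (T (Kf Q0 r (η * q * s)) n), ∃ p : ℕ, aN P = p ∧ legendreSym s p = -1 := by
  obtain ⟨p, hpf, hp2, hpd, h1, h2, h3⟩ := dir h n
  obtain ⟨P, hP0, hP, hm⟩ := exists_prime_over (L := T (Kf Q0 r (η * q * s)) n) p hpf.out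
  have hF := T_Fr _ (two_notin h) p hp2 (fun P hP hm => K0_Fr h B p hp2 h1 h2 P hP hm) n
    ((pow_dvd_pow 2 (by omega)).trans hpd) P hP hm
  refine ⟨idu P hP0, p, ?_, h3⟩
  rw [aN_idu, Fr_norm P hP hP0 p hpf.out hm hF]

lemma gen_K0 (h : Hyp η q r s) (B : Biq Q0 (Kf Q0 r (η * q * s)) r (η * q * s) (η * q * r * s) σ₁ σ₂ σ₃) (n : ℕ) :
    ∃ P : Id (T (Kf Q0 r (η * q * s)) n), ∀ H : Subgroup (A (Kf Q0 r (η * q * s))), ∀ Q : Id (Kf Q0 r (η * q * s)),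
      aN Q = aN P → cl _ Q ∈ H → cl _ (iMap σ₂ Q) ∈ H → H = ⊤ := by
  obtain ⟨P, p, hP, hsp⟩ := prime_T h B n
  refine ⟨P, fun H Q hQ h1 h2 => ?_⟩
  have hQp : aN Q = p := hQ.trans hP
  exact gen2 A_pgroup (cl _ Q) (cl _ (iMap σ₂ Q)) (Q_nsq h B Q p hQp hsp)
    (Q_nsq h B (iMap σ₂ Q) p ((aN_sig B.q2 Q).trans hQp) hsp)
    (by rw [← map_mul]; exact Q_nsq' h B Q p hQp hsp) (K0_rank h B) H h1 h2

theorem A_T (h : Hyp η q r s)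
    (hp : ∃ u : (Rq (η * q * r * s))ˣ, u ∈ (pr _).ker ∧ ∃ y : Rq (η * q * r * s), y ^ 2 = r * u ∨ y ^ 2 = s * u)
    (m : ℕ) (hm : Nat.card (A (Rq (η * q * r * s))) = 2 ^ (m + 1)) (n : ℕ) :
    Nonempty (A (T (Kf Q0 r (η * q * s)) n) ≃* Multiplicative (ZMod 2 × ZMod (2 ^ m))) := by
  obtain ⟨σ₁, σ₂, σ₃, B⟩ := biqK h
  obtain ⟨Q, p, hQ, hsp⟩ := prime_T h B 0
  obtain ⟨hc, hc2⟩ := K0_order h B hp Q p hQ hsp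
  have e0 : Nonempty (A (Kf Q0 r (η * q * s)) ≃* Multiplicative (ZMod 2 × ZMod (2 ^ m))) :=
    grp_final A_pgroup m (hc.trans hm) _ hc2 (Q_nsq' h B Q p hQ hsp) (K0_rank h B)
  cases n with
  | zero => exact e0
  | succ n =>
    obtain ⟨σ, -, -, -, -, -, h2p⟩ := kdata r h.hr8
    have hU : Uq (Kf Q0 r (η * q * s)) 2 := Uq_sqrt B.q1 h2p (coe_sq (η * q * s) (B.lb mem_ad)) (B.b1 _)
      (by have := modθ h.hη (qs_mod h); rwa [← mul_assoc] at this)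
    have h1 : Nat.card (A (T (Kf Q0 r (η * q * s)) 1)) ≤ Nat.card (A (Kf Q0 r (η * q * s))) := by
      rw [hc, A_congr (T_one_eq r (η * q * s))]; exact K1_card h hp
    obtain ⟨⟨N, ν, τ, D⟩, -⟩ := tower (two_notin h) σ₂ (gen_K0 h B) hU h1 n
    obtain ⟨e⟩ := e0
    exact ⟨(MulEquiv.ofBijective ν D.b).trans e⟩

lemma transfer {F G : IntermediateField ℚ ℝ} [NumberField G] (hFG : F = G) {X : Type} [CommGroup X]
    (e : Nonempty (A G ≃* X)) (P : Sylow 2 (ClassGroup (𝓞 F))) : Nonempty (P ≃* X) := by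
  subst hFG
  obtain ⟨e⟩ := e
  obtain ⟨e'⟩ := sylow_equiv P
  exact ⟨e'.trans e⟩

lemma h2_congr {F G : IntermediateField ℚ ℝ} [NumberField G] (hFG : F = G) : h2 F = Nat.card (A G) := by
  subst hFG; exact h2_eq F
end
end Wk

theorem statement_1 (η q r s : ℕ) [Fact q.Prime] [Fact r.Prime] [Fact s.Prime]
    (hη : η = 1 ∨ η = 2)
    (hq4 : q % 4 = 3) (hr8 : r % 8 = 5) (hs8 : s % 8 = 5)
    (hqr : legendreSym r q = (-1) ^ (if η = 2 then 1 else 0))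
    (hqs : legendreSym s q = (-1) ^ (if η = 2 then 1 else 0))
    (hrs : legendreSym s r = 1)
    (γ γ' : ℤ) (hγ : 0 < γ) (hγ' : 0 < γ')
    (hPell : γ ^ 2 - (η * q * r * s : ℕ) * γ' ^ 2 = 1)
    (hfund : ∀ a b : ℤ, 0 < a → 0 < b → a ^ 2 - (η * q * r * s : ℕ) * b ^ 2 = 1 → γ ≤ a)
    (hnsq : ¬ ∃ t : ℤ, 2 ^ (if η = 1 then 1 else 0) * (q : ℤ) * (γ - 1) = t ^ 2)
    (m : ℕ)
    (hm : h2 (IntermediateField.adjoin ℚ {Real.sqrt (η * q * r * s : ℕ)}) = 2 ^ (m + 1)) :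
    ∀ n : ℕ,
      ∀ P : Sylow 2 (ClassGroup (NumberField.RingOfIntegers
        (layer (IntermediateField.adjoin ℚ
          {Real.sqrt (r : ℕ), Real.sqrt (η * q * s : ℕ)}) n))),
      Nonempty (P ≃* Multiplicative (ZMod 2 × ZMod (2 ^ m))) := by
  intro n P
  have hz : ((-1) ^ (if η = 2 then 1 else 0) : ℤ) = Wk.ze η := by
    rcases hη with rfl | rfl <;> simp [Wk.ze]
  have h : Wk.Hyp η q r s := ⟨hη, hq4, hr8, hs8, hqr.trans hz, hqs.trans hz, hrs⟩
  have hp := Wk.pell h γ γ' hγ hγ' hPell hfund hnsq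
  have e1 : IntermediateField.adjoin ℚ {Real.sqrt (η * q * r * s : ℕ)} = Wk.Rq (η * q * r * s) := by
    simp only [Wk.Rq, Wk.Q0, Wk.ad, bot_sup_eq]
  rw [Wk.h2_congr e1] at hm
  exact Wk.transfer (by rw [Wk.K0_eq, Wk.layer_eq]) (Wk.A_T h hp m hm n) P
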